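/- arXiv:1912.04569 — 4 statements merged into one kernel-verified Lean document; each statement's English description precedes it below -/
import Mathlib

section
/- Every simple graph G on n ≥ 8 vertices with minimum degree at least ⌊n/2⌋ has at least (⌊n/2⌋)² distinct ordered pairs (s,t) of distinct vertices for which some spanning subgraph of G is a 2T-graph admitting an (s,t)-triple. -/
open SimpleGraph

universe u

variable {V : Type u}

/-- `T` is a spanning tree of `G`: a subgraph on the same vertex set which is
connected and acyclic. -/
def IsSpanningTree (G T : SimpleGraph V) : Prop :=
  T ≤ G ∧ T.Connected ∧ T.IsAcyclic

/-- A 2T-graph: a graph on at least two vertices whose edge set is the disjoint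
union of the edge sets of two edge-disjoint spanning trees. -/
def IsTwoT (G : SimpleGraph V) : Prop :=
  2 ≤ Nat.card V ∧
    ∃ I O : SimpleGraph V,
      IsSpanningTree G I ∧ IsSpanningTree G O ∧ I ⊓ O = ⊥ ∧ I ⊔ O = G

/-- An `(s,t)`-triple of `G`: a total (linear) order on the vertices together with two
edge-disjoint spanning trees `I` and `O` of `G` such that every vertex except `t` has a
larger neighbor in `I`, and every vertex except `s` has a smaller neighbor in `O`. -/
def HasSTTriple (G : SimpleGraph V) (s t : V) : Prop :=
  ∃ (r : LinearOrder V) (I O : SimpleGraph V),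
    IsSpanningTree G I ∧ IsSpanningTree G O ∧ I ⊓ O = ⊥ ∧
    (∀ v, v ≠ t → ∃ w, I.Adj v w ∧ r.lt v w) ∧
    (∀ v, v ≠ s → ∃ w, O.Adj v w ∧ r.lt w v)

/-- The degree of a vertex. -/
noncomputable def gdeg (G : SimpleGraph V) (v : V) : ℕ := (G.neighborSet v).ncard

/-- A quartic: a (simple) 2T-graph in which every vertex has degree 3 or 4. -/
def IsQuartic (G : SimpleGraph V) : Prop :=
  IsTwoT G ∧ ∀ v : V, gdeg G v = 3 ∨ gdeg G v = 4

/-- A transit of a quartic: a vertex of degree 3. -/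
def IsTransit (G : SimpleGraph V) (v : V) : Prop := gdeg G v = 3

/-- A quartic is excellent if it admits an `(s,t)`-triple for every pair of distinct
transits `s`, `t`. -/
def Excellent (G : SimpleGraph V) : Prop :=
  ∀ s t : V, IsTransit G s → IsTransit G t → s ≠ t → HasSTTriple G s t

/-- The edge neighborhood of a vertex set `S`: all edges of `G` with exactly one
endpoint in `S`. -/
def edgeNbhd (G : SimpleGraph V) (S : Set V) : Set (Sym2 V) :=
  {e | ∃ u v : V, e = s(u, v) ∧ G.Adj u v ∧ u ∈ S ∧ v ∉ S}

/-- A set of edges is a matching if no two distinct edges share an endpoint. -/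
def IsMatchingSet (M : Set (Sym2 V)) : Prop :=
  ∀ e ∈ M, ∀ f ∈ M, e ≠ f → ∀ v : V, v ∈ e → v ∉ f

/-- A quartic is normal if the edge neighborhood of every proper subquartic is a
matching of size 3 or 4. -/
def NormalQuartic (G : SimpleGraph V) : Prop :=
  ∀ H : G.Subgraph, IsQuartic H.coe → H ≠ ⊤ →
    IsMatchingSet (edgeNbhd G H.verts) ∧
      ((edgeNbhd G H.verts).ncard = 3 ∨ (edgeNbhd G H.verts).ncard = 4)

/-- A generic circuit: a 2T-graph with no proper subgraph which is a 2T-graph. -/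
def IsGenericCircuit (G : SimpleGraph V) : Prop :=
  IsTwoT G ∧ ∀ H : G.Subgraph, IsTwoT H.coe → H = ⊤

/-- Property (*): for every pair of distinct vertices `s, t` there is a spanning
subgraph which is a 2T-graph and admits an `(s,t)`-triple. -/
def PropertyStar (G : SimpleGraph V) : Prop :=
  ∀ s t : V, s ≠ t → ∃ H : SimpleGraph V, H ≤ G ∧ IsTwoT H ∧ HasSTTriple H s t

/-- `G` is obtained by identifying two disjoint copies of the complete graph `K_k`
at a single vertex. -/
def IsTwoCliquesAtVertex (G : SimpleGraph V) (k : ℕ) : Prop :=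
  ∃ (A B : Set V) (x : V), A ∩ B = {x} ∧ A ∪ B = Set.univ ∧ A.ncard = k ∧ B.ncard = k ∧
    ∀ u v : V, G.Adj u v ↔ u ≠ v ∧ ((u ∈ A ∧ v ∈ A) ∨ (u ∈ B ∧ v ∈ B))

open scoped Classical in
/-- The number of neighbors of `v` in `W`. -/
noncomputable def degIn (G : SimpleGraph V) (W : Finset V) (v : V) : ℕ :=
  (W.filter (G.Adj v)).card

/-- The vertices are ordered by `f`, and `c x y`, for an edge with `f x < f y`, says that this
edge is reserved for its lower end. Every vertex of `X` has a reserved edge going up inside `W`,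
and every vertex of `Y` has a reserved edge going down inside `W`. -/
def Covers (G : SimpleGraph V) (f : V → ℚ) (c : V → V → Prop) (W X Y : Set V) : Prop :=
  (∀ v ∈ X, ∃ w ∈ W, G.Adj v w ∧ f v < f w ∧ c v w) ∧
    ∀ v ∈ Y, ∃ w ∈ W, G.Adj v w ∧ f w < f v ∧ ¬ c w v

/-- All vertices of `W`, up to the obvious exceptions `t` and `s`, have a reserved edge going up
and a reserved edge going down. -/
def Full (G : SimpleGraph V) (W : Finset V) (s t : V) : Prop :=
  ∃ (f : V → ℚ) (c : V → V → Prop), Function.Injective f ∧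
    Covers G f c W (W \ {t}) (W \ {s})

/-- For a fixed order of the vertices with first vertex `s` and last vertex `t`, all demands
of the vertices of `W` can be met, up to a single one which may be prescribed. -/
def Slack (G : SimpleGraph V) (W : Finset V) (s t : V) : Prop :=
  s ∈ W ∧ t ∈ W ∧ ∃ f : V → ℚ, Function.Injective f ∧ (∀ w ∈ W, w ≠ s → f s < f w) ∧
    (∀ w ∈ W, w ≠ t → f w < f t) ∧
    (∀ x ∈ W, x ≠ t → ∃ c, Covers G f c W ((W \ {t}) \ {x}) (W \ {s})) ∧
    ∀ y ∈ W, y ≠ s → ∃ c, Covers G f c W (W \ {t}) ((W \ {s}) \ {y})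

section Trees

/-- The graph joining every vertex other than `t` to its image under `p`. -/
def parentGraph (p : V → V) (t : V) : SimpleGraph V :=
  SimpleGraph.fromRel fun x y => x ≠ t ∧ p x = y

lemma parentGraph_isTree [Fintype V] (f : V → ℚ) (p : V → V) (t : V)
    (hp : ∀ v, v ≠ t → f v < f (p v)) : (parentGraph p t).IsTree := by
  classical
  have hadj : ∀ v, v ≠ t → (parentGraph p t).Adj v (p v) := by
    intro v hv
    rw [parentGraph, SimpleGraph.fromRel_adj]
    refine ⟨fun h => ?_, Or.inl ⟨hv, rfl⟩⟩
    have := hp v hv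
    rw [← h] at this
    exact lt_irrefl _ this
  have hreach : ∀ v, (parentGraph p t).Reachable v t := by
    have hwf : WellFounded fun x y : V => f y < f x := by
      have : IsTrans V fun x y => f y < f x := ⟨fun a b c h h' => h'.trans h⟩
      have : Std.Irrefl fun x y : V => f y < f x := ⟨fun a => lt_irrefl _⟩
      exact Finite.wellFounded_of_trans_of_irrefl _
    intro v
    induction v using hwf.induction with
    | _ v ih =>
      by_cases hv : v = t
      · rw [hv]
      · exact (hadj v hv).reachable.trans (ih _ (hp v hv))
  have hconn : (parentGraph p t).Connected :=
    { preconnected := fun u v => (hreach u).trans (hreach v).symm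
      nonempty := ⟨t⟩ }
  rw [SimpleGraph.isTree_iff_connected_and_card]
  refine ⟨hconn, le_antisymm ?_ hconn.card_vert_le_card_edgeSet_add_one⟩
  have hsub : (parentGraph p t).edgeSet ⊆
      ((Finset.univ.erase t).image fun v => s(v, p v) : Finset (Sym2 V)) := by
    intro e
    induction e with
    | _ x y =>
      rw [SimpleGraph.mem_edgeSet, parentGraph, SimpleGraph.fromRel_adj]
      rintro ⟨-, ⟨h, rfl⟩ | ⟨h, rfl⟩⟩
      · exact Finset.mem_coe.2 (Finset.mem_image.2 ⟨x, by simpa using h, rfl⟩)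
      · exact Finset.mem_coe.2 (Finset.mem_image.2 ⟨y, by simpa using h, Sym2.eq_swap⟩)
  have h1 := Set.ncard_le_ncard hsub (Finset.finite_toSet _)
  rw [Set.ncard_coe_finset] at h1
  have h2 := h1.trans Finset.card_image_le
  rw [Finset.card_erase_of_mem (Finset.mem_univ t), Finset.card_univ] at h2
  have h3 : 0 < Fintype.card V := Fintype.card_pos_iff.2 ⟨t⟩
  rw [Nat.card_eq_fintype_card (α := V), Nat.card_coe_set_eq]
  omega

lemma Full.exists_isTwoT [Fintype V] {G : SimpleGraph V} {s t : V}
    (h : Full G Finset.univ s t) (hn : 2 ≤ Fintype.card V) :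
    ∃ H : SimpleGraph V, H ≤ G ∧ IsTwoT H ∧ HasSTTriple H s t := by
  obtain ⟨f, c, hf, hX, hY⟩ := h
  have hX' : ∀ v, ∃ w, v ≠ t → G.Adj v w ∧ f v < f w ∧ c v w := fun v => by
    by_cases hv : v = t
    · exact ⟨v, fun h => absurd hv h⟩
    · obtain ⟨w, -, hw⟩ := hX v (by simpa using hv)
      exact ⟨w, fun _ => hw⟩
  have hY' : ∀ v, ∃ w, v ≠ s → G.Adj v w ∧ f w < f v ∧ ¬ c w v := fun v => by
    by_cases hv : v = s
    · exact ⟨v, fun h => absurd hv h⟩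
    · obtain ⟨w, -, hw⟩ := hY v (by simpa using hv)
      exact ⟨w, fun _ => hw⟩
  choose p hp using hX'
  choose q hq using hY'
  have hI : (parentGraph p t).IsTree := parentGraph_isTree f p t fun v hv => (hp v hv).2.1
  have hO : (parentGraph q s).IsTree :=
    parentGraph_isTree (fun v => - f v) q s fun v hv => neg_lt_neg (hq v hv).2.1
  have hIG : parentGraph p t ≤ G := by
    intro x y
    rw [parentGraph, SimpleGraph.fromRel_adj]
    rintro ⟨-, ⟨h, rfl⟩ | ⟨h, rfl⟩⟩
    exacts [(hp _ h).1, (hp _ h).1.symm]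
  have hOG : parentGraph q s ≤ G := by
    intro x y
    rw [parentGraph, SimpleGraph.fromRel_adj]
    rintro ⟨-, ⟨h, rfl⟩ | ⟨h, rfl⟩⟩
    exacts [(hq _ h).1, (hq _ h).1.symm]
  have key : ∀ x y, x ≠ t → p x = y → y ≠ s → q y = x → False := by
    rintro x y hx rfl hy hqx
    have h1 := (hp x hx).2.2
    have h2 := (hq _ hy).2.2
    rw [hqx] at h2
    exact h2 h1
  have key' : ∀ x y, x ≠ t → p x = y → x ≠ s → q x = y → False := by
    rintro x y hx rfl hy hqx
    have h1 := (hp x hx).2.1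
    have h2 := (hq _ hy).2.1
    rw [hqx] at h2
    exact lt_asymm h1 h2
  have hdisj : parentGraph p t ⊓ parentGraph q s = ⊥ := by
    rw [eq_bot_iff]
    rintro x y ⟨h1, h2⟩
    rw [parentGraph, SimpleGraph.fromRel_adj] at h1 h2
    exfalso
    rcases h1.2 with ⟨a, b⟩ | ⟨a, b⟩ <;> rcases h2.2 with ⟨a', b'⟩ | ⟨a', b'⟩
    · exact key' _ _ a b a' b'
    · exact key _ _ a b a' b'
    · exact key _ _ a b a' b'
    · exact key' _ _ a b a' b'
  have hIs : IsSpanningTree (parentGraph p t ⊔ parentGraph q s) (parentGraph p t) :=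
    ⟨le_sup_left, hI.1, hI.2⟩
  have hOs : IsSpanningTree (parentGraph p t ⊔ parentGraph q s) (parentGraph q s) :=
    ⟨le_sup_right, hO.1, hO.2⟩
  refine ⟨parentGraph p t ⊔ parentGraph q s, sup_le hIG hOG,
    ⟨by rwa [Nat.card_eq_fintype_card], _, _, hIs, hOs, hdisj, rfl⟩,
    LinearOrder.lift' f hf, _, _, hIs, hOs, hdisj, fun v hv => ⟨p v, ?_, (hp v hv).2.1⟩,
    fun v hv => ⟨q v, ?_, (hq v hv).2.1⟩⟩
  · rw [parentGraph, SimpleGraph.fromRel_adj]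
    exact ⟨(hp v hv).1.ne, Or.inl ⟨hv, rfl⟩⟩
  · rw [parentGraph, SimpleGraph.fromRel_adj]
    exact ⟨(hq v hv).1.ne, Or.inl ⟨hv, rfl⟩⟩

end Trees

section Extension

variable {G : SimpleGraph V} {f : V → ℚ} {c : V → V → Prop} {W : Finset V} {s t v : V}

lemma exists_lt_lt_notMem_range [Finite V] (f : V → ℚ) {a b : ℚ} (h : a < b) :
    ∃ z, a < z ∧ z < b ∧ z ∉ Set.range f := by
  obtain ⟨z, hz, hz'⟩ := (Set.Ioo_infinite h).exists_notMem_finite (Set.finite_range f)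
  exact ⟨z, hz.1, hz.2, hz'⟩

lemma exists_lt_notMem_range [Finite V] (f : V → ℚ) : ∃ z, (∀ v, z < f v) ∧ z ∉ Set.range f := by
  obtain ⟨m, hm⟩ := (Set.finite_range f).bddBelow
  have : ∀ v, m - 1 < f v := fun v => (sub_one_lt m).trans_le (hm ⟨v, rfl⟩)
  exact ⟨m - 1, this, fun ⟨v, hv⟩ => (this v).ne' hv⟩

lemma injective_update_of_notMem_range [DecidableEq V] (hf : Function.Injective f) {z : ℚ}
    (hz : z ∉ Set.range f) : Function.Injective (Function.update f v z) := by
  intro x y hxy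
  by_cases hx : x = v <;> by_cases hy : y = v
  · rw [hx, hy]
  · subst hx
    rw [Function.update_self, Function.update_of_ne hy] at hxy
    exact absurd ⟨y, hxy.symm⟩ hz
  · subst hy
    rw [Function.update_self, Function.update_of_ne hx] at hxy
    exact absurd ⟨x, hxy⟩ hz
  · rw [Function.update_of_ne hx, Function.update_of_ne hy] at hxy
    exact hf hxy

lemma Covers.reverse {W X Y : Set V} (h : Covers G f c W X Y) :
    Covers G (fun v => - f v) (fun x y => ¬ c y x) W Y X := by
  refine ⟨fun v hv => ?_, fun v hv => ?_⟩
  · obtain ⟨w, hw, h1, h2, h3⟩ := h.2 v hv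
    exact ⟨w, hw, h1, neg_lt_neg h2, h3⟩
  · obtain ⟨w, hw, h1, h2, h3⟩ := h.1 v hv
    exact ⟨w, hw, h1, neg_lt_neg h2, not_not.2 h3⟩

lemma Full.reverse (h : Full G W s t) : Full G W t s := by
  obtain ⟨f, c, hf, hc⟩ := h
  exact ⟨_, _, neg_injective.comp hf, hc.reverse⟩

lemma Slack.reverse (h : Slack G W s t) : Slack G W t s := by
  obtain ⟨hs, ht, f, hf, h1, h2, h3, h4⟩ := h
  refine ⟨ht, hs, _, neg_injective.comp hf, fun w hw hwt => neg_lt_neg (h2 w hw hwt),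
    fun w hw hws => neg_lt_neg (h1 w hw hws), fun x hx hxs => ?_, fun y hy hyt => ?_⟩
  · obtain ⟨c, hc⟩ := h4 x hx hxs
    exact ⟨_, hc.reverse⟩
  · obtain ⟨c, hc⟩ := h3 y hy hyt
    exact ⟨_, hc.reverse⟩

/-- A new vertex `v` is placed at height `z`; the edges from `v` to the vertices satisfying `P`
are reserved for their end in `W`, the other ones for `v`. -/
lemma Covers.extend [DecidableEq V] {W X Y X' Y' : Set V} (h : Covers G f c W X Y) (hv : v ∉ W)
    (z : ℚ) (P : V → Prop)
    (hX : ∀ x ∈ X', (x = v ∧ ∃ w ∈ W, G.Adj v w ∧ z < f w ∧ ¬ P w) ∨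
      x ∈ W ∧ (x ∈ X ∨ G.Adj v x ∧ f x < z ∧ P x))
    (hY : ∀ y ∈ Y', (y = v ∧ ∃ w ∈ W, G.Adj v w ∧ f w < z ∧ ¬ P w) ∨
      y ∈ W ∧ (y ∈ Y ∨ G.Adj v y ∧ z < f y ∧ P y)) :
    Covers G (Function.update f v z)
      (fun x y => if y = v then P x else if x = v then ¬ P y else c x y) (insert v W) X' Y' := by
  have hne : ∀ {w}, w ∈ W → w ≠ v := fun hw h => hv (h ▸ hw)
  refine ⟨fun x hx => ?_, fun y hy => ?_⟩
  · rcases hX x hx with ⟨rfl, w, hw, h1, h2, h3⟩ | ⟨hxW, hx' | ⟨h1, h2, h3⟩⟩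
    · exact ⟨w, Or.inr hw, h1, by simpa [hne hw] using h2, by simpa [hne hw] using h3⟩
    · obtain ⟨w, hw, h1, h2, h3⟩ := h.1 x hx'
      exact ⟨w, Or.inr hw, h1, by simpa [hne hw, hne hxW] using h2,
        by simpa [hne hw, hne hxW] using h3⟩
    · exact ⟨v, Or.inl rfl, h1.symm, by simpa [hne hxW] using h2, by simpa using h3⟩
  · rcases hY y hy with ⟨rfl, w, hw, h1, h2, h3⟩ | ⟨hyW, hy' | ⟨h1, h2, h3⟩⟩
    · exact ⟨w, Or.inr hw, h1, by simpa [hne hw] using h2, by simpa using h3⟩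
    · obtain ⟨w, hw, h1, h2, h3⟩ := h.2 y hy'
      exact ⟨w, Or.inr hw, h1, by simpa [hne hw, hne hyW] using h2,
        by simpa [hne hw, hne hyW] using h3⟩
    · exact ⟨v, Or.inl rfl, h1.symm, by simpa [hne hyW] using h2, by simpa [hne hyW] using h3⟩

lemma exists_lt_of_two_le_degIn (hf : Function.Injective f) (h : 2 ≤ degIn G W v) :
    ∃ a ∈ W, ∃ b ∈ W, G.Adj v a ∧ G.Adj v b ∧ f a < f b := by
  classical
  obtain ⟨a, ha, b, hb, hab⟩ := Finset.one_lt_card.1 h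
  rw [Finset.mem_filter] at ha hb
  rcases lt_or_gt_of_ne (hf.ne hab) with h | h
  · exact ⟨a, ha.1, b, hb.1, ha.2, hb.2, h⟩
  · exact ⟨b, hb.1, a, ha.1, hb.2, ha.2, h⟩

lemma exists_lt_lt_of_three_le_degIn (hf : Function.Injective f) (h : 3 ≤ degIn G W v) :
    ∃ a ∈ W, ∃ m ∈ W, ∃ b ∈ W,
      G.Adj v a ∧ G.Adj v m ∧ G.Adj v b ∧ f a < f m ∧ f m < f b := by
  classical
  obtain ⟨x, y, z, hx, hy, hz, hxy, hxz, hyz⟩ := Finset.two_lt_card_iff.1 h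
  rw [Finset.mem_filter] at hx hy hz
  rcases lt_or_gt_of_ne (hf.ne hxy) with h1 | h1 <;>
  rcases lt_or_gt_of_ne (hf.ne hxz) with h2 | h2 <;>
  rcases lt_or_gt_of_ne (hf.ne hyz) with h3 | h3
  · exact ⟨x, hx.1, y, hy.1, z, hz.1, hx.2, hy.2, hz.2, h1, h3⟩
  · exact ⟨x, hx.1, z, hz.1, y, hy.1, hx.2, hz.2, hy.2, h2, h3⟩
  · exact absurd (h1.trans h3) (lt_asymm h2)
  · exact ⟨z, hz.1, x, hx.1, y, hy.1, hz.2, hx.2, hy.2, h2, h1⟩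
  · exact ⟨y, hy.1, x, hx.1, z, hz.1, hy.2, hx.2, hz.2, h1, h2⟩
  · exact absurd (h1.trans h2) (lt_asymm h3)
  · exact ⟨y, hy.1, z, hz.1, x, hx.1, hy.2, hz.2, hx.2, h3, h2⟩
  · exact ⟨z, hz.1, y, hy.1, x, hx.1, hz.2, hy.2, hx.2, h3, h1⟩

variable [Finite V] [DecidableEq V]

lemma Full.insert_mid (h : Full G W s t) (hv : v ∉ W) (hd : 2 ≤ degIn G W v) :
    Full G (insert v W) s t := by
  obtain ⟨f, c, hf, hc⟩ := h
  obtain ⟨a, ha, b, hb, hva, hvb, hab⟩ := exists_lt_of_two_le_degIn hf hd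
  obtain ⟨z, haz, hzb, hz⟩ := exists_lt_lt_notMem_range f hab
  rw [Full, Finset.coe_insert]
  refine ⟨_, _, injective_update_of_notMem_range hf hz, hc.extend hv z (fun x => x ≠ a ∧ x ≠ b) ?_ ?_⟩
  · rintro x ⟨rfl | hx, hxt⟩
    · exact Or.inl ⟨rfl, b, hb, hvb, hzb, by simp⟩
    · exact Or.inr ⟨hx, Or.inl ⟨hx, hxt⟩⟩
  · rintro x ⟨rfl | hx, hxt⟩
    · exact Or.inl ⟨rfl, a, ha, hva, haz, by simp⟩
    · exact Or.inr ⟨hx, Or.inl ⟨hx, hxt⟩⟩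

lemma Full.insert_first (h : Full G W s t) (hsW : s ∈ W) (hv : v ∉ W) (hvs : G.Adj v s)
    (hd : 2 ≤ degIn G W v) : Full G (insert v W) v t := by
  classical
  obtain ⟨f, c, hf, hc⟩ := h
  obtain ⟨u, hu, hus⟩ := Finset.exists_mem_ne hd s
  rw [Finset.mem_filter] at hu
  obtain ⟨z, hzf, hz⟩ := exists_lt_notMem_range f
  rw [Full, Finset.coe_insert]
  refine ⟨_, _, injective_update_of_notMem_range hf hz, hc.extend hv z (fun x => x ≠ u) ?_ ?_⟩
  · rintro x ⟨rfl | hx, hxt⟩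
    · exact Or.inl ⟨rfl, u, hu.1, hu.2, hzf u, by simp⟩
    · exact Or.inr ⟨hx, Or.inl ⟨hx, hxt⟩⟩
  · rintro x ⟨rfl | hx, hxt⟩
    · exact absurd rfl hxt
    · by_cases hxs : x = s
      · subst hxs
        exact Or.inr ⟨hx, Or.inr ⟨hvs, hzf _, hus.symm⟩⟩
      · exact Or.inr ⟨hx, Or.inl ⟨hx, hxs⟩⟩

lemma Slack.insert_mid (h : Slack G W s t) (hv : v ∉ W) (hd : 2 ≤ degIn G W v) :
    Slack G (insert v W) s t := by
  obtain ⟨hs, ht, f, hf, hmin, hmax, hup, hdown⟩ := h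
  obtain ⟨a, ha, b, hb, hva, hvb, hab⟩ := exists_lt_of_two_le_degIn hf hd
  obtain ⟨z, haz, hzb, hz⟩ := exists_lt_lt_notMem_range f hab
  have hne : ∀ {w}, w ∈ W → w ≠ v := fun hw h => hv (h ▸ hw)
  have hat : a ≠ t := by
    rintro rfl
    exact lt_asymm hab (hmax b hb (fun h => (h ▸ hab).false))
  have hbs : b ≠ s := by
    rintro rfl
    exact lt_asymm hab (hmin a ha (fun h => (h ▸ hab).false))
  have hsz : f s < z := by
    by_cases h : a = s
    · rwa [← h]
    · exact (hmin a ha h).trans haz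
  have hzt : z < f t := by
    by_cases h : b = t
    · rwa [← h]
    · exact hzb.trans (hmax b hb h)
  refine ⟨Finset.mem_insert_of_mem hs, Finset.mem_insert_of_mem ht, _,
    injective_update_of_notMem_range hf hz (v := v), ?_, ?_, ?_, ?_⟩
  · intro w hw hws
    rcases Finset.mem_insert.1 hw with rfl | hw
    · simpa [hne hs] using hsz
    · simpa [hne hs, hne hw] using hmin w hw hws
  · intro w hw hwt
    rcases Finset.mem_insert.1 hw with rfl | hw
    · simpa [hne ht] using hzt
    · simpa [hne ht, hne hw] using hmax w hw hwt
  · intro x hx hxt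
    rw [Finset.coe_insert]
    rcases Finset.mem_insert.1 hx with rfl | hx
    · obtain ⟨c, hc⟩ := hdown b hb hbs
      refine ⟨_, hc.extend hv z (fun y => y ≠ a) ?_ ?_⟩
      · rintro y ⟨⟨rfl | hy, hyt⟩, hyx⟩
        · exact absurd rfl hyx
        · exact Or.inr ⟨hy, Or.inl ⟨hy, hyt⟩⟩
      · rintro y ⟨rfl | hy, hys⟩
        · exact Or.inl ⟨rfl, a, ha, hva, haz, by simp⟩
        · by_cases hyb : y = b
          · subst hyb
            exact Or.inr ⟨hy, Or.inr ⟨hvb, hzb, fun h => (h ▸ hab).false⟩⟩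
          · exact Or.inr ⟨hy, Or.inl ⟨⟨hy, hys⟩, hyb⟩⟩
    · obtain ⟨c, hc⟩ := hup x hx hxt
      refine ⟨_, hc.extend hv z (fun y => y ≠ a ∧ y ≠ b) ?_ ?_⟩
      · rintro y ⟨⟨rfl | hy, hyt⟩, hyx⟩
        · exact Or.inl ⟨rfl, b, hb, hvb, hzb, by simp⟩
        · exact Or.inr ⟨hy, Or.inl ⟨⟨hy, hyt⟩, hyx⟩⟩
      · rintro y ⟨rfl | hy, hys⟩
        · exact Or.inl ⟨rfl, a, ha, hva, haz, by simp⟩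
        · exact Or.inr ⟨hy, Or.inl ⟨hy, hys⟩⟩
  · intro x hx hxs
    rw [Finset.coe_insert]
    rcases Finset.mem_insert.1 hx with rfl | hx
    · obtain ⟨c, hc⟩ := hup a ha hat
      refine ⟨_, hc.extend hv z (fun y => y ≠ b) ?_ ?_⟩
      · rintro y ⟨rfl | hy, hyt⟩
        · exact Or.inl ⟨rfl, b, hb, hvb, hzb, by simp⟩
        · by_cases hya : y = a
          · subst hya
            exact Or.inr ⟨hy, Or.inr ⟨hva, haz, fun h => (h ▸ hab).false⟩⟩
          · exact Or.inr ⟨hy, Or.inl ⟨⟨hy, hyt⟩, hya⟩⟩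
      · rintro y ⟨⟨rfl | hy, hys⟩, hyx⟩
        · exact absurd rfl hyx
        · exact Or.inr ⟨hy, Or.inl ⟨hy, hys⟩⟩
    · obtain ⟨c, hc⟩ := hdown x hx hxs
      refine ⟨_, hc.extend hv z (fun y => y ≠ a ∧ y ≠ b) ?_ ?_⟩
      · rintro y ⟨rfl | hy, hyt⟩
        · exact Or.inl ⟨rfl, b, hb, hvb, hzb, by simp⟩
        · exact Or.inr ⟨hy, Or.inl ⟨hy, hyt⟩⟩
      · rintro y ⟨⟨rfl | hy, hys⟩, hyx⟩
        · exact Or.inl ⟨rfl, a, ha, hva, haz, by simp⟩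
        · exact Or.inr ⟨hy, Or.inl ⟨⟨hy, hys⟩, hyx⟩⟩

lemma Slack.full_insert (h : Slack G W s t) (hv : v ∉ W) (hd : 3 ≤ degIn G W v) :
    Full G (insert v W) s t := by
  obtain ⟨-, -, f, hf, -, hmax, hup, -⟩ := h
  obtain ⟨a, ha, m, hm, b, hb, hva, hvm, hvb, ham, hmb⟩ := exists_lt_lt_of_three_le_degIn hf hd
  obtain ⟨z, hmz, hzb, hz⟩ := exists_lt_lt_notMem_range f hmb
  have hmt : m ≠ t := by
    rintro rfl
    exact lt_asymm hmb (hmax b hb (fun h => (h ▸ hmb).false))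
  obtain ⟨c, hc⟩ := hup m hm hmt
  rw [Full, Finset.coe_insert]
  refine ⟨_, _, injective_update_of_notMem_range hf hz, hc.extend hv z (fun x => x ≠ a ∧ x ≠ b) ?_ ?_⟩
  · rintro x ⟨rfl | hx, hxt⟩
    · exact Or.inl ⟨rfl, b, hb, hvb, hzb, by simp⟩
    · by_cases hxm : x = m
      · subst hxm
        exact Or.inr ⟨hx, Or.inr ⟨hvm, hmz, fun h => (h ▸ ham).false, fun h => (h ▸ hmb).false⟩⟩
      · exact Or.inr ⟨hx, Or.inl ⟨⟨hx, hxt⟩, hxm⟩⟩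
  · rintro x ⟨rfl | hx, hxt⟩
    · exact Or.inl ⟨rfl, a, ha, hva, ham.trans hmz, by simp⟩
    · exact Or.inr ⟨hx, Or.inl ⟨hx, hxt⟩⟩

lemma Slack.insert_first (h : Slack G W s t) (hv : v ∉ W) (hvs : G.Adj v s)
    (hd : 2 ≤ degIn G W v) : Slack G (insert v W) v t := by
  classical
  obtain ⟨hs, ht, f, hf, -, hmax, hup, hdown⟩ := h
  obtain ⟨u, hu, hus⟩ := Finset.exists_mem_ne hd s
  rw [Finset.mem_filter] at hu
  obtain ⟨z, hzf, hz⟩ := exists_lt_notMem_range f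
  have hne : ∀ {w}, w ∈ W → w ≠ v := fun hw h => hv (h ▸ hw)
  refine ⟨Finset.mem_insert_self _ _, Finset.mem_insert_of_mem ht, _,
    injective_update_of_notMem_range hf hz (v := v), ?_, ?_, ?_, ?_⟩
  · intro w hw hws
    rcases Finset.mem_insert.1 hw with rfl | hw
    · exact absurd rfl hws
    · simpa [hne hw] using hzf w
  · intro w hw hwt
    rcases Finset.mem_insert.1 hw with rfl | hw
    · simpa [hne ht] using hzf t
    · simpa [hne ht, hne hw] using hmax w hw hwt
  · intro x hx hxt
    rw [Finset.coe_insert]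
    rcases Finset.mem_insert.1 hx with rfl | hx
    · obtain ⟨c, hc⟩ := hdown u hu.1 hus
      refine ⟨_, hc.extend hv z (fun y => True) ?_ ?_⟩
      · rintro y ⟨⟨rfl | hy, hyt⟩, hyx⟩
        · exact absurd rfl hyx
        · exact Or.inr ⟨hy, Or.inl ⟨hy, hyt⟩⟩
      · rintro y ⟨rfl | hy, hyx⟩
        · exact absurd rfl hyx
        · by_cases hys : y = s
          · subst hys
            exact Or.inr ⟨hy, Or.inr ⟨hvs, hzf _, trivial⟩⟩
          · by_cases hyu : y = u
            · subst hyu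
              exact Or.inr ⟨hy, Or.inr ⟨hu.2, hzf _, trivial⟩⟩
            · exact Or.inr ⟨hy, Or.inl ⟨⟨hy, hys⟩, hyu⟩⟩
    · obtain ⟨c, hc⟩ := hup x hx hxt
      refine ⟨_, hc.extend hv z (fun y => y ≠ u) ?_ ?_⟩
      · rintro y ⟨⟨rfl | hy, hyt⟩, hyx⟩
        · exact Or.inl ⟨rfl, u, hu.1, hu.2, hzf _, by simp⟩
        · exact Or.inr ⟨hy, Or.inl ⟨⟨hy, hyt⟩, hyx⟩⟩
      · rintro y ⟨rfl | hy, hyx⟩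
        · exact absurd rfl hyx
        · by_cases hys : y = s
          · subst hys
            exact Or.inr ⟨hy, Or.inr ⟨hvs, hzf _, hus.symm⟩⟩
          · exact Or.inr ⟨hy, Or.inl ⟨hy, hys⟩⟩
  · intro x hx hxv
    rw [Finset.coe_insert]
    replace hx : x ∈ W := Finset.mem_of_mem_insert_of_ne hx hxv
    by_cases hxs : x = s
    · subst hxs
      obtain ⟨c, hc⟩ := hdown u hu.1 hus
      refine ⟨_, hc.extend hv z (fun y => y ≠ x) ?_ ?_⟩
      · rintro y ⟨rfl | hy, hyt⟩
        · exact Or.inl ⟨rfl, x, hx, hvs, hzf _, by simp⟩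
        · exact Or.inr ⟨hy, Or.inl ⟨hy, hyt⟩⟩
      · rintro y ⟨⟨rfl | hy, hyv⟩, hyx⟩
        · exact absurd rfl hyv
        · by_cases hyu : y = u
          · subst hyu
            exact Or.inr ⟨hy, Or.inr ⟨hu.2, hzf _, hus⟩⟩
          · exact Or.inr ⟨hy, Or.inl ⟨⟨hy, hyx⟩, hyu⟩⟩
    · obtain ⟨c, hc⟩ := hdown x hx hxs
      refine ⟨_, hc.extend hv z (fun y => y ≠ u) ?_ ?_⟩
      · rintro y ⟨rfl | hy, hyt⟩
        · exact Or.inl ⟨rfl, u, hu.1, hu.2, hzf _, by simp⟩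
        · exact Or.inr ⟨hy, Or.inl ⟨hy, hyt⟩⟩
      · rintro y ⟨⟨rfl | hy, hyv⟩, hyx⟩
        · exact absurd rfl hyv
        · by_cases hys : y = s
          · subst hys
            exact Or.inr ⟨hy, Or.inr ⟨hvs, hzf _, hus.symm⟩⟩
          · exact Or.inr ⟨hy, Or.inl ⟨⟨hy, hys⟩, hyx⟩⟩

lemma Slack.full_insert_first (h : Slack G W s t) (hv : v ∉ W) (hvs : G.Adj v s)
    (hd : 3 ≤ degIn G W v) : Full G (insert v W) v t := by
  classical
  obtain ⟨hs, -, f, hf, -, -, -, hdown⟩ := h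
  obtain ⟨u, hu, hus⟩ := Finset.exists_mem_ne (one_lt_two.trans hd) s
  obtain ⟨u', hu', hne⟩ : ∃ u' ∈ W.filter (G.Adj v), u' ∉ ({s, u} : Finset V) :=
    Finset.exists_mem_notMem_of_card_lt_card (Finset.card_le_two.trans_lt hd)
  rw [Finset.mem_insert, Finset.mem_singleton, not_or] at hne
  rw [Finset.mem_filter] at hu hu'
  obtain ⟨z, hzf, hz⟩ := exists_lt_notMem_range f
  obtain ⟨c, hc⟩ := hdown u hu.1 hus
  rw [Full, Finset.coe_insert]
  refine ⟨_, _, injective_update_of_notMem_range hf hz, hc.extend hv z (fun y => y ≠ u') ?_ ?_⟩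
  · rintro y ⟨rfl | hy, hyt⟩
    · exact Or.inl ⟨rfl, u', hu'.1, hu'.2, hzf _, by simp⟩
    · exact Or.inr ⟨hy, Or.inl ⟨hy, hyt⟩⟩
  · rintro y ⟨rfl | hy, hyx⟩
    · exact absurd rfl hyx
    · by_cases hys : y = s
      · subst hys
        exact Or.inr ⟨hy, Or.inr ⟨hvs, hzf _, Ne.symm hne.1⟩⟩
      · by_cases hyu : y = u
        · subst hyu
          exact Or.inr ⟨hy, Or.inr ⟨hu.2, hzf _, Ne.symm hne.2⟩⟩
        · exact Or.inr ⟨hy, Or.inl ⟨⟨hy, hys⟩, hyu⟩⟩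

end Extension

section Order

variable {G : SimpleGraph V} {m : ℕ} {φ : Fin m → V} {f : V → ℚ}

lemma exists_injective_strictMono_comp [Finite V] (hφ : Function.Injective φ) :
    ∃ f : V → ℚ, Function.Injective f ∧ StrictMono (f ∘ φ) := by
  obtain ⟨n, ⟨e⟩⟩ := Finite.exists_equiv_fin V
  have hval : ∀ i, Function.extend φ (fun i => (i : ℚ) - m) (fun v => (e v : ℚ)) (φ i) =
    (i : ℚ) - m := fun i => hφ.extend_apply _ _ i
  have hneg : ∀ i : Fin m, ((i : ℕ) : ℚ) - m < 0 := fun i => sub_neg.2 (by exact_mod_cast i.2)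
  refine ⟨Function.extend φ (fun i => (i : ℚ) - m) (fun v => (e v : ℚ)), fun x y hxy => ?_,
    fun i j hij => ?_⟩
  · by_cases hx : ∃ i, φ i = x <;> by_cases hy : ∃ i, φ i = y
    · obtain ⟨i, rfl⟩ := hx
      obtain ⟨j, rfl⟩ := hy
      rw [hval, hval] at hxy
      have : (i : ℕ) = j := by exact_mod_cast sub_left_injective hxy
      rw [Fin.ext this]
    · obtain ⟨i, rfl⟩ := hx
      rw [hval, Function.extend_apply' _ _ _ hy] at hxy
      exact absurd (hneg i) (by rw [hxy]; exact not_lt.2 (Nat.cast_nonneg _))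
    · obtain ⟨i, rfl⟩ := hy
      rw [hval, Function.extend_apply' _ _ _ hx] at hxy
      exact absurd (hneg i) (by rw [← hxy]; exact not_lt.2 (Nat.cast_nonneg _))
    · rw [Function.extend_apply' _ _ _ hx, Function.extend_apply' _ _ _ hy] at hxy
      exact e.injective (Fin.ext (by exact_mod_cast hxy))
  · simp only [Function.comp_apply, hval]
    exact sub_lt_sub_right (by exact_mod_cast hij) _

/-- A system of reserved edges along an explicit enumeration. -/
lemma exists_covers_range (hf : StrictMono (f ∘ φ)) (up down : Fin m → Fin m)
    {A B : Fin m → Prop} (hup : ∀ i, A i → i < up i ∧ G.Adj (φ i) (φ (up i)))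
    (hdown : ∀ i, B i → down i < i ∧ G.Adj (φ i) (φ (down i)))
    (hdisj : ∀ i, A i → B (up i) → down (up i) ≠ i) {X Y : Set V}
    (hX : ∀ x ∈ X, ∃ i, A i ∧ φ i = x) (hY : ∀ y ∈ Y, ∃ i, B i ∧ φ i = y) :
    ∃ c, Covers G f c (Set.range φ) X Y := by
  have hφ : Function.Injective φ := hf.injective.of_comp
  refine ⟨fun x y => ∃ i, A i ∧ φ i = x ∧ φ (up i) = y, fun x hx => ?_, fun y hy => ?_⟩
  · obtain ⟨i, hi, rfl⟩ := hX x hx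
    exact ⟨_, ⟨up i, rfl⟩, (hup i hi).2, hf (hup i hi).1, i, hi, rfl, rfl⟩
  · obtain ⟨j, hj, rfl⟩ := hY y hy
    refine ⟨_, ⟨down j, rfl⟩, (hdown j hj).2, hf (hdown j hj).1, ?_⟩
    rintro ⟨i, hi, h1, h2⟩
    have h1 := hφ h1
    have h2 := hφ h2
    subst h2
    exact hdisj i hi hj h1.symm

lemma slack_pair [Finite V] [DecidableEq V] {s t : V} (h : G.Adj s t) :
    Slack G {s, t} s t := by
  have hφ : Function.Injective ![s, t] := by
    intro i j
    fin_cases i <;> fin_cases j <;> simp [h.ne, h.ne']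
  obtain ⟨f, hf, hmono⟩ := exists_injective_strictMono_comp hφ
  have hst : f s < f t := hmono (a := 0) (b := 1) (by decide)
  refine ⟨by simp, by simp, f, hf, ?_, ?_, ?_, ?_⟩
  · simp [hst]
  · simp [hst]
  · refine fun x hx hxt => ⟨fun _ _ => False, ?_, ?_⟩
    · rintro v ⟨⟨hv, hvt⟩, hvx⟩
      simp_all
    · rintro v ⟨hv, hvs⟩
      refine ⟨s, by simp, ?_⟩
      have : v = t := by simp_all
      exact this ▸ ⟨h.symm, hst, id⟩
  · refine fun x hx hxt => ⟨fun _ _ => True, ?_, ?_⟩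
    · rintro v ⟨hv, hvs⟩
      refine ⟨t, by simp, ?_⟩
      have : v = s := by simp_all
      exact this ▸ ⟨h, hst, trivial⟩
    · rintro v ⟨⟨hv, hvt⟩, hvx⟩
      simp_all

end Order

section Percolation

variable {G : SimpleGraph V} {W R : Finset V} {s t v : V}

lemma degIn_mono (h : W ⊆ R) (v : V) : degIn G W v ≤ degIn G R v := by
  classical
  exact Finset.card_le_card (Finset.filter_subset_filter _ h)

lemma degIn_insert_self [DecidableEq V] : degIn G (insert v W) v = degIn G W v := by
  classical
  rw [degIn, degIn]
  congr 1
  ext x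
  simp only [Finset.mem_filter, Finset.mem_insert]
  constructor
  · rintro ⟨rfl | h, h'⟩
    exacts [absurd h' (G.irrefl), ⟨h, h'⟩]
  · rintro ⟨h, h'⟩
    exact ⟨Or.inr h, h'⟩

variable [Finite V]

/-- A slack set inside `R` grows to a slack set which is closed in `R`. -/
lemma Slack.exists_closed (h : Slack G W s t) (hWR : W ⊆ R) :
    ∃ W', W ⊆ W' ∧ W' ⊆ R ∧ Slack G W' s t ∧ ∀ v ∈ R, v ∉ W' → degIn G W' v ≤ 1 := by
  classical
  obtain ⟨W', hW, ⟨hR, hs⟩, hmax⟩ :=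
    (Set.toFinite {W' | W' ⊆ R ∧ Slack G W' s t}).exists_le_maximal ⟨hWR, h⟩
  refine ⟨W', hW, hR, hs, fun v hv hv' => ?_⟩
  by_contra! hd
  exact hv' (hmax ⟨Finset.insert_subset hv hR, hs.insert_mid hv' hd⟩
    (Finset.subset_insert v W') (Finset.mem_insert_self v W'))

lemma Full.exists_closed (h : Full G W s t) (hWR : W ⊆ R) :
    ∃ W', W ⊆ W' ∧ W' ⊆ R ∧ Full G W' s t ∧ ∀ v ∈ R, v ∉ W' → degIn G W' v ≤ 1 := by
  classical
  obtain ⟨W', hW, ⟨hR, hs⟩, hmax⟩ :=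
    (Set.toFinite {W' | W' ⊆ R ∧ Full G W' s t}).exists_le_maximal ⟨hWR, h⟩
  refine ⟨W', hW, hR, hs, fun v hv hv' => ?_⟩
  by_contra! hd
  exact hv' (hmax ⟨Finset.insert_subset hv hR, hs.insert_mid hv' hd⟩
    (Finset.subset_insert v W') (Finset.mem_insert_self v W'))

/-- A slack set either grows to all of `R`, which is then full, or gets stuck at a proper subset
which is closed in `R`. -/
lemma Slack.full_or_exists_closed (h : Slack G W s t) (hWR : W ⊂ R)
    (hd : ∀ v ∈ R, 3 ≤ degIn G R v) :
    Full G R s t ∨ ∃ W', W ⊆ W' ∧ W' ⊂ R ∧ ∀ v ∈ R, v ∉ W' → degIn G W' v ≤ 1 := by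
  classical
  obtain ⟨W', hW, ⟨hR, hs⟩, hmax⟩ :=
    (Set.toFinite {W' | W' ⊂ R ∧ Slack G W' s t}).exists_le_maximal ⟨hWR, h⟩
  by_cases hcl : ∀ v ∈ R, v ∉ W' → degIn G W' v ≤ 1
  · exact Or.inr ⟨W', hW, hR, hcl⟩
  push Not at hcl
  obtain ⟨v, hv, hv', h2⟩ := hcl
  have hsub : insert v W' ⊆ R := Finset.insert_subset hv hR.subset
  by_cases heq : insert v W' = R
  · left
    rw [← heq]
    refine hs.full_insert hv' ?_
    rw [← degIn_insert_self, heq]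
    exact hd v hv
  · exact absurd (hmax ⟨hsub.ssubset_of_ne heq, hs.insert_mid hv' h2⟩
      (Finset.subset_insert v W') (Finset.mem_insert_self v W')) hv'

end Percolation

section Join

variable {G : SimpleGraph V}

/-- Reserved edges inside `A` and inside its complement are combined by placing `A` below its
complement; an edge leading from `x` in `A` up to `y` is reserved for `x` if and only if
`P x y`. -/
lemma exists_covers_join [Finite V] {f₁ f₂ : V → ℚ} {c₁ c₂ : V → V → Prop}
    {A X₁ Y₁ X₂ Y₂ X Y : Set V} (hf₁ : Function.Injective f₁) (hf₂ : Function.Injective f₂)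
    (h₁ : Covers G f₁ c₁ A X₁ Y₁) (h₂ : Covers G f₂ c₂ Aᶜ X₂ Y₂) (P : V → V → Prop)
    (hX : ∀ x ∈ X, (x ∈ A ∧ x ∈ X₁) ∨ (x ∉ A ∧ x ∈ X₂) ∨ (x ∈ A ∧ ∃ y ∉ A, G.Adj x y ∧ P x y))
    (hY : ∀ y ∈ Y, (y ∈ A ∧ y ∈ Y₁) ∨ (y ∉ A ∧ y ∈ Y₂) ∨
      (y ∉ A ∧ ∃ x ∈ A, G.Adj x y ∧ ¬ P x y)) :
    ∃ (f : V → ℚ) (c : V → V → Prop), Function.Injective f ∧ Covers G f c Set.univ X Y := by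
  classical
  obtain ⟨a, ha⟩ := (Set.finite_range f₁).bddAbove
  obtain ⟨b, hb⟩ := (Set.finite_range f₂).bddBelow
  have hM : ∀ x y, f₁ x < f₂ y + (a - b + 1) := by
    intro x y
    have := ha ⟨x, rfl⟩
    have := hb ⟨y, rfl⟩
    linarith
  set M := a - b + 1
  refine ⟨fun v => if v ∈ A then f₁ v else f₂ v + M,
    fun x y => if x ∈ A then (if y ∈ A then c₁ x y else P x y) else c₂ x y, ?_, ?_, ?_⟩
  · intro x y hxy
    by_cases hx : x ∈ A <;> by_cases hy : y ∈ A <;> simp only [hx, hy, if_true, if_false] at hxy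
    · exact hf₁ hxy
    · exact absurd hxy (hM x y).ne
    · exact absurd hxy (hM y x).ne'
    · exact hf₂ (add_left_injective M hxy)
  · intro x hx
    rcases hX x hx with ⟨hA, h⟩ | ⟨hA, h⟩ | ⟨hA, y, hy, h, hP⟩
    · obtain ⟨w, hw, h1, h2, h3⟩ := h₁.1 x h
      exact ⟨w, trivial, h1, by simpa [hA, hw] using h2, by simpa [hA, hw] using h3⟩
    · obtain ⟨w, hw, h1, h2, h3⟩ := h₂.1 x h
      exact ⟨w, trivial, h1, by simpa [hA, show w ∉ A from hw] using h2, by simpa [hA] using h3⟩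
    · exact ⟨y, trivial, h, by simpa [hA, hy] using hM x y, by simpa [hA, hy] using hP⟩
  · intro y hy
    rcases hY y hy with ⟨hA, h⟩ | ⟨hA, h⟩ | ⟨hA, x, hx, h, hP⟩
    · obtain ⟨w, hw, h1, h2, h3⟩ := h₁.2 y h
      exact ⟨w, trivial, h1, by simpa [hA, hw] using h2, by simpa [hA, hw] using h3⟩
    · obtain ⟨w, hw, h1, h2, h3⟩ := h₂.2 y h
      have hw : w ∉ A := hw
      exact ⟨w, trivial, h1, by simpa [hA, hw] using h2, by simpa [hw] using h3⟩
    · exact ⟨x, trivial, h.symm, by simpa [hA, hx] using hM x y, by simpa [hA, hx] using hP⟩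

lemma Full.join [Fintype V] {Q R : Finset V} {s q r t q₂ y : V} (hQR : ∀ v, v ∈ R ↔ v ∉ Q)
    (hQ : Full G Q s q) (hR : Full G R r t) (hq : q ∈ Q) (hr : r ∈ R) (hy : y ∈ R)
    (hqy : G.Adj q y) (hq₂ : q₂ ∈ Q) (hq₂r : G.Adj q₂ r) (hne : q₂ ≠ q) :
    Full G Finset.univ s t := by
  obtain ⟨f₁, c₁, hf₁, h₁⟩ := hQ
  obtain ⟨f₂, c₂, hf₂, h₂⟩ := hR
  have hR' : (R : Set V) = (Q : Set V)ᶜ := by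
    ext v
    simp [hQR]
  rw [hR'] at h₂
  rw [Full, Finset.coe_univ]
  refine exists_covers_join hf₁ hf₂ h₁ h₂ (fun x _ => x = q) ?_ ?_
  · rintro x ⟨-, hx⟩
    by_cases hxQ : x ∈ Q
    · by_cases hxq : x = q
      · subst hxq
        exact Or.inr (Or.inr ⟨hxQ, y, (hQR y).1 hy, hqy, rfl⟩)
      · exact Or.inl ⟨hxQ, hxQ, hxq⟩
    · exact Or.inr (Or.inl ⟨hxQ, hxQ, hx⟩)
  · rintro x ⟨-, hx⟩
    by_cases hxQ : x ∈ Q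
    · exact Or.inl ⟨hxQ, hxQ, hx⟩
    · by_cases hxr : x = r
      · subst hxr
        exact Or.inr (Or.inr ⟨hxQ, q₂, hq₂, hq₂r, hne⟩)
      · exact Or.inr (Or.inl ⟨hxQ, hxQ, hxr⟩)

end Join

section Dense

variable {G : SimpleGraph V} {W R : Finset V} {s t v a b : V}

lemma two_le_degIn (ha : a ∈ W) (hb : b ∈ W) (hab : a ≠ b) (hva : G.Adj v a)
    (hvb : G.Adj v b) : 2 ≤ degIn G W v := by
  classical
  exact Finset.one_lt_card.2
    ⟨a, Finset.mem_filter.2 ⟨ha, hva⟩, b, Finset.mem_filter.2 ⟨hb, hvb⟩, hab⟩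

lemma degIn_lt_card (hv : v ∈ W) : degIn G W v < W.card := by
  classical
  refine Finset.card_lt_card (Finset.filter_ssubset.2 ⟨v, hv, G.irrefl⟩)

lemma degIn_add_card_le [DecidableEq V] (hWR : W ⊆ R) (hvR : v ∈ R) (hvW : v ∉ W) :
    degIn G R v + W.card + 1 ≤ degIn G W v + R.card := by
  classical
  have h1 : R.filter (G.Adj v) ⊆ W.filter (G.Adj v) ∪ (R \ W).erase v := by
    intro x hx
    rw [Finset.mem_filter] at hx
    have := hx.2.ne'
    by_cases hxW : x ∈ W <;> simp [hxW, hx, this]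
  have h2 := (Finset.card_le_card h1).trans (Finset.card_union_le _ _)
  have hmem : v ∈ R \ W := Finset.mem_sdiff.2 ⟨hvR, hvW⟩
  have h3 := Finset.card_pos.2 ⟨v, hmem⟩
  rw [Finset.card_erase_of_mem hmem] at h2
  have h4 := Finset.card_sdiff_add_card_eq_card hWR
  rw [degIn, degIn]
  omega

lemma adj_or_adj_of_card_le [DecidableEq V] (hv : v ∈ R) (hd : R.card ≤ degIn G R v + 2)
    (ha : a ∈ R) (hb : b ∈ R) (hav : a ≠ v) (hbv : b ≠ v) (hab : a ≠ b) :
    G.Adj v a ∨ G.Adj v b := by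
  classical
  by_contra! h
  have hsub : ({a, b} : Finset V) ⊆ R := by
    intro x
    simp only [Finset.mem_insert, Finset.mem_singleton]
    rintro (rfl | rfl) <;> assumption
  have h1 := degIn_add_card_le (G := G) (v := v) hsub hv (by simp [hav.symm, hbv.symm])
  rw [Finset.card_pair hab] at h1
  have h2 : degIn G {a, b} v = 0 := by
    rw [degIn, Finset.card_eq_zero, Finset.filter_eq_empty_iff]
    simp [h.1, h.2]
  omega

/-- A nearly complete graph has full orders for all choices of first and last vertex. -/
lemma full_of_card_le_degIn_add_two [Finite V] (h3 : ∀ v ∈ R, 3 ≤ degIn G R v)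
    (hd : ∀ v ∈ R, R.card ≤ degIn G R v + 2) (hs : s ∈ R) (ht : t ∈ R) (hst : s ≠ t) :
    Full G R s t := by
  classical
  have key : ∀ W : Finset V, W ⊂ R → 3 ≤ W.card → Slack G W s t → Full G R s t := by
    intro W hW hcard hsl
    refine (hsl.full_or_exists_closed hW h3).resolve_right ?_
    rintro ⟨W', hWW', hW'R, hcl⟩
    obtain ⟨v, hvR, hvW'⟩ := Finset.exists_of_ssubset hW'R
    have h1 := degIn_add_card_le (G := G) hW'R.subset hvR hvW'
    have h2 := hcl v hvR hvW'
    have h4 := Finset.card_le_card hWW'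
    have h5 := hd v hvR
    omega
  have hRs := degIn_lt_card (G := G) hs
  have hunion := Finset.card_union_add_card_inter (R.filter (G.Adj s)) (R.filter (G.Adj t))
  have hds : 3 ≤ (R.filter (G.Adj s)).card := h3 s hs
  have hdt : 3 ≤ (R.filter (G.Adj t)).card := h3 t ht
  have hds' : R.card ≤ (R.filter (G.Adj s)).card + 2 := hd s hs
  have hdt' : R.card ≤ (R.filter (G.Adj t)).card + 2 := hd t ht
  have hmem : ∀ a ∈ R.filter (G.Adj s) ∩ R.filter (G.Adj t), a ∈ R ∧ G.Adj s a ∧ G.Adj t a := by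
    intro a ha
    rw [Finset.mem_inter, Finset.mem_filter, Finset.mem_filter] at ha
    exact ⟨ha.1.1, ha.1.2, ha.2.2⟩
  by_cases hadj : G.Adj s t
  · have h1 : (R.filter (G.Adj s) ∪ R.filter (G.Adj t)).card ≤ R.card :=
      Finset.card_le_card (Finset.union_subset (Finset.filter_subset _ _)
        (Finset.filter_subset _ _))
    obtain ⟨a, ha⟩ : (R.filter (G.Adj s) ∩ R.filter (G.Adj t)).Nonempty := by
      rw [← Finset.card_pos]
      omega
    obtain ⟨haR, hsa, hta⟩ := hmem a ha
    have hcard : (insert a {s, t} : Finset V).card = 3 := by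
      rw [Finset.card_insert_of_notMem (by simp [hsa.ne', hta.ne']), Finset.card_pair hst]
    refine key (insert a {s, t}) (Finset.ssubset_iff_subset_ne.2 ⟨?_, ?_⟩) hcard.ge
      ((slack_pair hadj).insert_mid (by simp [hsa.ne', hta.ne'])
        (two_le_degIn (a := s) (b := t) (by simp) (by simp) hst hsa.symm hta.symm))
    · simp [Finset.insert_subset_iff, *]
    · rintro rfl
      have := h3 s hs
      omega
  · have h1 : R.filter (G.Adj s) ∪ R.filter (G.Adj t) ⊆ R \ {s, t} := by
      intro x hx
      rw [Finset.mem_union, Finset.mem_filter, Finset.mem_filter] at hx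
      simp only [Finset.mem_sdiff, Finset.mem_insert, Finset.mem_singleton, not_or]
      rcases hx with ⟨hx, h⟩ | ⟨hx, h⟩
      · exact ⟨hx, h.ne', fun h' => hadj (h' ▸ h)⟩
      · exact ⟨hx, fun h' => hadj (h' ▸ h).symm, h.ne'⟩
    have h2 := Finset.card_le_card h1
    have hst2 : ({s, t} : Finset V) ⊆ R := by simp [Finset.insert_subset_iff, hs, ht]
    have h4 := Finset.card_sdiff_add_card_eq_card hst2
    rw [Finset.card_pair hst] at h4
    have hR5 : 5 ≤ R.card := by
      have := Finset.card_le_card (Finset.subset_union_left.trans h1)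
      omega
    obtain ⟨a, b, c, ha, hb, hc, hab, hac, hbc⟩ := Finset.two_lt_card_iff.1
      (show 2 < (R.filter (G.Adj s) ∩ R.filter (G.Adj t)).card by omega)
    obtain ⟨b, hb, hab, hadjab⟩ : ∃ b ∈ R.filter (G.Adj s) ∩ R.filter (G.Adj t),
        a ≠ b ∧ G.Adj a b := by
      rcases adj_or_adj_of_card_le (hmem a ha).1 (hd a (hmem a ha).1) (hmem b hb).1
        (hmem c hc).1 hab.symm hac.symm hbc with h | h
      exacts [⟨b, hb, hab, h⟩, ⟨c, hc, hac, h⟩]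
    obtain ⟨haR, hsa, hta⟩ := hmem a ha
    obtain ⟨hbR, hsb, htb⟩ := hmem b hb
    have hsl : Slack G (insert a {s, b}) s b := (slack_pair hsb).insert_mid
      (by simp [hsa.ne', hab]) (two_le_degIn (a := s) (b := b) (by simp) (by simp) hsb.ne
        hsa.symm hadjab)
    have ht' : t ∉ (insert a {s, b} : Finset V) := by simp [hta.ne, htb.ne, hst.symm]
    have hsl' : Slack G (insert t (insert a {s, b})) s t :=
      (hsl.reverse.insert_first ht' htb
        (two_le_degIn (a := a) (b := b) (by simp) (by simp) hab hta htb)).reverse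
    have hcard : (insert t (insert a {s, b}) : Finset V).card = 4 := by
      rw [Finset.card_insert_of_notMem ht',
        Finset.card_insert_of_notMem (by simp [hsa.ne', hab]), Finset.card_pair hsb.ne]
    refine key _ (Finset.ssubset_iff_subset_ne.2 ⟨?_, ?_⟩) (by omega) hsl'
    · simp [Finset.insert_subset_iff, *]
    · rintro rfl
      omega

end Dense

/-- No vertex outside `W` has two neighbors in `W`. -/
def NbrClosed (G : SimpleGraph V) (W : Finset V) : Prop :=
  ∀ v, v ∉ W → degIn G W v ≤ 1

/-- The ordered pairs of distinct vertices admitting a full order of the whole graph. -/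
def fullPairs [Fintype V] (G : SimpleGraph V) : Set (V × V) :=
  {p | p.1 ≠ p.2 ∧ Full G Finset.univ p.1 p.2}

section Counting

variable [Fintype V] {G : SimpleGraph V} {k : ℕ} {s t : V}

lemma sq_le_ncard_fullPairs_of_forall {T : Finset V} (hT : k ≤ T.card)
    (h : ∀ t ∈ T, ∃ S : Finset V, k ≤ S.card ∧ ∀ s ∈ S, s ≠ t ∧ Full G Finset.univ s t) :
    k ^ 2 ≤ (fullPairs G).ncard := by
  classical
  have h' : ∀ t, ∃ S : Finset V, t ∈ T → k ≤ S.card ∧ ∀ s ∈ S, s ≠ t ∧ Full G Finset.univ s t :=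
    fun t => by
      by_cases ht : t ∈ T
      · obtain ⟨S, hS⟩ := h t ht
        exact ⟨S, fun _ => hS⟩
      · exact ⟨∅, fun h => absurd h ht⟩
  choose S hS using h'
  have h1 : k ^ 2 ≤ (T.sigma S).card := by
    rw [Finset.card_sigma, sq]
    calc k * k ≤ T.card * k := Nat.mul_le_mul_right k hT
      _ = T.card • k := (smul_eq_mul _ _).symm
      _ ≤ _ := Finset.card_nsmul_le_sum T _ k fun t ht => (hS t ht).1
  have hinj : Function.Injective fun p : (_ : V) × V => (p.2, p.1) := by
    rintro ⟨a, b⟩ ⟨c, d⟩ h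
    simp only [Prod.mk.injEq] at h
    rw [h.1, h.2]
  rw [← Finset.card_image_of_injective _ hinj, ← Set.ncard_coe_finset] at h1
  refine h1.trans (Set.ncard_le_ncard ?_ (Set.toFinite _))
  intro p hp
  obtain ⟨⟨t, s⟩, hq, rfl⟩ := Finset.mem_image.1 (Finset.mem_coe.1 hp)
  rw [Finset.mem_sigma] at hq
  exact (hS t hq.1).2 s hq.2

lemma sq_le_ncard_fullPairs_of_product {S T : Finset V} (hS : k ≤ S.card) (hT : k ≤ T.card)
    (h : ∀ s ∈ S, ∀ t ∈ T, s ≠ t ∧ Full G Finset.univ s t) :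
    k ^ 2 ≤ (fullPairs G).ncard :=
  sq_le_ncard_fullPairs_of_forall hT fun t ht => ⟨S, hS, fun s hs => h s hs t ht⟩

lemma full_univ_of_adj_of_forall_nbrClosed (h3 : ∀ v, 3 ≤ degIn G Finset.univ v)
    (hst : G.Adj s t) (hcl : ∀ W, s ∈ W → t ∈ W → NbrClosed G W → W = Finset.univ) {s' : V}
    (hs' : s' = s ∨ G.Adj s s') (hs't : s' ≠ t) : Full G Finset.univ s' t := by
  classical
  have grow : ∀ (x : V) (W : Finset V), s ∈ W → t ∈ W → W ≠ Finset.univ → Slack G W x t →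
      Full G Finset.univ x t := by
    intro x W hs ht hW hsl
    refine (hsl.full_or_exists_closed (Finset.ssubset_univ_iff.2 hW)
      fun v _ => h3 v).resolve_right ?_
    rintro ⟨W', hWW', hW', hcl'⟩
    exact Finset.ssubset_univ_iff.1 hW'
      (hcl W' (hWW' hs) (hWW' ht) fun v hv => hcl' v (Finset.mem_univ v) hv)
  rcases hs' with rfl | hs'
  · refine grow _ {s', t} (by simp) (by simp) ?_ (slack_pair hst)
    intro h
    have := (h3 s').trans_lt (degIn_lt_card (Finset.mem_univ s'))
    rw [← h] at this
    have h2 : ({s', t} : Finset V).card ≤ 2 := Finset.card_le_two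
    omega
  · obtain ⟨W, hW, hWR, hsl, hclW⟩ := (slack_pair hst).exists_closed
      (R := Finset.univ.erase s') (by simp [Finset.insert_subset_iff, hs'.ne, hs't.symm])
    have hsW : s ∈ W := hW (by simp)
    have htW : t ∈ W := hW (by simp)
    have hs'W : s' ∉ W := fun h => by simpa using hWR h
    have h2 : 2 ≤ degIn G W s' := by
      by_contra! hlt
      refine hs'W ?_
      rw [hcl W hsW htW fun v hv => ?_]
      · exact Finset.mem_univ _
      · by_cases hvs : v = s'
        · rw [hvs]
          omega
        · exact hclW v (by simpa using hvs) hv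
    by_cases huniv : insert s' W = Finset.univ
    · rw [← huniv]
      refine hsl.full_insert_first hs'W hs'.symm ?_
      rw [← degIn_insert_self, huniv]
      exact h3 s'
    · exact grow s' _ (Finset.mem_insert_of_mem hsW) (Finset.mem_insert_of_mem htW) huniv
        (hsl.insert_first hs'W hs'.symm h2)

/-- If no proper closed set contains the edge `st`, then `t` is the last vertex of many
full orders. -/
lemma exists_le_card_of_forall_nbrClosed (h3 : 3 ≤ k) (hdeg : ∀ v, k ≤ degIn G Finset.univ v)
    (hst : G.Adj s t) (hcl : ∀ W, s ∈ W → t ∈ W → NbrClosed G W → W = Finset.univ) :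
    ∃ S : Finset V, k ≤ S.card ∧ ∀ s ∈ S, s ≠ t ∧ Full G Finset.univ s t := by
  classical
  refine ⟨(insert s (Finset.univ.filter (G.Adj s))).erase t, ?_, fun x hx => ?_⟩
  · rw [Finset.card_erase_of_mem (by simp [hst]), Finset.card_insert_of_notMem (by simp)]
    exact (hdeg s).trans (Nat.add_sub_cancel ..).ge
  · rw [Finset.mem_erase, Finset.mem_insert, Finset.mem_filter_univ] at hx
    exact ⟨hx.1, full_univ_of_adj_of_forall_nbrClosed (fun v => h3.trans (hdeg v)) hst hcl
      hx.2 hx.1⟩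

end Counting

section Closed

variable {G : SimpleGraph V} {W R : Finset V} {k : ℕ} {s t v a b : V}

lemma exists_adj_of_degIn_pos (h : 0 < degIn G W v) : ∃ a ∈ W, G.Adj v a := by
  classical
  obtain ⟨a, ha⟩ := Finset.card_pos.1 h
  exact ⟨a, (Finset.mem_filter.1 ha).1, (Finset.mem_filter.1 ha).2⟩

lemma exists_adj_ne_of_two_le_degIn (h : 2 ≤ degIn G W v) (b : V) :
    ∃ a ∈ W, G.Adj v a ∧ a ≠ b := by
  classical
  obtain ⟨a, ha, hab⟩ := Finset.exists_mem_ne h b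
  exact ⟨a, (Finset.mem_filter.1 ha).1, (Finset.mem_filter.1 ha).2, hab⟩

lemma adj_of_card_le [DecidableEq V] (hv : v ∈ R) (hd : R.card ≤ degIn G R v + 1)
    (ha : a ∈ R) (hav : a ≠ v) : G.Adj v a := by
  classical
  by_contra h
  have h1 := degIn_add_card_le (G := G) (Finset.singleton_subset_iff.2 ha) hv
    (by simpa using hav.symm)
  rw [Finset.card_singleton] at h1
  have h2 : degIn G {a} v = 0 := by
    rw [degIn, Finset.card_eq_zero, Finset.filter_eq_empty_iff]
    simpa using h
  omega

lemma exists_not_adj_of_lt_card (hd : degIn G R v + 1 < R.card) :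
    ∃ a ∈ R, a ≠ v ∧ ¬ G.Adj v a := by
  classical
  have h1 : (insert v (R.filter (G.Adj v))).card < R.card :=
    (Finset.card_insert_le _ _).trans_lt hd
  obtain ⟨a, ha, ha'⟩ := Finset.exists_mem_notMem_of_card_lt_card h1
  refine ⟨a, ha, fun h => ha' (by simp [h]), fun h => ha' ?_⟩
  exact Finset.mem_insert_of_mem (Finset.mem_filter.2 ⟨ha, h⟩)

lemma degIn_add_two_le_card [DecidableEq V] (hv : v ∈ R) (ha : a ∈ R) (hav : a ≠ v)
    (h : ¬ G.Adj v a) : degIn G R v + 2 ≤ R.card := by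
  by_contra! hlt
  exact h (adj_of_card_le hv (by omega) ha hav)

lemma NbrClosed.eq_of_adj (h : NbrClosed G W) (hv : v ∉ W) (ha : a ∈ W) (hb : b ∈ W)
    (hva : G.Adj v a) (hvb : G.Adj v b) : a = b := by
  by_contra hab
  have := h v hv
  have := two_le_degIn ha hb hab hva hvb
  omega

variable [Fintype V] [DecidableEq V]

lemma degIn_compl_add (W : Finset V) (v : V) :
    degIn G Wᶜ v + degIn G W v = degIn G Finset.univ v := by
  classical
  rw [degIn, degIn, degIn, ← Finset.card_union_of_disjoint, ← Finset.filter_union]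
  · rw [Finset.union_comm, Finset.union_compl]
  · exact Finset.disjoint_filter_filter disjoint_compl_left

lemma sum_degIn_compl (W : Finset V) :
    ∑ v ∈ W, degIn G Wᶜ v = ∑ u ∈ Wᶜ, degIn G W u := by
  classical
  have := Finset.sum_card_bipartiteAbove_eq_sum_card_bipartiteBelow (s := W) (t := Wᶜ) G.Adj
  simp only [Finset.bipartiteAbove, Finset.bipartiteBelow] at this
  simp only [degIn]
  convert this using 4 with v hv
  exact G.adj_comm _ _

lemma NbrClosed.sum_degIn_compl_le (h : NbrClosed G W) :
    ∑ v ∈ W, degIn G Wᶜ v ≤ Wᶜ.card := by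
  rw [sum_degIn_compl, Finset.card_eq_sum_ones]
  exact Finset.sum_le_sum fun u hu => h u (Finset.mem_compl.1 hu)

lemma NbrClosed.le_degIn_compl_add_one (h : NbrClosed G W)
    (hdeg : ∀ v, k ≤ degIn G Finset.univ v) (hv : v ∉ W) : k ≤ degIn G Wᶜ v + 1 := by
  have := hdeg v
  have := degIn_compl_add (G := G) W v
  have := h v hv
  omega

lemma NbrClosed.le_card_compl (h : NbrClosed G W) (hdeg : ∀ v, k ≤ degIn G Finset.univ v)
    (hW : W ≠ Finset.univ) : k ≤ Wᶜ.card := by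
  obtain ⟨u, hu⟩ : ∃ u, u ∉ W := by
    by_contra! h
    exact hW (Finset.eq_univ_iff_forall.2 h)
  have := h.le_degIn_compl_add_one hdeg hu
  have := degIn_lt_card (G := G) (Finset.mem_compl.2 hu)
  omega

/-- Possible sizes of a closed set. -/
lemma NbrClosed.card_eq (h : NbrClosed G W) (hk : 4 ≤ k)
    (hdeg : ∀ v, k ≤ degIn G Finset.univ v) (hn : Fintype.card V ≤ 2 * k + 1)
    (hW : W ≠ Finset.univ) (h3 : 3 ≤ W.card) :
    W.card = k ∨ (W.card = k + 1 ∧ Fintype.card V = 2 * k + 1) ∨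
      (W.card = 3 ∧ k = 4 ∧ Fintype.card V = 9) := by
  have h1 := h.le_card_compl hdeg hW
  have h2 := Finset.card_add_card_compl W
  have h4 : W.card * (k + 1 - W.card) ≤ Wᶜ.card := by
    refine le_trans ?_ h.sum_degIn_compl_le
    rw [← smul_eq_mul]
    refine Finset.card_nsmul_le_sum _ _ _ fun v hv => ?_
    have := hdeg v
    have := degIn_compl_add (G := G) W v
    have := degIn_lt_card (G := G) hv
    omega
  rcases lt_or_ge W.card k with hlt | hge
  · right
    right
    obtain ⟨a, ha⟩ := Nat.exists_eq_add_of_le h3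
    obtain ⟨b, hb⟩ := Nat.exists_eq_add_of_lt hlt
    rw [ha] at hb
    rw [ha, hb, show 3 + a + b + 1 + 1 - (3 + a) = b + 2 by omega] at h4
    have h5 : (3 + a) * (b + 2) = 3 * b + 6 + a * b + 2 * a := by ring
    have h6 : a = 0 ∧ b = 0 := by
      constructor <;> nlinarith [Nat.zero_le (a * b)]
    omega
  · omega

lemma NbrClosed.le_degIn_add_one (h : NbrClosed G W) (hk : 4 ≤ k)
    (hdeg : ∀ v, k ≤ degIn G Finset.univ v) (hn : Fintype.card V ≤ 2 * k + 1)
    (hW : W.card = k) (hv : v ∈ W) : k ≤ degIn G W v + 1 := by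
  by_contra! hlt
  obtain ⟨a, ha, hav, hadj⟩ := exists_not_adj_of_lt_card (G := G) (R := W) (v := v) (by omega)
  have h1 : ∀ x ∈ W, 1 ≤ degIn G Wᶜ x := by
    intro x hx
    have := hdeg x
    have := degIn_compl_add (G := G) W x
    have := degIn_lt_card (G := G) hx
    omega
  have h2 := degIn_add_two_le_card ha hv hav.symm (fun h => hadj h.symm)
  have h3 := h.sum_degIn_compl_le
  have hav' : a ∈ W.erase v := Finset.mem_erase.2 ⟨hav, ha⟩
  rw [← Finset.add_sum_erase _ _ hv, ← Finset.add_sum_erase _ _ hav'] at h3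
  have h4 : ((W.erase v).erase a).card • 1 ≤ ∑ x ∈ (W.erase v).erase a, degIn G Wᶜ x :=
    Finset.card_nsmul_le_sum _ _ _ fun x hx =>
      h1 x (Finset.mem_of_mem_erase (Finset.mem_of_mem_erase hx))
  rw [smul_eq_mul, mul_one, Finset.card_erase_of_mem hav', Finset.card_erase_of_mem hv] at h4
  have := hdeg v
  have := hdeg a
  have := degIn_compl_add (G := G) W v
  have := degIn_compl_add (G := G) W a
  have := Finset.card_add_card_compl W
  omega

lemma NbrClosed.sq_le_of_card_eq (h : NbrClosed G W) (hk : 4 ≤ k)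
    (hdeg : ∀ v, k ≤ degIn G Finset.univ v) (hn : 2 * k ≤ Fintype.card V)
    (hn' : Fintype.card V ≤ 2 * k + 1) (hW : W.card = k) : k ^ 2 ≤ (fullPairs G).ncard := by
  have hcard := Finset.card_add_card_compl W
  refine sq_le_ncard_fullPairs_of_product (S := W) (T := Wᶜ) hW.ge (by omega)
    fun s hs t ht => ?_
  have hWd : ∀ v ∈ W, k ≤ degIn G W v + 1 := fun v => h.le_degIn_add_one hk hdeg hn' hW
  have hUd : ∀ v ∈ Wᶜ, k ≤ degIn G Wᶜ v + 1 := fun v hv =>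
    h.le_degIn_compl_add_one hdeg (Finset.mem_compl.1 hv)
  have hFW : ∀ q ∈ W, q ≠ s → Full G W s q := fun q hq hqs =>
    full_of_card_le_degIn_add_two (fun v hv => by have := hWd v hv; omega)
      (fun v hv => by have := hWd v hv; omega) hs hq hqs.symm
  have hFU : ∀ r ∈ Wᶜ, r ≠ t → Full G Wᶜ r t := fun r hr hrt =>
    full_of_card_le_degIn_add_two (fun v hv => by have := hUd v hv; omega)
      (fun v hv => by have := hUd v hv; omega) hr ht hrt
  have hU : ∀ v ∈ W, ∃ y ∈ Wᶜ, G.Adj v y := by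
    intro v hv
    refine exists_adj_of_degIn_pos ?_
    have := hdeg v
    have := degIn_compl_add (G := G) W v
    have := degIn_lt_card (G := G) hv
    omega
  refine ⟨fun hst => Finset.mem_compl.1 ht (hst ▸ hs), ?_⟩
  obtain ⟨a, b, ha, hb, hab⟩ := Finset.one_lt_card_iff.1
    (show 1 < (W.erase s).card by rw [Finset.card_erase_of_mem hs]; omega)
  rw [Finset.mem_erase] at ha hb
  obtain ⟨y, hy, hay⟩ := hU a ha.2
  obtain ⟨z, hz, hbz⟩ := hU b hb.2
  by_cases hyt : y = t
  · have hzt : z ≠ t := by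
      rintro rfl
      subst hyt
      exact hab (h.eq_of_adj (Finset.mem_compl.1 hz) ha.2 hb.2 hay.symm hbz.symm)
    exact Full.join (fun v => Finset.mem_compl) (hFW a ha.2 ha.1) (hFU z hz hzt) ha.2 hz hy hay
      hb.2 hbz hab.symm
  · exact Full.join (fun v => Finset.mem_compl) (hFW b hb.2 hb.1) (hFU y hy hyt) hb.2 hy hz hbz
      ha.2 hay hab

lemma NbrClosed.sq_le_of_card_eq_succ (h : NbrClosed G W) (hk : 4 ≤ k)
    (hdeg : ∀ v, k ≤ degIn G Finset.univ v) (hn : Fintype.card V = 2 * k + 1)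
    (hW : W.card = k + 1) : k ^ 2 ≤ (fullPairs G).ncard := by
  have hcard := Finset.card_add_card_compl W
  have hUd : ∀ v ∈ Wᶜ, k ≤ degIn G Wᶜ v + 1 := fun v hv =>
    h.le_degIn_compl_add_one hdeg (Finset.mem_compl.1 hv)
  by_cases hclU : NbrClosed G Wᶜ
  · exact hclU.sq_le_of_card_eq hk hdeg (by omega) (by omega) (by omega)
  by_cases hex : ∃ W₂, Wᶜ ⊆ W₂ ∧ W₂ ≠ Finset.univ ∧ NbrClosed G W₂
  · obtain ⟨W₂, hUW₂, hne, hcl₂⟩ := hex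
    have hle := Finset.card_le_card hUW₂
    rcases hcl₂.card_eq hk hdeg hn.le hne (by omega) with hW₂ | ⟨hW₂, -⟩ | ⟨hW₂, hk4, -⟩
    · exact hcl₂.sq_le_of_card_eq hk hdeg (by omega) (by omega) hW₂
    swap
    · omega
    have hcard₂ := Finset.card_add_card_compl W₂
    by_cases hclU₂ : NbrClosed G W₂ᶜ
    · exact hclU₂.sq_le_of_card_eq hk hdeg (by omega) (by omega) (by omega)
    have hUd₂ : ∀ v ∈ W₂ᶜ, k ≤ degIn G W₂ᶜ v + 1 := fun v hv =>
      hcl₂.le_degIn_compl_add_one hdeg (Finset.mem_compl.1 hv)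
    simp only [NbrClosed, not_forall, not_le] at hclU hclU₂
    obtain ⟨v, hvU, hv2⟩ := hclU
    obtain ⟨x, hxU, hx2⟩ := hclU₂
    have hvW₂ : v ∈ W₂ := by
      by_contra hv
      have := hcl₂ v hv
      have := degIn_mono (G := G) hUW₂ v
      omega
    have hxW₂ : x ∈ W₂ := by simpa using hxU
    have hUW : W₂ᶜ ⊆ W := fun x hx => by_contra fun hxW =>
      Finset.mem_compl.1 hx (hUW₂ (Finset.mem_compl.2 hxW))
    have hxU' : x ∉ Wᶜ := by
      intro hx
      have := h x (Finset.mem_compl.1 hx)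
      have := degIn_mono (G := G) hUW x
      omega
    have hW₂eq : insert v Wᶜ = W₂ :=
      Finset.eq_of_subset_of_card_le (Finset.insert_subset hvW₂ hUW₂)
        (by rw [Finset.card_insert_of_notMem hvU]; omega)
    have hvx : v = x := by
      rw [← hW₂eq, Finset.mem_insert] at hxW₂
      exact (hxW₂.resolve_right hxU').symm
    subst hvx
    have hWeq : insert v W₂ᶜ = W :=
      Finset.eq_of_subset_of_card_le (Finset.insert_subset (by simpa using hvU) hUW)
        (by rw [Finset.card_insert_of_notMem hxU]; omega)
    refine sq_le_ncard_fullPairs_of_product (S := Wᶜ) (T := W₂ᶜ) (by omega) (by omega)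
      fun s hs t ht => ⟨fun hst => Finset.mem_compl.1 hs (hUW (hst ▸ ht)), ?_⟩
    obtain ⟨z, hz, hvz, hzt⟩ := exists_adj_ne_of_two_le_degIn hx2 t
    have hR : Full G W v t := by
      rw [← hWeq]
      refine Full.insert_first (s := z) ?_ hz hxU hvz hx2
      exact full_of_card_le_degIn_add_two (fun v hv => by have := hUd₂ v hv; omega)
        (fun v hv => by have := hUd₂ v hv; omega) hz ht hzt
    obtain ⟨q₂, hq₂, hvq₂⟩ := exists_adj_of_degIn_pos (by omega : 0 < degIn G Wᶜ v)
    obtain ⟨q, hq, hqn⟩ := Finset.exists_mem_notMem_of_card_lt_card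
      (s := {s, q₂}) (t := Wᶜ) (Finset.card_le_two.trans_lt (by omega))
    rw [Finset.mem_insert, Finset.mem_singleton, not_or] at hqn
    have hQ : Full G Wᶜ s q :=
      full_of_card_le_degIn_add_two (fun v hv => by have := hUd v hv; omega)
        (fun v hv => by have := hUd v hv; omega) hs hq (Ne.symm hqn.1)
    obtain ⟨y, hy, hqy⟩ : ∃ y ∈ W, G.Adj q y := by
      refine exists_adj_of_degIn_pos ?_
      have := hdeg q
      have := degIn_compl_add (G := G) W q
      have := degIn_lt_card (G := G) hq
      omega
    exact Full.join (fun v => by simp) hQ hR hq (by simpa using hvU) hy hqy hq₂ hvq₂.symm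
      (Ne.symm hqn.2)
  · push Not at hex
    refine sq_le_ncard_fullPairs_of_forall (T := Wᶜ) (by omega) fun t ht => ?_
    have hd := hUd t ht
    obtain ⟨s, hs, hts⟩ := exists_adj_of_degIn_pos (by omega : 0 < degIn G Wᶜ t)
    refine exists_le_card_of_forall_nbrClosed (by omega) hdeg hts.symm fun W' hsW' htW' hcl' => ?_
    by_contra hne
    refine hex W' (fun u hu => ?_) hne hcl'
    by_contra huW'
    have hadj : ∀ a ∈ Wᶜ, a ∈ W' → G.Adj u a := fun a ha haW' =>
      adj_of_card_le hu (by have := hUd u hu; omega) ha (fun h => huW' (h ▸ haW'))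
    exact hts.ne (hcl'.eq_of_adj huW' htW' hsW' (hadj t ht htW') (hadj s hs hsW'))

end Closed

/-- For a fixed order of `U`, all demands except those of `t` and `r` can be met, apart from one
vertex without a reserved edge going down, for which there are two choices. -/
def HalfSlack (G : SimpleGraph V) (U : Finset V) (r t : V) : Prop :=
  ∃ f : V → ℚ, Function.Injective f ∧ ∃ y₁ ∈ U, ∃ y₂ ∈ U, y₁ ≠ r ∧ y₂ ≠ r ∧ y₁ ≠ y₂ ∧
    ∀ y, y = y₁ ∨ y = y₂ → ∃ c, Covers G f c U (U \ {t}) ((U \ {r}) \ {y})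

section Triangle

variable {G : SimpleGraph V} {U W : Finset V} {r s t b c : V}

lemma Slack.halfSlack (h : Slack G U r t) (hU : 3 ≤ U.card) : HalfSlack G U r t := by
  classical
  obtain ⟨hr, -, f, hf, -, -, -, h⟩ := h
  obtain ⟨y₁, y₂, hy₁, hy₂, hne⟩ := Finset.one_lt_card_iff.1
    (show 1 < (U.erase r).card by rw [Finset.card_erase_of_mem hr]; omega)
  rw [Finset.mem_erase] at hy₁ hy₂
  refine ⟨f, hf, y₁, hy₁.2, y₂, hy₂.2, hy₁.1, hy₂.1, hne, ?_⟩
  rintro y (rfl | rfl)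
  exacts [h _ hy₁.2 hy₁.1, h _ hy₂.2 hy₂.1]

lemma range_eq_coe_of_card {m : ℕ} {φ : Fin m → V} (hφ : Function.Injective φ)
    (h : ∀ i, φ i ∈ U) (hU : U.card = m) : Set.range φ = U := by
  classical
  have h1 : Finset.univ.image φ = U := by
    refine Finset.eq_of_subset_of_card_le (Finset.image_subset_iff.2 fun i _ => h i) ?_
    rw [Finset.card_image_of_injective _ hφ, hU, Finset.card_fin]
  rw [← h1, Finset.coe_image, Finset.coe_univ, Set.image_univ]

lemma halfSlack_of_enum [Finite V] {φ : Fin 6 → V} (hφ : Function.Injective φ)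
    (hU : Set.range φ = U) {E : Fin 6 → Fin 6 → Prop} (hE : ∀ i j, E i j → G.Adj (φ i) (φ j))
    (up₁ down₁ up₂ down₂ : Fin 6 → Fin 6) (e₁ e₂ : Fin 6) (he : e₁ ≠ 0 ∧ e₂ ≠ 0 ∧ e₁ ≠ e₂)
    (hup₁ : ∀ i, i ≠ 5 → i < up₁ i ∧ E i (up₁ i))
    (hdown₁ : ∀ i, i ≠ 0 ∧ i ≠ e₁ → down₁ i < i ∧ E i (down₁ i))
    (hdisj₁ : ∀ i, i ≠ 5 → up₁ i ≠ 0 ∧ up₁ i ≠ e₁ → down₁ (up₁ i) ≠ i)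
    (hup₂ : ∀ i, i ≠ 5 → i < up₂ i ∧ E i (up₂ i))
    (hdown₂ : ∀ i, i ≠ 0 ∧ i ≠ e₂ → down₂ i < i ∧ E i (down₂ i))
    (hdisj₂ : ∀ i, i ≠ 5 → up₂ i ≠ 0 ∧ up₂ i ≠ e₂ → down₂ (up₂ i) ≠ i) :
    HalfSlack G U (φ 0) (φ 5) := by
  obtain ⟨f, hf, hmono⟩ := exists_injective_strictMono_comp hφ
  have hmem : ∀ i, φ i ∈ U := fun i => by
    rw [← Finset.mem_coe, ← hU]
    exact ⟨i, rfl⟩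
  refine ⟨f, hf, φ e₁, hmem _, φ e₂, hmem _, hφ.ne he.1, hφ.ne he.2.1, hφ.ne he.2.2, ?_⟩
  rw [← hU]
  have hX : ∀ x ∈ Set.range φ \ {φ 5}, ∃ i, i ≠ 5 ∧ φ i = x := by
    rintro x ⟨⟨i, rfl⟩, hi⟩
    exact ⟨i, fun h => hi (h ▸ rfl), rfl⟩
  have hY : ∀ e, ∀ x ∈ (Set.range φ \ {φ 0}) \ {φ e}, ∃ i, (i ≠ 0 ∧ i ≠ e) ∧ φ i = x := by
    rintro e x ⟨⟨⟨i, rfl⟩, hi⟩, hi'⟩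
    exact ⟨i, ⟨fun h => hi (h ▸ rfl), fun h => hi' (h ▸ rfl)⟩, rfl⟩
  rintro y (rfl | rfl)
  · exact exists_covers_range hmono up₁ down₁ (fun i hi => ⟨(hup₁ i hi).1, hE _ _ (hup₁ i hi).2⟩)
      (fun i hi => ⟨(hdown₁ i hi).1, hE _ _ (hdown₁ i hi).2⟩) hdisj₁ hX (hY e₁)
  · exact exists_covers_range hmono up₂ down₂ (fun i hi => ⟨(hup₂ i hi).1, hE _ _ (hup₂ i hi).2⟩)
      (fun i hi => ⟨(hdown₂ i hi).1, hE _ _ (hdown₂ i hi).2⟩) hdisj₂ hX (hY e₂)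

lemma halfSlack_prism [Finite V] {φ : Fin 6 → V} (hφ : Function.Injective φ)
    (hU : Set.range φ = U)
    (hE : ∀ i j : Fin 6, i ≠ j ∧ (i.val / 3 = j.val / 3 ∨ i.val % 3 = j.val % 3) →
      G.Adj (φ i) (φ j)) : HalfSlack G U (φ 0) (φ 5) :=
  halfSlack_of_enum hφ hU hE ![1, 2, 5, 4, 5, 0] ![0, 0, 0, 0, 1, 3]
    ![2, 2, 5, 4, 5, 0] ![0, 0, 0, 0, 1, 3] 1 2 (by decide) (by decide) (by decide) (by decide)
    (by decide) (by decide) (by decide)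

lemma halfSlack_bipartite [Finite V] {φ : Fin 6 → V} (hφ : Function.Injective φ)
    (hU : Set.range φ = U)
    (hE : ∀ i j : Fin 6, ![true, false, false, true, false, true] i ≠
      ![true, false, false, true, false, true] j → G.Adj (φ i) (φ j)) :
    HalfSlack G U (φ 0) (φ 5) :=
  halfSlack_of_enum hφ hU hE ![1, 3, 5, 4, 5, 0] ![0, 0, 0, 2, 0, 1]
    ![2, 3, 5, 4, 5, 0] ![0, 0, 0, 2, 0, 1] 1 2 (by decide) (by decide) (by decide) (by decide)
    (by decide) (by decide) (by decide)

lemma exists_three_halfSlack_of_perm [Finite V] [DecidableEq V] {φ : Fin 6 → V}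
    (hφ : Function.Injective φ) (hU : Set.range φ = U) (σ τ : Equiv.Perm (Fin 6))
    (hστ : σ 5 ≠ 5 ∧ τ 5 ≠ 5 ∧ σ 5 ≠ τ 5) (h : HalfSlack G U (φ 0) (φ 5))
    (hσ : HalfSlack G U (φ (σ 0)) (φ (σ 5))) (hτ : HalfSlack G U (φ (τ 0)) (φ (τ 5))) :
    ∃ T ⊆ U, 3 ≤ T.card ∧ ∀ t ∈ T, ∃ r ∈ U, HalfSlack G U r t := by
  have hmem : ∀ i, φ i ∈ U := fun i => by
    rw [← Finset.mem_coe, ← hU]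
    exact ⟨i, rfl⟩
  refine ⟨{φ 5, φ (σ 5), φ (τ 5)}, ?_, ?_, ?_⟩
  · simp [Finset.insert_subset_iff, hmem]
  · rw [Finset.card_eq_three.2 ⟨_, _, _, hφ.ne hστ.1.symm, hφ.ne hστ.2.1.symm, hφ.ne hστ.2.2, rfl⟩]
  · simp only [Finset.mem_insert, Finset.mem_singleton]
    rintro t (rfl | rfl | rfl)
    exacts [⟨_, hmem _, h⟩, ⟨_, hmem _, hσ⟩, ⟨_, hmem _, hτ⟩]

lemma range_comp_perm {φ : Fin 6 → V} (hU : Set.range φ = U) (σ : Equiv.Perm (Fin 6)) :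
    Set.range (φ ∘ σ) = U := by
  rw [σ.surjective.range_comp, hU]

lemma exists_three_halfSlack_prism [Finite V] [DecidableEq V] {φ : Fin 6 → V}
    (hφ : Function.Injective φ) (hU : Set.range φ = U)
    (hE : ∀ i j : Fin 6, i ≠ j ∧ (i.val / 3 = j.val / 3 ∨ i.val % 3 = j.val % 3) →
      G.Adj (φ i) (φ j)) :
    ∃ T ⊆ U, 3 ≤ T.card ∧ ∀ t ∈ T, ∃ r ∈ U, HalfSlack G U r t :=
  exists_three_halfSlack_of_perm hφ hU (Equiv.swap 1 2 * Equiv.swap 4 5)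
    (Equiv.swap 0 2 * Equiv.swap 3 5) (by decide) (halfSlack_prism hφ hU hE)
    (halfSlack_prism (hφ.comp (Equiv.injective _)) (range_comp_perm hU _)
      fun i j hij => hE _ _ (by revert i j; decide))
    (halfSlack_prism (hφ.comp (Equiv.injective _)) (range_comp_perm hU _)
      fun i j hij => hE _ _ (by revert i j; decide))

lemma exists_three_halfSlack_bipartite [Finite V] [DecidableEq V] {φ : Fin 6 → V}
    (hφ : Function.Injective φ) (hU : Set.range φ = U)
    (hE : ∀ i j : Fin 6, ![true, false, false, true, false, true] i ≠
      ![true, false, false, true, false, true] j → G.Adj (φ i) (φ j)) :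
    ∃ T ⊆ U, 3 ≤ T.card ∧ ∀ t ∈ T, ∃ r ∈ U, HalfSlack G U r t :=
  exists_three_halfSlack_of_perm hφ hU (Equiv.swap 3 5) (Equiv.swap 0 5) (by decide)
    (halfSlack_bipartite hφ hU hE)
    (halfSlack_bipartite (hφ.comp (Equiv.injective _)) (range_comp_perm hU _)
      fun i j hij => hE _ _ (by revert i j; decide))
    (halfSlack_bipartite (hφ.comp (Equiv.injective _)) (range_comp_perm hU _)
      fun i j hij => hE _ _ (by revert i j; decide))

lemma HalfSlack.full_univ [Fintype V] [DecidableEq V] (h : HalfSlack G Wᶜ r t)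
    (hcl : NbrClosed G W) (hW : Slack G W s c) (hb : b ∈ W) (hbs : b ≠ s) (hbc : b ≠ c)
    (hsc : s ≠ c) (hdW : ∀ w ∈ W, 2 ≤ degIn G Wᶜ w) (hdU : ∀ u ∈ Wᶜ, 1 ≤ degIn G W u)
    (hr : r ∈ Wᶜ) : Full G Finset.univ s t := by
  obtain ⟨hs, hc, f₁, hf₁, -, -, h₁, -⟩ := hW
  obtain ⟨f₂, hf₂, y₁, hy₁, y₂, hy₂, hy₁r, hy₂r, hne, h₂⟩ := h
  obtain ⟨u, hu, hcu, hur⟩ := exists_adj_ne_of_two_le_degIn (hdW c hc) r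
  obtain ⟨y, hy, hyU, hyr, hyu⟩ : ∃ y, (y = y₁ ∨ y = y₂) ∧ y ∈ Wᶜ ∧ y ≠ r ∧ y ≠ u := by
    by_cases h : y₁ = u
    · exact ⟨y₂, Or.inr rfl, hy₂, hy₂r, fun h' => hne (h.trans h'.symm)⟩
    · exact ⟨y₁, Or.inl rfl, hy₁, hy₁r, h⟩
  obtain ⟨x, hx, hxc, z, hz, hxz, hzr, hzy⟩ :
      ∃ x ∈ W, x ≠ c ∧ ∃ z ∈ Wᶜ, G.Adj x z ∧ z ≠ r ∧ z ≠ y := by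
    obtain ⟨a, ha, hsa, har⟩ := exists_adj_ne_of_two_le_degIn (hdW s hs) r
    obtain ⟨a', ha', hba', har'⟩ := exists_adj_ne_of_two_le_degIn (hdW b hb) r
    by_cases hay : a = y
    · refine ⟨b, hb, hbc, a', ha', hba', har', ?_⟩
      rintro rfl
      subst hay
      exact hbs (hcl.eq_of_adj (Finset.mem_compl.1 ha) hb hs hba'.symm hsa.symm)
    · exact ⟨s, hs, hsc, a, ha, hsa, har, hay⟩
  obtain ⟨c₁, h₁⟩ := h₁ x hx hxc
  obtain ⟨c₂, h₂⟩ := h₂ y hy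
  rw [Finset.coe_compl] at h₂
  rw [Full, Finset.coe_univ]
  simp only [Finset.mem_compl] at *
  refine exists_covers_join hf₁ hf₂ h₁ h₂ (fun _ v => v = u ∨ v = z) ?_ ?_
  · rintro v ⟨-, hv⟩
    by_cases hvW : v ∈ W
    · by_cases hvc : v = c
      · subst hvc
        exact Or.inr (Or.inr ⟨hvW, u, hu, hcu, Or.inl rfl⟩)
      · by_cases hvx : v = x
        · subst hvx
          exact Or.inr (Or.inr ⟨hvW, z, hz, hxz, Or.inr rfl⟩)
        · exact Or.inl ⟨hvW, ⟨hvW, hvc⟩, hvx⟩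
    · exact Or.inr (Or.inl ⟨hvW, hvW, hv⟩)
  · rintro v ⟨-, hv⟩
    by_cases hvW : v ∈ W
    · exact Or.inl ⟨hvW, hvW, hv⟩
    · obtain ⟨w, hw, hvw⟩ := exists_adj_of_degIn_pos (hdU v hvW)
      by_cases hvr : v = r
      · subst hvr
        exact Or.inr (Or.inr ⟨hvW, w, hw, hvw.symm, not_or.2 ⟨hur.symm, hzr.symm⟩⟩)
      · by_cases hvy : v = y
        · subst hvy
          exact Or.inr (Or.inr ⟨hvW, w, hw, hvw.symm, not_or.2 ⟨hyu, hzy.symm⟩⟩)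
        · exact Or.inr (Or.inl ⟨hvW, ⟨hvW, hvr⟩, hvy⟩)

end Triangle

section SixVertices

variable {G : SimpleGraph V} {U W : Finset V} {k : ℕ}

lemma Slack.of_triangle [Finite V] [DecidableEq V] {x y z : V} (hxy : G.Adj x y)
    (hyz : G.Adj y z) (hxz : G.Adj x z) : Slack G {y, x, z} x z :=
  (slack_pair hxz).insert_mid (by simp [hxy.ne', hyz.ne])
    (two_le_degIn (a := x) (b := z) (by simp) (by simp) hxz.ne hxy.symm hyz)

lemma exists_three_halfSlack [Finite V] [DecidableEq V] (hU : U.card = 6)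
    (h3 : ∀ u ∈ U, 3 ≤ degIn G U u) :
    ∃ T ⊆ U, 3 ≤ T.card ∧ ∀ t ∈ T, ∃ r ∈ U, HalfSlack G U r t := by
  classical
  by_cases htri : ∃ a ∈ U, ∃ b ∈ U, ∃ c ∈ U, G.Adj a b ∧ G.Adj b c ∧ G.Adj a c
  · obtain ⟨a, ha, b, hb, c, hc, hab, hbc, hac⟩ := htri
    set D : Finset V := {a, b, c} with hD
    have hDU : D ⊆ U := by simp [hD, Finset.insert_subset_iff, ha, hb, hc]
    have hDcard : D.card = 3 := Finset.card_eq_three.2 ⟨a, b, c, hab.ne, hac.ne, hbc.ne, rfl⟩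
    by_cases hcl : ∀ v ∈ U, v ∉ D → degIn G D v ≤ 1
    · have hP : (U \ D).card = 3 := by
        have := Finset.card_sdiff_add_card_eq_card hDU
        omega
      have hPd : ∀ p ∈ U \ D, (U \ D).card ≤ degIn G (U \ D) p + 1 := by
        intro p hp
        rw [Finset.mem_sdiff] at hp
        have h1 : degIn G U p ≤ degIn G D p + degIn G (U \ D) p := by
          rw [degIn, degIn, degIn, ← Finset.card_union_of_disjoint, ← Finset.filter_union,
            Finset.union_sdiff_of_subset hDU]
          exact Finset.disjoint_filter_filter Finset.disjoint_sdiff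
        have := h3 p hp.1
        have := hcl p hp.1 hp.2
        omega
      have hq : ∀ q ∈ D, ∃ p ∈ U \ D, G.Adj q p := by
        intro q hq
        have h1 := degIn_lt_card (G := G) hq
        have h2 := h3 q (hDU hq)
        by_contra! h
        have h4 : degIn G U q ≤ degIn G D q := by
          rw [degIn, degIn]
          refine Finset.card_le_card fun x hx => ?_
          rw [Finset.mem_filter] at hx ⊢
          refine ⟨?_, hx.2⟩
          by_contra hxD
          exact h x (Finset.mem_sdiff.2 ⟨hx.1, hxD⟩) hx.2
        omega
      have haD : a ∈ D := by simp [hD]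
      have hbD : b ∈ D := by simp [hD]
      have hcD : c ∈ D := by simp [hD]
      obtain ⟨p, hp, hap⟩ := hq a haD
      obtain ⟨q, hq', hbq⟩ := hq b hbD
      obtain ⟨r, hr, hcr⟩ := hq c hcD
      have hne : ∀ {x y z w}, x ∈ D → y ∈ D → x ≠ y → z ∈ U \ D → w ∈ U \ D →
          G.Adj x z → G.Adj y w → z ≠ w := by
        rintro x y z w hx hy hxy hz hw hxz hyw rfl
        rw [Finset.mem_sdiff] at hz
        have := two_le_degIn hx hy hxy hxz.symm hyw.symm
        have := hcl z hz.1 hz.2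
        omega
      have hpq := hne haD hbD hab.ne hp hq' hap hbq
      have hpr := hne haD hcD hac.ne hp hr hap hcr
      have hqr := hne hbD hcD hbc.ne hq' hr hbq hcr
      have hpq' := adj_of_card_le hp (hPd p hp) hq' hpq.symm
      have hpr' := adj_of_card_le hp (hPd p hp) hr hpr.symm
      have hqr' := adj_of_card_le hq' (hPd q hq') hr hqr.symm
      have hne' : ∀ {x y}, x ∈ D → y ∈ U \ D → x ≠ y := by
        rintro x y hx hy rfl
        exact (Finset.mem_sdiff.1 hy).2 hx
      refine exists_three_halfSlack_prism (φ := ![a, b, c, p, q, r]) ?_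
        (range_eq_coe_of_card ?_ ?_ hU) ?_
      rotate_left 2
      · have h1 := (Finset.mem_sdiff.1 hp).1
        have h2 := (Finset.mem_sdiff.1 hq').1
        have h3 := (Finset.mem_sdiff.1 hr).1
        intro i
        fin_cases i <;> simpa
      · intro i j
        fin_cases i <;> fin_cases j <;>
          simp [hab, hbc, hac, hap, hbq, hcr, hpq', hpr', hqr', hab.symm, hbc.symm, hac.symm,
            hap.symm, hbq.symm, hcr.symm, hpq'.symm, hpr'.symm, hqr'.symm]
      all_goals
        intro i j
        fin_cases i <;> fin_cases j <;>
          simp [hab.ne, hbc.ne, hac.ne, hpq, hpr, hqr, hab.ne', hbc.ne', hac.ne', hpq.symm,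
            hpr.symm, hqr.symm, hne' haD hp, hne' haD hq', hne' haD hr, hne' hbD hp,
            hne' hbD hq', hne' hbD hr, hne' hcD hp, hne' hcD hq', hne' hcD hr, (hne' haD hp).symm,
            (hne' haD hq').symm, (hne' haD hr).symm, (hne' hbD hp).symm, (hne' hbD hq').symm,
            (hne' hbD hr).symm, (hne' hcD hp).symm, (hne' hcD hq').symm, (hne' hcD hr).symm]
    · have key : ∀ x y z, ({y, x, z} : Finset V) = D → G.Adj x y → G.Adj y z → G.Adj x z →
          HalfSlack G U x z := by
        intro x y z hxyz hxy hyz hxz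
        have hsl := Slack.of_triangle hxy hyz hxz
        rw [hxyz] at hsl
        obtain ⟨W', hDW', hW'U, hsl', hcl'⟩ := hsl.exists_closed hDU
        by_cases heq : W' = U
        · rw [heq] at hsl'
          exact hsl'.halfSlack (by omega)
        · exfalso
          obtain ⟨v, hvU, hvW'⟩ := Finset.exists_of_ssubset (hW'U.ssubset_of_ne heq)
          have h1 := degIn_add_card_le (G := G) hW'U hvU hvW'
          have h2 := hcl' v hvU hvW'
          have h4 := h3 v hvU
          have h5 := Finset.eq_of_subset_of_card_le hDW' (by omega)
          rw [← h5] at hcl'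
          exact hcl hcl'
      refine ⟨D, hDU, hDcard.ge, fun t ht => ?_⟩
      simp only [hD, Finset.mem_insert, Finset.mem_singleton] at ht
      rcases ht with rfl | rfl | rfl
      · refine ⟨c, hc, key c b t ?_ hbc.symm hab.symm hac.symm⟩
        ext v
        simp only [hD, Finset.mem_insert, Finset.mem_singleton]
        tauto
      · refine ⟨a, ha, key a c t ?_ hac hbc.symm hab⟩
        ext v
        simp only [hD, Finset.mem_insert, Finset.mem_singleton]
        tauto
      · refine ⟨a, ha, key a b t ?_ hab hbc hac⟩
        ext v
        simp only [hD, Finset.mem_insert, Finset.mem_singleton]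
        tauto
  · push Not at htri
    obtain ⟨u, hu⟩ : U.Nonempty := Finset.card_pos.1 (by omega)
    set N := U.filter (G.Adj u) with hN
    have hNU : N ⊆ U := Finset.filter_subset _ _
    have hNcard : 3 ≤ N.card := h3 u hu
    have hM := Finset.card_sdiff_add_card_eq_card hNU
    have hsub : ∀ x ∈ N, U.filter (G.Adj x) ⊆ U \ N := by
      intro x hx y hy
      rw [hN, Finset.mem_filter] at hx
      rw [Finset.mem_filter] at hy
      refine Finset.mem_sdiff.2 ⟨hy.1, fun hyN => ?_⟩
      rw [hN, Finset.mem_filter] at hyN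
      exact htri u hu x hx.1 y hy.1 hx.2 hy.2 hyN.2
    obtain ⟨x, hx⟩ : N.Nonempty := Finset.card_pos.1 (by omega)
    have h1 := (h3 x (hNU hx)).trans (Finset.card_le_card (hsub x hx))
    have hadj : ∀ x ∈ N, ∀ y ∈ U \ N, G.Adj x y := by
      intro x hx y hy
      have h2 : 3 ≤ (U.filter (G.Adj x)).card := h3 x (hNU hx)
      rw [← Finset.eq_of_subset_of_card_le (hsub x hx) (by omega)] at hy
      exact (Finset.mem_filter.1 hy).2
    obtain ⟨x₁, x₂, x₃, hx₁₂, hx₁₃, hx₂₃, hNeq⟩ := Finset.card_eq_three.1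
      (show N.card = 3 by omega)
    obtain ⟨y₁, y₂, y₃, hy₁₂, hy₁₃, hy₂₃, hMeq⟩ := Finset.card_eq_three.1
      (show (U \ N).card = 3 by omega)
    rw [hMeq] at hadj
    have hxU : ∀ x ∈ N, x ∈ U := fun x hx => hNU hx
    have hyU : ∀ y ∈ U \ N, y ∈ U := fun y hy => (Finset.mem_sdiff.1 hy).1
    rw [hMeq] at hyU
    rw [hNeq] at hadj hxU
    simp only [Finset.mem_insert, Finset.mem_singleton, forall_eq_or_imp, forall_eq] at hadj hxU hyU
    obtain ⟨⟨h11, h12, h13⟩, ⟨h21, h22, h23⟩, ⟨h31, h32, h33⟩⟩ := hadj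
    refine exists_three_halfSlack_bipartite (φ := ![x₁, y₁, y₂, x₂, y₃, x₃]) ?_
      (range_eq_coe_of_card ?_ ?_ hU) ?_
    rotate_left 2
    · intro i
      fin_cases i <;> simp [hxU, hyU]
    · intro i j
      fin_cases i <;> fin_cases j <;>
        simp [h11, h12, h13, h21, h22, h23, h31, h32, h33, h11.symm, h12.symm, h13.symm,
          h21.symm, h22.symm, h23.symm, h31.symm, h32.symm, h33.symm]
    all_goals
      intro i j
      fin_cases i <;> fin_cases j <;>
        simp [hx₁₂, hx₁₃, hx₂₃, hy₁₂, hy₁₃, hy₂₃, hx₁₂.symm, hx₁₃.symm, hx₂₃.symm, hy₁₂.symm,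
          hy₁₃.symm, hy₂₃.symm, h11.ne, h12.ne, h13.ne, h21.ne, h22.ne, h23.ne, h31.ne, h32.ne,
          h33.ne, h11.ne', h12.ne', h13.ne', h21.ne', h22.ne', h23.ne', h31.ne', h32.ne', h33.ne']

lemma NbrClosed.sq_le_of_card_eq_three [Fintype V] [DecidableEq V] (h : NbrClosed G W)
    (hdeg : ∀ v, 4 ≤ degIn G Finset.univ v) (hn : Fintype.card V = 9) (hW : W.card = 3) :
    4 ^ 2 ≤ (fullPairs G).ncard := by
  classical
  have hcard := Finset.card_add_card_compl W
  have hsum := h.sum_degIn_compl_le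
  have hdW : ∀ w ∈ W, 2 ≤ degIn G Wᶜ w := by
    intro w hw
    have := hdeg w
    have := degIn_compl_add (G := G) W w
    have := degIn_lt_card (G := G) hw
    omega
  have hWd : ∀ w ∈ W, W.card ≤ degIn G W w + 1 := by
    intro w hw
    rw [← Finset.add_sum_erase _ _ hw] at hsum
    have h4 : (W.erase w).card • 2 ≤ ∑ x ∈ W.erase w, degIn G Wᶜ x :=
      Finset.card_nsmul_le_sum _ _ _ fun x hx => hdW x (Finset.mem_of_mem_erase hx)
    rw [smul_eq_mul, Finset.card_erase_of_mem hw] at h4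
    have := hdeg w
    have := degIn_compl_add (G := G) W w
    omega
  have hdU : ∀ u ∈ Wᶜ, 1 ≤ degIn G W u := by
    intro u hu
    have h4 : W.card • 2 ≤ ∑ x ∈ W, degIn G Wᶜ x := Finset.card_nsmul_le_sum _ _ _ hdW
    rw [sum_degIn_compl, ← Finset.add_sum_erase _ _ hu, smul_eq_mul] at h4
    have h5 : ∑ x ∈ Wᶜ.erase u, degIn G W x ≤ (Wᶜ.erase u).card • 1 :=
      Finset.sum_le_card_nsmul _ _ _ fun x hx =>
        h x (Finset.mem_compl.1 (Finset.mem_of_mem_erase hx))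
    rw [smul_eq_mul, Finset.card_erase_of_mem hu] at h5
    omega
  obtain ⟨T, hTU, hT, hTs⟩ := exists_three_halfSlack (G := G) (U := Wᶜ) (by omega)
    fun u hu => by
      have := h.le_degIn_compl_add_one hdeg (Finset.mem_compl.1 hu)
      omega
  have hmain : ∀ s ∈ W, ∀ t ∈ T, s ≠ t ∧ Full G Finset.univ s t := by
    intro s hs t ht
    obtain ⟨r, hr, hsl⟩ := hTs t ht
    refine ⟨fun hst => Finset.mem_compl.1 (hTU ht) (hst ▸ hs), ?_⟩
    obtain ⟨b, c, hb, hc, hbc⟩ := Finset.one_lt_card_iff.1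
      (show 1 < (W.erase s).card by rw [Finset.card_erase_of_mem hs]; omega)
    rw [Finset.mem_erase] at hb hc
    have hsl' := Slack.of_triangle (adj_of_card_le hs (hWd s hs) hb.2 hb.1)
      (adj_of_card_le hb.2 (hWd b hb.2) hc.2 hbc.symm)
      (adj_of_card_le hs (hWd s hs) hc.2 hc.1)
    have heq : ({b, s, c} : Finset V) = W := by
      refine Finset.eq_of_subset_of_card_le
        (by simp [Finset.insert_subset_iff, hs, hb.2, hc.2]) ?_
      rw [hW, Finset.card_eq_three.2 ⟨b, s, c, hb.1, hbc, hc.1.symm, rfl⟩]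
    rw [heq] at hsl'
    exact hsl.full_univ h hsl' hb.2 hb.1 hbc hc.1.symm hdW hdU hr
  have hdisj : Disjoint (W ×ˢ T) (T ×ˢ W) := by
    rw [Finset.disjoint_left]
    rintro ⟨x, y⟩ h1 h2
    rw [Finset.mem_product] at h1 h2
    exact Finset.mem_compl.1 (hTU h2.1) h1.1
  have hcount : 4 ^ 2 ≤ (W ×ˢ T ∪ T ×ˢ W).card := by
    rw [Finset.card_union_of_disjoint hdisj, Finset.card_product, Finset.card_product, hW]
    omega
  rw [← Set.ncard_coe_finset] at hcount
  refine hcount.trans (Set.ncard_le_ncard ?_ (Set.toFinite _))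
  rintro ⟨x, y⟩ hp
  rw [Finset.mem_coe, Finset.mem_union, Finset.mem_product, Finset.mem_product] at hp
  rcases hp with hp | hp
  · exact hmain x hp.1 y hp.2
  · exact ⟨(hmain y hp.2 x hp.1).1.symm, (hmain y hp.2 x hp.1).2.reverse⟩

end SixVertices

/-- The vertex `v` lies in a triangle of `G`. -/
def InTriangle (G : SimpleGraph V) (v : V) : Prop :=
  ∃ a b, G.Adj v a ∧ G.Adj v b ∧ G.Adj a b

section Bipartite

variable [Fintype V] {G : SimpleGraph V} {k : ℕ} {X Y : Finset V} {s t x y j : V}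

lemma adj_of_forall_adj_mem (hdeg : ∀ v, k ≤ degIn G Finset.univ v) (hX : X.card ≤ k) {v : V}
    (h : ∀ a, G.Adj v a → a ∈ X) {a : V} (ha : a ∈ X) : G.Adj v a := by
  classical
  have h1 : Finset.univ.filter (G.Adj v) = X :=
    Finset.eq_of_subset_of_card_le (fun a ha => h a (Finset.mem_filter.1 ha).2)
      (hX.trans (hdeg v))
  rw [← h1, Finset.mem_filter] at ha
  exact ha.2

lemma le_card_of_forall_adj_mem (hdeg : ∀ v, k ≤ degIn G Finset.univ v) {v : V}
    (h : ∀ a, G.Adj v a → a ∈ X) : k ≤ X.card := by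
  classical
  exact (hdeg v).trans (Finset.card_le_card fun a ha => h a (Finset.mem_filter.1 ha).2)

variable [DecidableEq V]

lemma full_univ_of_complete_bipartite (hX : 4 ≤ X.card) (hXc : 4 ≤ Xᶜ.card)
    (hadj : ∀ a ∈ X, ∀ b ∈ Xᶜ, G.Adj a b) (hs : s ∈ X) (ht : t ∈ Xᶜ) :
    Full G Finset.univ s t := by
  obtain ⟨x₁, x₂, x₃, hx₁, hx₂, hx₃, hx₁₂, hx₁₃, hx₂₃⟩ := Finset.two_lt_card_iff.1
    (show 2 < (X.erase s).card by rw [Finset.card_erase_of_mem hs]; omega)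
  obtain ⟨y₁, y₂, y₃, hy₁, hy₂, hy₃, hy₁₂, hy₁₃, hy₂₃⟩ := Finset.two_lt_card_iff.1
    (show 2 < (Xᶜ.erase t).card by rw [Finset.card_erase_of_mem ht]; omega)
  rw [Finset.mem_erase] at hx₁ hx₂ hx₃ hy₁ hy₂ hy₃
  set φ : Fin 8 → V := ![s, y₁, y₂, x₁, x₂, y₃, x₃, t] with hφdef
  have hmem : ∀ i, φ i ∈ X ↔ ![true, false, false, true, true, false, true, false] i := by
    intro i
    have h1 := Finset.mem_compl.1 ht
    have h2 := Finset.mem_compl.1 hy₁.2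
    have h3 := Finset.mem_compl.1 hy₂.2
    have h4 := Finset.mem_compl.1 hy₃.2
    fin_cases i <;> simp [*]
  have hφadj : ∀ i j, ![true, false, false, true, true, false, true, false] i ≠
      ![true, false, false, true, true, false, true, false] j → G.Adj (φ i) (φ j) := by
    intro i j hij
    by_cases hi : φ i ∈ X
    · refine hadj _ hi _ (Finset.mem_compl.2 fun hj => hij ?_)
      rw [(hmem i).1 hi, (hmem j).1 hj]
    · refine (hadj _ ?_ _ (Finset.mem_compl.2 hi)).symm
      by_contra hj
      rw [hmem, Bool.not_eq_true] at hi hj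
      exact hij (hi.trans hj.symm)
  have hφ : Function.Injective φ := by
    have hne : ∀ {a b}, a ∈ X → b ∈ Xᶜ → a ≠ b := by
      rintro a b ha hb rfl
      exact Finset.mem_compl.1 hb ha
    intro i j hij
    by_contra hne'
    have hcol : ![true, false, false, true, true, false, true, false] i =
        ![true, false, false, true, true, false, true, false] j := by
      by_contra hcol
      exact (hφadj i j hcol).ne hij
    revert i j
    simp only [hφdef]
    intro i j
    fin_cases i <;> fin_cases j <;>
      simp [hx₁.1, hx₂.1, hx₃.1, hy₁.1, hy₂.1, hy₃.1, hx₁.1.symm, hx₂.1.symm, hx₃.1.symm,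
        hy₁.1.symm, hy₂.1.symm, hy₃.1.symm, hx₁₂, hx₁₃, hx₂₃, hy₁₂, hy₁₃, hy₂₃, hx₁₂.symm,
        hx₁₃.symm, hx₂₃.symm, hy₁₂.symm, hy₁₃.symm, hy₂₃.symm]
  obtain ⟨f, hf, hmono⟩ := exists_injective_strictMono_comp hφ
  have hcore : Full G (Finset.univ.image φ) s t := by
    rw [Full, Finset.coe_image, Finset.coe_univ, Set.image_univ]
    have htab : (∀ i : Fin 8, i ≠ 7 → i < ![5, 4, 3, 7, 5, 6, 7, 0] i ∧
        ![true, false, false, true, true, false, true, false] i ≠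
          ![true, false, false, true, true, false, true, false]
            (![5, 4, 3, 7, 5, 6, 7, 0] i)) ∧
        (∀ i : Fin 8, i ≠ 0 → ![0, 0, 0, 1, 2, 3, 1, 4] i < i ∧
          ![true, false, false, true, true, false, true, false] i ≠
            ![true, false, false, true, true, false, true, false]
              (![0, 0, 0, 1, 2, 3, 1, 4] i)) := by decide
    obtain ⟨c, hc⟩ := exists_covers_range (G := G) hmono ![5, 4, 3, 7, 5, 6, 7, 0]
      ![0, 0, 0, 1, 2, 3, 1, 4] (A := fun i => i ≠ 7) (B := fun i => i ≠ 0)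
      (X := Set.range φ \ {t}) (Y := Set.range φ \ {s})
      (fun i hi => ⟨(htab.1 i hi).1, hφadj _ _ (htab.1 i hi).2⟩)
      (fun i hi => ⟨(htab.2 i hi).1, hφadj _ _ (htab.2 i hi).2⟩)
      (by decide) (by
        rintro x ⟨⟨i, rfl⟩, hi⟩
        exact ⟨i, fun h => hi (h ▸ rfl), rfl⟩) (by
        rintro x ⟨⟨i, rfl⟩, hi⟩
        exact ⟨i, fun h => hi (h ▸ rfl), rfl⟩)
    exact ⟨f, c, hf, hc⟩
  obtain ⟨W, hW, -, hfull, hcl⟩ := hcore.exists_closed (Finset.subset_univ _)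
  have hφW : ∀ i, φ i ∈ W := fun i => hW (Finset.mem_image_of_mem _ (Finset.mem_univ i))
  have huniv : W = Finset.univ := by
    rw [Finset.eq_univ_iff_forall]
    intro v
    by_contra hv
    have h1 := hcl v (Finset.mem_univ v) hv
    by_cases hvX : v ∈ X
    · have := two_le_degIn (G := G) (v := v) (hφW 1) (hφW 2) hy₁₂ (hadj v hvX _ hy₁.2)
        (hadj v hvX _ hy₂.2)
      omega
    · have hvX := Finset.mem_compl.2 hvX
      have := two_le_degIn (G := G) (v := v) (hφW 3) (hφW 4) hx₁₂ (hadj _ hx₁.2 v hvX).symm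
        (hadj _ hx₂.2 v hvX).symm
      omega
  rwa [huniv] at hfull

lemma sq_le_ncard_fullPairs_of_bipartite (hk : 4 ≤ k) (hdeg : ∀ v, k ≤ degIn G Finset.univ v)
    (hn : Fintype.card V ≤ 2 * k + 1) (hX : ∀ a ∈ X, ∀ b ∈ X, ¬ G.Adj a b)
    (hXc : ∀ a ∉ X, ∀ b ∉ X, ¬ G.Adj a b) (hs : s ∈ X) : k ^ 2 ≤ (fullPairs G).ncard := by
  have h1 : ∀ v ∈ X, ∀ a, G.Adj v a → a ∈ Xᶜ := fun v hv a hva =>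
    Finset.mem_compl.2 fun ha => hX v hv a ha hva
  have h2 : ∀ v ∈ Xᶜ, ∀ a, G.Adj v a → a ∈ X := fun v hv a hva => by
    by_contra ha
    exact hXc v (Finset.mem_compl.1 hv) a ha hva
  have hcXc : k ≤ Xᶜ.card := le_card_of_forall_adj_mem hdeg (h1 s hs)
  obtain ⟨t, ht⟩ := Finset.card_pos.1 (by omega : 0 < Xᶜ.card)
  have hcX : k ≤ X.card := le_card_of_forall_adj_mem hdeg (h2 t ht)
  have hcard := Finset.card_add_card_compl X
  have hadj : ∀ a ∈ X, ∀ b ∈ Xᶜ, G.Adj a b := by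
    intro a ha b hb
    by_cases hle : X.card ≤ k
    · exact (adj_of_forall_adj_mem hdeg hle (h2 b hb) ha).symm
    · exact adj_of_forall_adj_mem hdeg (by omega) (h1 a ha) hb
  exact sq_le_ncard_fullPairs_of_product hcX hcXc fun s hs t ht =>
    ⟨(hadj s hs t ht).ne, full_univ_of_complete_bipartite (hk.trans hcX) (hk.trans hcXc) hadj
      hs ht⟩

open scoped Classical in
lemma le_card_inTriangle (hk : 4 ≤ k) (hdeg : ∀ v, k ≤ degIn G Finset.univ v)
    (hX : ∀ a ∈ X, ∀ b ∈ X, ¬ G.Adj a b) (hY : ∀ a ∈ Y, ∀ b ∈ Y, ¬ G.Adj a b)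
    (hXk : X.card = k) (hYk : Y.card = k) (hcov : ∀ v, v ∈ X ∨ v ∈ Y ∨ v = j) (hjX : j ∉ X)
    (hjY : j ∉ Y) (hx : x ∈ X) (hxj : G.Adj j x) (hxT : ¬ InTriangle G x) (hy : y ∈ Y)
    (hyj : G.Adj j y) : k ≤ (Finset.univ.filter (InTriangle G)).card := by
  have hxy : ¬ G.Adj x y := fun h => hxT ⟨j, y, hxj.symm, h, hyj⟩
  have hNx : ∀ a, G.Adj x a → a ∈ insert j (Y.erase y) := by
    intro a ha
    rw [Finset.mem_insert, Finset.mem_erase]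
    rcases hcov a with h | h | h
    · exact absurd ha (hX x hx a h)
    · exact Or.inr ⟨fun h' => hxy (h' ▸ ha), h⟩
    · exact Or.inl h
  have hNy : ∀ a, G.Adj y a → a ∈ insert j (X.erase x) := by
    intro a ha
    rw [Finset.mem_insert, Finset.mem_erase]
    rcases hcov a with h | h | h
    · exact Or.inr ⟨fun h' => hxy (h' ▸ ha).symm, h⟩
    · exact absurd ha (hY y hy a h)
    · exact Or.inl h
  have hcx : (insert j (Y.erase y)).card ≤ k := by
    have := Finset.card_insert_le j (Y.erase y)
    rw [Finset.card_erase_of_mem hy] at this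
    omega
  have hcy : (insert j (X.erase x)).card ≤ k := by
    have := Finset.card_insert_le j (X.erase x)
    rw [Finset.card_erase_of_mem hx] at this
    omega
  have hyX : ∀ v ∈ X, v ≠ x → G.Adj y v := fun v hv hvx =>
    adj_of_forall_adj_mem hdeg hcy hNy
      (Finset.mem_insert_of_mem (Finset.mem_erase.2 ⟨hvx, hv⟩))
  have hxY : ∀ v ∈ Y, v ≠ y → G.Adj x v := fun v hv hvy =>
    adj_of_forall_adj_mem hdeg hcx hNx
      (Finset.mem_insert_of_mem (Finset.mem_erase.2 ⟨hvy, hv⟩))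
  have hNj : ∀ v, G.Adj j v → v ≠ x → v ≠ y → G.Adj y v := by
    intro v hv hvx hvy
    rcases hcov v with h | h | h
    · exact hyX v h hvx
    · exact absurd ⟨j, v, hxj.symm, hxY v h hvy, hv⟩ hxT
    · exact absurd hv (h ▸ G.irrefl)
  have hdj : k ≤ (Finset.univ.filter (G.Adj j)).card := hdeg j
  obtain ⟨v, hv, hvn⟩ := Finset.exists_mem_notMem_of_card_lt_card
    (s := {x, y}) (t := Finset.univ.filter (G.Adj j)) (Finset.card_le_two.trans_lt (by omega))
  rw [Finset.mem_insert, Finset.mem_singleton, not_or] at hvn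
  rw [Finset.mem_filter_univ] at hv
  have hsub : insert j ((Finset.univ.filter (G.Adj j)).erase x) ⊆
      Finset.univ.filter (InTriangle G) := by
    intro w hw
    rw [Finset.mem_insert, Finset.mem_erase, Finset.mem_filter_univ] at hw
    rw [Finset.mem_filter_univ]
    rcases hw with rfl | ⟨hwx, hw⟩
    · exact ⟨y, v, hyj, hv, hNj v hv hvn.1 hvn.2⟩
    · by_cases hwy : w = y
      · subst hwy
        exact ⟨j, v, hw.symm, hNj v hv hvn.1 hvn.2, hv⟩
      · exact ⟨j, y, hw.symm, (hNj w hw hwx hwy).symm, hyj⟩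
  have := Finset.card_le_card hsub
  rw [Finset.card_insert_of_notMem (by simp), Finset.card_erase_of_mem (by simpa using hxj)]
    at this
  omega

open scoped Classical in
lemma exists_bipartition_of_card_inTriangle_lt (hk : 4 ≤ k)
    (hdeg : ∀ v, k ≤ degIn G Finset.univ v) (hn : Fintype.card V ≤ 2 * k + 1)
    (hpos : 0 < Fintype.card V) (hT : (Finset.univ.filter (InTriangle G)).card < k) :
    ∃ X : Finset V, X.Nonempty ∧ (∀ a ∈ X, ∀ b ∈ X, ¬ G.Adj a b) ∧
      ∀ a ∉ X, ∀ b ∉ X, ¬ G.Adj a b := by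
  have hnbr : ∀ v, ∃ w, G.Adj v w ∧ ¬ InTriangle G w := by
    intro v
    have h1 : k ≤ (Finset.univ.filter (G.Adj v)).card := hdeg v
    obtain ⟨w, hw, hwT⟩ := Finset.exists_mem_notMem_of_card_lt_card (hT.trans_le h1)
    rw [Finset.mem_filter_univ] at hw hwT
    exact ⟨w, hw, hwT⟩
  obtain ⟨v⟩ := Fintype.card_pos_iff.1 hpos
  obtain ⟨i, -, hi⟩ := hnbr v
  obtain ⟨i', hii', hi'⟩ := hnbr i
  set X := Finset.univ.filter (G.Adj i') with hXdef
  set Y := Finset.univ.filter (G.Adj i) with hYdef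
  have hiX : i ∈ X := by simpa [hXdef] using hii'.symm
  have hXk : k ≤ X.card := hdeg i'
  have hYk : k ≤ Y.card := hdeg i
  have hX : ∀ a ∈ X, ∀ b ∈ X, ¬ G.Adj a b := by
    intro a ha b hb hab
    rw [hXdef, Finset.mem_filter_univ] at ha hb
    exact hi' ⟨a, b, ha, hb, hab⟩
  have hY : ∀ a ∈ Y, ∀ b ∈ Y, ¬ G.Adj a b := by
    intro a ha b hb hab
    rw [hYdef, Finset.mem_filter_univ] at ha hb
    exact hi ⟨a, b, ha, hb, hab⟩
  have hXY : Disjoint X Y := by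
    rw [Finset.disjoint_left]
    intro a ha hb
    rw [hXdef, Finset.mem_filter_univ] at ha
    rw [hYdef, Finset.mem_filter_univ] at hb
    exact hi ⟨i', a, hii', hb, ha⟩
  have hcard := Finset.card_union_of_disjoint hXY
  by_cases hcov : X ∪ Y = Finset.univ
  · have hmem : ∀ a, a ∉ X → a ∈ Y := fun a ha =>
      (Finset.mem_union.1 (hcov ▸ Finset.mem_univ a)).resolve_left ha
    exact ⟨X, ⟨i, hiX⟩, hX, fun a ha b hb => hY a (hmem a ha) b (hmem b hb)⟩
  obtain ⟨j, hj⟩ : ∃ j, j ∉ X ∪ Y := by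
    by_contra! h
    exact hcov (Finset.eq_univ_iff_forall.2 h)
  have hins : insert j (X ∪ Y) = Finset.univ := by
    refine Finset.eq_univ_of_card _ (le_antisymm (Finset.card_le_univ _) ?_)
    rw [Finset.card_insert_of_notMem hj]
    omega
  have hle := Finset.card_le_univ (insert j (X ∪ Y))
  rw [Finset.card_insert_of_notMem hj] at hle
  rw [Finset.mem_union, not_or] at hj
  have hcov' : ∀ v, v ∈ X ∨ v ∈ Y ∨ v = j := by
    intro v
    have := Finset.mem_univ v
    rw [← hins, Finset.mem_insert, Finset.mem_union] at this
    tauto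
  by_cases hP : ∃ x ∈ X, G.Adj j x
  · by_cases hQ : ∃ y ∈ Y, G.Adj j y
    · obtain ⟨x, hx, hjx⟩ := hP
      obtain ⟨y, hy, hjy⟩ := hQ
      obtain ⟨w, hjw, hw⟩ := hnbr j
      refine absurd hT (not_lt.2 ?_)
      rcases hcov' w with h | h | h
      · exact le_card_inTriangle hk hdeg hX hY (by omega) (by omega) hcov' hj.1 hj.2 h hjw hw
          hy hjy
      · exact le_card_inTriangle hk hdeg hY hX (by omega) (by omega)
          (fun v => by have := hcov' v; tauto) hj.2 hj.1 h hjw hw hx hjx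
      · exact absurd hjw (h ▸ G.irrefl)
    · push Not at hQ
      refine ⟨X, ⟨i, hiX⟩, hX, ?_⟩
      intro a ha b hb hab
      rcases (hcov' a).resolve_left ha with ha' | rfl <;>
        rcases (hcov' b).resolve_left hb with hb' | rfl
      · exact hY a ha' b hb' hab
      · exact hQ a ha' hab.symm
      · exact hQ b hb' hab
      · exact G.irrefl hab
  · push Not at hP
    refine ⟨insert j X, ⟨j, Finset.mem_insert_self _ _⟩, ?_, ?_⟩
    · intro a ha b hb hab
      rcases Finset.mem_insert.1 ha with rfl | ha' <;> rcases Finset.mem_insert.1 hb with rfl | hb'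
      · exact G.irrefl hab
      · exact hP b hb' hab
      · exact hP a ha' hab.symm
      · exact hX a ha' b hb' hab
    · intro a ha b hb
      rw [Finset.mem_insert, not_or] at ha hb
      have ha' := hcov' a
      have hb' := hcov' b
      exact hY a (by tauto) b (by tauto)

end Bipartite

section Main

variable [Fintype V] {G : SimpleGraph V} {k : ℕ}

lemma sq_le_ncard_fullPairs (hk : 4 ≤ k) (hdeg : ∀ v, k ≤ degIn G Finset.univ v)
    (hn : 2 * k ≤ Fintype.card V) (hn' : Fintype.card V ≤ 2 * k + 1) :
    k ^ 2 ≤ (fullPairs G).ncard := by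
  classical
  by_cases hex : ∃ W, NbrClosed G W ∧ W ≠ Finset.univ ∧ 3 ≤ W.card
  · obtain ⟨W, hcl, hne, h3⟩ := hex
    rcases hcl.card_eq hk hdeg hn' hne h3 with h | ⟨h, hodd⟩ | ⟨h, rfl, hnine⟩
    · exact hcl.sq_le_of_card_eq hk hdeg hn hn' h
    · exact hcl.sq_le_of_card_eq_succ hk hdeg hodd h
    · exact hcl.sq_le_of_card_eq_three hdeg hnine h
  push Not at hex
  rcases le_or_gt k (Finset.univ.filter (InTriangle G)).card with hT | hT
  · refine sq_le_ncard_fullPairs_of_forall hT fun t ht => ?_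
    obtain ⟨s, x, hts, htx, hsx⟩ := (Finset.mem_filter.1 ht).2
    refine exists_le_card_of_forall_nbrClosed (by omega) hdeg hts.symm fun W hs ht hcl => ?_
    by_contra hne
    have hx : x ∈ W := by
      by_contra hx
      exact hts.ne (hcl.eq_of_adj hx ht hs htx.symm hsx.symm)
    have hlt := hex W hcl hne
    have hsub : ({t, s, x} : Finset V) ⊆ W := by simp [Finset.insert_subset_iff, ht, hs, hx]
    have := Finset.card_le_card hsub
    rw [Finset.card_eq_three.2 ⟨t, s, x, hts.ne, htx.ne, hsx.ne, rfl⟩] at this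
    omega
  · obtain ⟨X, ⟨s, hs⟩, hX, hXc⟩ :=
      exists_bipartition_of_card_inTriangle_lt hk hdeg hn' (by omega) hT
    exact sq_le_ncard_fullPairs_of_bipartite hk hdeg hn' hX hXc hs

end Main

/-- Every simple graph on `n ≥ 8` vertices with minimum degree at least `⌊n/2⌋` has at
least `⌊n/2⌋²` ordered pairs `(s,t)` of distinct vertices for which some spanning
subgraph of `G` is a 2T-graph admitting an `(s,t)`-triple. -/
theorem stmt4 [Fintype V] (G : SimpleGraph V)
    (hn : 8 ≤ Fintype.card V)
    (hdeg : ∀ v : V, Fintype.card V / 2 ≤ gdeg G v) :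
    (Fintype.card V / 2) ^ 2 ≤
      {p : V × V | p.1 ≠ p.2 ∧
        ∃ H : SimpleGraph V, H ≤ G ∧ IsTwoT H ∧ HasSTTriple H p.1 p.2}.ncard := by
  have hgdeg : ∀ v, gdeg G v = degIn G Finset.univ v := by
    classical
    intro v
    rw [gdeg, degIn, ← Set.ncard_coe_finset]
    congr 1
    ext x
    simp
  refine (sq_le_ncard_fullPairs (G := G) (k := Fintype.card V / 2) (by omega)
    (fun v => (hgdeg v) ▸ hdeg v) (by omega) (by omega)).trans
    (Set.ncard_le_ncard ?_ (Set.toFinite _))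
  exact fun p hp => ⟨hp.1, hp.2.exists_isTwoT (by omega)⟩
end

section
/- Any sum of two excellent quartics is an excellent quartic. That is, if Q and R are disjoint excellent quartics, a ≠ b are transits of Q and c ≠ d are transits of R, then the graph obtained from the disjoint union of Q and R by adding the edges ac and bd is a quartic and is excellent. -/
open SimpleGraph

universe u

variable {V : Type u}

/-- The sum of two disjoint quartics `Q` and `R` along transits `a ≠ b` of `Q` and
`c ≠ d` of `R`: add the edges `ac` and `bd` to the disjoint union. -/
def quarticSum {α β : Type u} (Q : SimpleGraph α) (R : SimpleGraph β) (a b : α) (c d : β) :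
    SimpleGraph (α ⊕ β) :=
  SimpleGraph.fromRel fun x y =>
    (∃ u v : α, x = Sum.inl u ∧ y = Sum.inl v ∧ Q.Adj u v) ∨
    (∃ u v : β, x = Sum.inr u ∧ y = Sum.inr v ∧ R.Adj u v) ∨
    (x = Sum.inl a ∧ y = Sum.inr c) ∨ (x = Sum.inl b ∧ y = Sum.inr d)

section SumOfQuartics

variable {α β : Type u}

theorem IsSpanningTree.comap_iso {α β : Type u} {G T : SimpleGraph α} {H : SimpleGraph β}
    (h : IsSpanningTree G T) (e : G ≃g H) : IsSpanningTree H (T.comap e.symm) := by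
  let f : T.comap e.symm ≃g T := Iso.comap e.symm.toEquiv T
  exact ⟨fun x y hxy => e.symm.map_rel_iff.1 (h.1 hxy), f.connected_iff.2 h.2.1,
    f.isAcyclic_iff.2 h.2.2⟩

theorem HasSTTriple.map_iso {G : SimpleGraph α} {H : SimpleGraph β} {s t : α}
    (h : HasSTTriple G s t) (e : G ≃g H) : HasSTTriple H (e s) (e t) := by
  obtain ⟨r, I, O, hI, hO, hd, hl, hs⟩ := h
  refine ⟨@LinearOrder.lift' _ _ r e.symm e.symm.injective, I.comap e.symm, O.comap e.symm,
    hI.comap_iso e, hO.comap_iso e, ?_, fun v hv => ?_, fun v hv => ?_⟩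
  · ext x y
    have := congrArg (fun K : SimpleGraph α => K.Adj (e.symm x) (e.symm y)) hd
    simpa using this
  · obtain ⟨w, hw, hlt⟩ := hl (e.symm v) (fun h => hv (by simp [← h]))
    refine ⟨e w, by simpa using hw, ?_⟩
    change r.lt (e.symm v) (e.symm (e w))
    simpa using hlt
  · obtain ⟨w, hw, hlt⟩ := hs (e.symm v) (fun h => hv (by simp [← h]))
    refine ⟨e w, by simpa using hw, ?_⟩
    change r.lt (e.symm (e w)) (e.symm v)
    simpa using hlt

/-- Reversing the order and exchanging the two trees reverses the roles of `s` and `t`. -/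
theorem HasSTTriple.symm {G : SimpleGraph α} {s t : α} (h : HasSTTriple G s t) :
    HasSTTriple G t s := by
  obtain ⟨r, I, O, hI, hO, hd, hl, hs⟩ := h
  exact ⟨@OrderDual.instLinearOrder _ r, O, I, hO, hI, by rwa [inf_comm], hs, hl⟩

/-- The disjoint union of `I` and `J` together with the edge joining `x` to `y`. -/
def joinAt (I : SimpleGraph α) (J : SimpleGraph β) (x : α) (y : β) : SimpleGraph (α ⊕ β) :=
  (I ⊕g J) ⊔ edge (Sum.inl x) (Sum.inr y)

section joinAt

variable {I : SimpleGraph α} {J : SimpleGraph β} {x u u' : α} {y v v' : β}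

@[simp]
theorem joinAt_adj_inl_inl : (joinAt I J x y).Adj (.inl u) (.inl u') ↔ I.Adj u u' := by
  simp [joinAt, edge_adj]

@[simp]
theorem joinAt_adj_inr_inr : (joinAt I J x y).Adj (.inr v) (.inr v') ↔ J.Adj v v' := by
  simp [joinAt, edge_adj]

@[simp]
theorem joinAt_adj_inl_inr : (joinAt I J x y).Adj (.inl u) (.inr v) ↔ u = x ∧ v = y := by
  simp [joinAt, edge_adj]

@[simp]
theorem joinAt_adj_inr_inl : (joinAt I J x y).Adj (.inr v) (.inl u) ↔ u = x ∧ v = y := by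
  rw [adj_comm, joinAt_adj_inl_inr]

theorem connected_joinAt (hI : I.Connected) (hJ : J.Connected) : (joinAt I J x y).Connected := by
  have hl : ∀ u, (joinAt I J x y).Reachable (.inl u) (.inl x) := fun u =>
    (hI.preconnected u x).map ⟨Sum.inl, by simp⟩
  have hr : ∀ v, (joinAt I J x y).Reachable (.inr v) (.inl x) := fun v =>
    ((hJ.preconnected v y).map
      (⟨Sum.inr, by simp⟩ : J →g joinAt I J x y)).trans (Adj.reachable (by simp))
  have h : ∀ z, (joinAt I J x y).Reachable z (.inl x) := by
    rintro (u | v)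
    exacts [hl u, hr v]
  exact connected_iff_exists_forall_reachable _ |>.2 ⟨.inl x, fun z => (h z).symm⟩

theorem isTree_joinAt [Finite α] [Finite β] (hI : I.IsTree) (hJ : J.IsTree) :
    (joinAt I J x y).IsTree := by
  refine isTree_iff_connected_and_card.2 ⟨connected_joinAt hI.1 hJ.1, ?_⟩
  have hIc := (isTree_iff_connected_and_card.1 hI).2
  have hJc := (isTree_iff_connected_and_card.1 hJ).2
  have hset : (joinAt I J x y).edgeSet = insert s(.inl x, .inr y) (I ⊕g J).edgeSet := by
    rw [joinAt, edgeSet_sup, edgeSet_edge_of_ne (by simp), Set.union_singleton]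
  have hcard : Nat.card (I ⊕g J).edgeSet = Nat.card I.edgeSet + Nat.card J.edgeSet := by
    rw [Nat.card_congr edgeSetSumEquiv, Nat.card_sum]
  rw [hset, Nat.card_coe_set_eq, Set.ncard_insert_of_notMem (by simp), ← Nat.card_coe_set_eq,
    hcard, Nat.card_sum]
  omega

theorem joinAt_inf_joinAt {I' : SimpleGraph α} {J' : SimpleGraph β} {x' : α} {y' : β}
    (hI : I ⊓ I' = ⊥) (hJ : J ⊓ J' = ⊥) (hx : x ≠ x') :
    joinAt I J x y ⊓ joinAt I' J' x' y' = ⊥ := by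
  have hI' : ∀ u v, I.Adj u v → ¬ I'.Adj u v := fun u v h h' =>
    (hI ▸ (⟨h, h'⟩ : (I ⊓ I').Adj u v) : (⊥ : SimpleGraph α).Adj u v)
  have hJ' : ∀ u v, J.Adj u v → ¬ J'.Adj u v := fun u v h h' =>
    (hJ ▸ (⟨h, h'⟩ : (J ⊓ J').Adj u v) : (⊥ : SimpleGraph β).Adj u v)
  ext (u | u) (v | v) <;> simp <;> grind

end joinAt

section quarticSum

variable {Q : SimpleGraph α} {R : SimpleGraph β} {a b : α} {c d : β}

@[simp]
theorem quarticSum_adj_inl_inl {u v : α} :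
    (quarticSum Q R a b c d).Adj (.inl u) (.inl v) ↔ Q.Adj u v := by
  simpa [quarticSum, fromRel_adj, Q.adj_comm v u] using Adj.ne

@[simp]
theorem quarticSum_adj_inr_inr {u v : β} :
    (quarticSum Q R a b c d).Adj (.inr u) (.inr v) ↔ R.Adj u v := by
  simpa [quarticSum, fromRel_adj, R.adj_comm v u] using Adj.ne

@[simp]
theorem quarticSum_adj_inl_inr {u : α} {v : β} :
    (quarticSum Q R a b c d).Adj (.inl u) (.inr v) ↔ u = a ∧ v = c ∨ u = b ∧ v = d := by
  simp [quarticSum, fromRel_adj]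

@[simp]
theorem quarticSum_adj_inr_inl {u : α} {v : β} :
    (quarticSum Q R a b c d).Adj (.inr v) (.inl u) ↔ u = a ∧ v = c ∨ u = b ∧ v = d := by
  rw [adj_comm, quarticSum_adj_inl_inr]

theorem quarticSum_comm : quarticSum Q R a b c d = quarticSum Q R b a d c := by
  ext (u | u) (v | v) <;> simp [or_comm]

/-- Exchanging the two summands. -/
def quarticSumSwap (Q : SimpleGraph α) (R : SimpleGraph β) (a b : α) (c d : β) :
    quarticSum Q R a b c d ≃g quarticSum R Q c d a b where
  toEquiv := Equiv.sumComm α β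
  map_rel_iff' := by rintro (u | u) (v | v) <;> simp [and_comm]

@[simp]
theorem quarticSumSwap_inl (u : α) : quarticSumSwap Q R a b c d (.inl u) = .inr u := rfl

@[simp]
theorem quarticSumSwap_inr (v : β) : quarticSumSwap Q R a b c d (.inr v) = .inl v := rfl

theorem gdeg_map_iso {G : SimpleGraph α} {H : SimpleGraph β} (e : G ≃g H) (v : α) :
    gdeg H (e v) = gdeg G v :=
  (Nat.card_congr (e.mapNeighborSet v)).symm

theorem gdeg_quarticSum_left [Finite α] (hab : a ≠ b) :
    gdeg (quarticSum Q R a b c d) (.inl a) = gdeg Q a + 1 := by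
  have : (quarticSum Q R a b c d).neighborSet (.inl a) =
      insert (.inr c) (Sum.inl '' Q.neighborSet a) := by
    ext (v | v) <;> simp [hab]
  rw [gdeg, this, Set.ncard_insert_of_notMem (by simp) (Set.toFinite _),
    Set.ncard_image_of_injective _ Sum.inl_injective, gdeg]

theorem gdeg_quarticSum_inl_of_ne {v : α} (ha : v ≠ a) (hb : v ≠ b) :
    gdeg (quarticSum Q R a b c d) (.inl v) = gdeg Q v := by
  have : (quarticSum Q R a b c d).neighborSet (.inl v) = Sum.inl '' Q.neighborSet v := by
    ext (w | w) <;> simp [ha, hb]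
  rw [gdeg, this, Set.ncard_image_of_injective _ Sum.inl_injective, gdeg]

theorem gdeg_quarticSum_right [Finite α] (hab : a ≠ b) :
    gdeg (quarticSum Q R a b c d) (.inl b) = gdeg Q b + 1 := by
  rw [quarticSum_comm, gdeg_quarticSum_left hab.symm]

theorem isTransit_of_isTransit_quarticSum_inl [Finite α] (hab : a ≠ b) (ha : IsTransit Q a)
    (hb : IsTransit Q b) {v : α} (h : IsTransit (quarticSum Q R a b c d) (.inl v)) :
    IsTransit Q v ∧ v ≠ a ∧ v ≠ b := by
  unfold IsTransit at *
  have hva : v ≠ a := by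
    rintro rfl
    rw [gdeg_quarticSum_left hab] at h
    omega
  have hvb : v ≠ b := by
    rintro rfl
    rw [gdeg_quarticSum_right hab] at h
    omega
  rw [gdeg_quarticSum_inl_of_ne hva hvb] at h
  exact ⟨h, hva, hvb⟩

theorem isTransit_of_isTransit_quarticSum_inr [Finite β] (hcd : c ≠ d) (hc : IsTransit R c)
    (hd : IsTransit R d) {v : β} (h : IsTransit (quarticSum Q R a b c d) (.inr v)) :
    IsTransit R v ∧ v ≠ c ∧ v ≠ d := by
  refine isTransit_of_isTransit_quarticSum_inl (R := Q) (c := a) (d := b) hcd hc hd ?_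
  rwa [IsTransit, ← quarticSumSwap_inr (Q := Q), gdeg_map_iso]

theorem gdeg_quarticSum_inl [Finite α] (hab : a ≠ b) (ha : IsTransit Q a) (hb : IsTransit Q b)
    (hQ : ∀ v, gdeg Q v = 3 ∨ gdeg Q v = 4) (v : α) :
    gdeg (quarticSum Q R a b c d) (.inl v) = 3 ∨ gdeg (quarticSum Q R a b c d) (.inl v) = 4 := by
  unfold IsTransit at ha hb
  by_cases hva : v = a
  · subst hva
    rw [gdeg_quarticSum_left hab]
    omega
  by_cases hvb : v = b
  · subst hvb
    rw [gdeg_quarticSum_right hab]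
    omega
  rw [gdeg_quarticSum_inl_of_ne hva hvb]
  exact hQ v

theorem joinAt_sup_joinAt (I O : SimpleGraph α) (I' O' : SimpleGraph β) :
    joinAt I I' a c ⊔ joinAt O O' b d = quarticSum (I ⊔ O) (I' ⊔ O') a b c d := by
  ext (u | u) (v | v) <;> simp

theorem isSpanningTree_joinAt_left [Finite α] [Finite β] {I : SimpleGraph α} {J : SimpleGraph β}
    (hI : IsSpanningTree Q I) (hJ : IsSpanningTree R J) :
    IsSpanningTree (quarticSum Q R a b c d) (joinAt I J a c) := by
  have h : (joinAt I J a c).IsTree := isTree_joinAt ⟨hI.2.1, hI.2.2⟩ ⟨hJ.2.1, hJ.2.2⟩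
  refine ⟨?_, h.1, h.2⟩
  rintro (u | u) (v | v) huv
  · simpa using hI.1 (by simpa using huv)
  · simpa using Or.inl (by simpa using huv)
  · simpa using Or.inl (by simpa using huv)
  · simpa using hJ.1 (by simpa using huv)

theorem isSpanningTree_joinAt_right [Finite α] [Finite β] {I : SimpleGraph α} {J : SimpleGraph β}
    (hI : IsSpanningTree Q I) (hJ : IsSpanningTree R J) :
    IsSpanningTree (quarticSum Q R a b c d) (joinAt I J b d) :=
  quarticSum_comm ▸ isSpanningTree_joinAt_left hI hJ

theorem isQuartic_quarticSum [Finite α] [Finite β] (hQ : IsQuartic Q) (hR : IsQuartic R)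
    (hab : a ≠ b) (hcd : c ≠ d) (ha : IsTransit Q a) (hb : IsTransit Q b)
    (hc : IsTransit R c) (hd : IsTransit R d) : IsQuartic (quarticSum Q R a b c d) := by
  obtain ⟨⟨hα, I, O, hI, hO, hdisj, rfl⟩, hQdeg⟩ := hQ
  obtain ⟨⟨hβ, I', O', hI', hO', hdisj', rfl⟩, hRdeg⟩ := hR
  refine ⟨⟨by rw [Nat.card_sum]; omega, joinAt I I' a c, joinAt O O' b d,
    isSpanningTree_joinAt_left hI hI', isSpanningTree_joinAt_right hO hO',
    joinAt_inf_joinAt hdisj hdisj' hab, joinAt_sup_joinAt I O I' O'⟩, ?_⟩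
  rintro (v | v)
  · exact gdeg_quarticSum_inl hab ha hb hQdeg v
  · rw [← gdeg_map_iso (quarticSumSwap ..)]
    exact gdeg_quarticSum_inl hcd hc hd hRdeg v

/-- Place all vertices of the first summand before those of the second. -/
theorem hasSTTriple_quarticSum_inl_inr [Finite α] [Finite β] (hab : a ≠ b) {s : α} {t : β}
    (hs : HasSTTriple Q s a) (ht : HasSTTriple R d t) :
    HasSTTriple (quarticSum Q R a b c d) (.inl s) (.inr t) := by
  obtain ⟨r, I, O, hI, hO, hdisj, hIl, hOs⟩ := hs
  obtain ⟨r', I', O', hI', hO', hdisj', hIl', hOs'⟩ := ht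
  let L : LinearOrder (α ⊕ β) := LinearOrder.lift' (toLex : α ⊕ β → α ⊕ₗ β) toLex.injective
  have hll : ∀ u v, r.lt u v → L.lt (.inl u) (.inl v) := fun _ _ => Sum.Lex.inl_lt_inl_iff.2
  have hrr : ∀ u v, r'.lt u v → L.lt (.inr u) (.inr v) := fun _ _ => Sum.Lex.inr_lt_inr_iff.2
  have hlr : ∀ u v, L.lt (.inl u) (.inr v) := fun _ _ => Sum.Lex.inl_lt_inr _ _
  refine ⟨L, joinAt I I' a c, joinAt O O' b d, isSpanningTree_joinAt_left hI hI',
    isSpanningTree_joinAt_right hO hO', joinAt_inf_joinAt hdisj hdisj' hab, ?_, ?_⟩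
  · rintro (v | v) hv
    · by_cases hva : v = a
      · exact ⟨.inr c, by simp [hva], hlr _ _⟩
      · obtain ⟨w, hw, hlt⟩ := hIl v hva
        exact ⟨.inl w, by simpa using hw, hll _ _ hlt⟩
    · obtain ⟨w, hw, hlt⟩ := hIl' v (by simpa using hv)
      exact ⟨.inr w, by simpa using hw, hrr _ _ hlt⟩
  · rintro (v | v) hv
    · obtain ⟨w, hw, hlt⟩ := hOs v (by simpa using hv)
      exact ⟨.inl w, by simpa using hw, hll _ _ hlt⟩
    · by_cases hvd : v = d
      · exact ⟨.inl b, by simp [hvd], hlr _ _⟩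
      · obtain ⟨w, hw, hlt⟩ := hOs' v hvd
        exact ⟨.inr w, by simpa using hw, hrr _ _ hlt⟩

/-- There is a linear order on `α ⊕ β` extending those of the summands in which `β` is inserted
immediately after the element `a` of `α`. -/
theorem exists_linearOrder_sum_insert_after (r : LinearOrder α) (r' : LinearOrder β) (a : α) :
    ∃ L : LinearOrder (α ⊕ β), (∀ u v, r.lt u v → L.lt (.inl u) (.inl v)) ∧
      (∀ u v, r'.lt u v → L.lt (.inr u) (.inr v)) ∧ (∀ v, L.lt (.inl a) (.inr v)) ∧
      ∀ u v, r.lt a u → L.lt (.inr v) (.inl u) := by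
  let f : α ⊕ β → α ×ₗ WithBot β := Sum.elim (fun u => toLex (u, ⊥)) (fun v => toLex (a, ↑v))
  have hf : Function.Injective f := by
    rintro (u | u) (v | v) h <;> simp_all [f]
  refine ⟨LinearOrder.lift' f hf, fun u v h => ?_, fun u v h => ?_, fun v => ?_,
    fun u v h => ?_⟩
  · exact Prod.Lex.toLex_lt_toLex.2 (.inl h)
  · exact Prod.Lex.toLex_lt_toLex.2 (.inr ⟨rfl, WithBot.coe_lt_coe.2 h⟩)
  · exact Prod.Lex.toLex_lt_toLex.2 (.inr ⟨rfl, WithBot.bot_lt_coe v⟩)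
  · exact Prod.Lex.toLex_lt_toLex.2 (.inl h)

theorem hasSTTriple_quarticSum_inl_inl [Finite α] [Finite β] (hab : a ≠ b) {s t : α}
    (hst : HasSTTriple Q s t) (hcd : HasSTTriple R c d) :
    HasSTTriple (quarticSum Q R a b c d) (.inl s) (.inl t) := by
  obtain ⟨r, I, O, hI, hO, hdisj, hIl, hOs⟩ := hst
  wlog hlt : r.lt a b generalizing a b c d
  · rw [quarticSum_comm]
    exact this hab.symm hcd.symm ((@lt_or_gt_of_ne _ r _ _ hab).resolve_left hlt)
  obtain ⟨r', I', O', hI', hO', hdisj', hIl', hOs'⟩ := hcd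
  obtain ⟨L, hll, hrr, hlr, hrl⟩ := exists_linearOrder_sum_insert_after r r' a
  refine ⟨L, joinAt I I' b d, joinAt O O' a c, isSpanningTree_joinAt_right hI hI',
    isSpanningTree_joinAt_left hO hO', joinAt_inf_joinAt hdisj hdisj' hab.symm, ?_, ?_⟩
  · rintro (v | v) hv
    · obtain ⟨w, hw, hlt⟩ := hIl v (by simpa using hv)
      exact ⟨.inl w, by simpa using hw, hll _ _ hlt⟩
    · by_cases hvd : v = d
      · exact ⟨.inl b, by simp [hvd], hrl _ _ hlt⟩
      · obtain ⟨w, hw, hlt⟩ := hIl' v hvd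
        exact ⟨.inr w, by simpa using hw, hrr _ _ hlt⟩
  · rintro (v | v) hv
    · obtain ⟨w, hw, hlt⟩ := hOs v (by simpa using hv)
      exact ⟨.inl w, by simpa using hw, hll _ _ hlt⟩
    · by_cases hvc : v = c
      · exact ⟨.inl a, by simp [hvc], hvc ▸ hlr _⟩
      · obtain ⟨w, hw, hlt⟩ := hOs' v hvc
        exact ⟨.inr w, by simpa using hw, hrr _ _ hlt⟩

theorem excellent_quarticSum [Finite α] [Finite β] (hQe : Excellent Q) (hRe : Excellent R)
    (hab : a ≠ b) (hcd : c ≠ d) (ha : IsTransit Q a) (hb : IsTransit Q b)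
    (hc : IsTransit R c) (hd : IsTransit R d) : Excellent (quarticSum Q R a b c d) := by
  have mixed : ∀ (s : α) (t : β), IsTransit (quarticSum Q R a b c d) (.inl s) →
      IsTransit (quarticSum Q R a b c d) (.inr t) →
      HasSTTriple (quarticSum Q R a b c d) (.inl s) (.inr t) := by
    intro s t hs ht
    obtain ⟨hs, hsa, -⟩ := isTransit_of_isTransit_quarticSum_inl hab ha hb hs
    obtain ⟨ht, -, htd⟩ := isTransit_of_isTransit_quarticSum_inr hcd hc hd ht
    exact hasSTTriple_quarticSum_inl_inr hab (hQe s a hs ha hsa) (hRe d t hd ht htd.symm)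
  rintro (s | s) (t | t) hs ht hst
  · have hs' := (isTransit_of_isTransit_quarticSum_inl hab ha hb hs).1
    have ht' := (isTransit_of_isTransit_quarticSum_inl hab ha hb ht).1
    exact hasSTTriple_quarticSum_inl_inl hab (hQe s t hs' ht' (by simpa using hst))
      (hRe c d hc hd hcd)
  · exact mixed s t hs ht
  · exact (mixed t s ht hs).symm
  · have hs' := (isTransit_of_isTransit_quarticSum_inr hcd hc hd hs).1
    have ht' := (isTransit_of_isTransit_quarticSum_inr hcd hc hd ht).1
    exact (hasSTTriple_quarticSum_inl_inl hcd (hRe s t hs' ht' (by simpa using hst))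
      (hQe a b ha hb hab)).map_iso (quarticSumSwap R Q c d a b)

end quarticSum

end SumOfQuartics

/-- Any sum of two excellent quartics is an excellent quartic. -/
theorem stmt5 {α β : Type u} [Fintype α] [Fintype β]
    (Q : SimpleGraph α) (R : SimpleGraph β)
    (hQ : IsQuartic Q) (hR : IsQuartic R) (hQe : Excellent Q) (hRe : Excellent R)
    (a b : α) (c d : β) (hab : a ≠ b) (hcd : c ≠ d)
    (ha : IsTransit Q a) (hb : IsTransit Q b) (hc : IsTransit R c) (hd : IsTransit R d) :
    IsQuartic (quarticSum Q R a b c d) ∧ Excellent (quarticSum Q R a b c d) := by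
  exact ⟨isQuartic_quarticSum hQ hR hab hcd ha hb hc hd,
    excellent_quarticSum hQe hRe hab hcd ha hb hc hd⟩
end

section
/- Let G be a quartic and let P be an excellent partition of V(G). If the quotient graph G/P is an excellent quartic, then G is excellent. -/
open SimpleGraph

universe u

variable {V : Type u}

/-- The (simple) quotient graph of `G` by a partition (setoid) `P`: parts are the
vertices, and two distinct parts are joined whenever some edge of `G` connects them. -/
def quotientGraph (G : SimpleGraph V) (P : Setoid V) : SimpleGraph (Quotient P) :=
  SimpleGraph.fromRel fun x y =>
    ∃ u v : V, x = Quotient.mk P u ∧ y = Quotient.mk P v ∧ G.Adj u v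

theorem IsTwoT.card_edgeSet [Finite V] {G : SimpleGraph V} (hG : IsTwoT G) :
    Nat.card G.edgeSet + 2 = 2 * Nat.card V := by
  obtain ⟨-, I, O, ⟨-, hIc, hIa⟩, ⟨-, hOc, hOa⟩, hd, rfl⟩ := hG
  have hI := (isTree_iff_connected_and_card.1 ⟨hIc, hIa⟩).2
  have hO := (isTree_iff_connected_and_card.1 ⟨hOc, hOa⟩).2
  have hdis : Disjoint I.edgeSet O.edgeSet := by
    rw [Set.disjoint_iff_inter_eq_empty, ← edgeSet_inf, hd, edgeSet_bot]
  have h := Set.ncard_union_eq hdis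
  rw [← edgeSet_sup] at h
  rw [Nat.card_coe_set_eq] at *
  omega

/-- In a 2T-graph, two edge-disjoint connected spanning subgraphs are spanning trees. -/
theorem IsTwoT.isAcyclic_of_connected [Finite V] {G I O : SimpleGraph V} (hG : IsTwoT G)
    (hIG : I ≤ G) (hOG : O ≤ G) (hI : I.Connected) (hO : O.Connected) (hd : I ⊓ O = ⊥) :
    I.IsAcyclic ∧ O.IsAcyclic := by
  have hcard := hG.card_edgeSet
  have h1 := hI.card_vert_le_card_edgeSet_add_one
  have h2 := hO.card_vert_le_card_edgeSet_add_one
  have hdis : Disjoint I.edgeSet O.edgeSet := by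
    rw [Set.disjoint_iff_inter_eq_empty, ← edgeSet_inf, hd, edgeSet_bot]
  have h3 : Nat.card I.edgeSet + Nat.card O.edgeSet ≤ Nat.card G.edgeSet := by
    have h := Set.ncard_union_eq hdis
    have h' : (I.edgeSet ∪ O.edgeSet).ncard ≤ G.edgeSet.ncard :=
      Set.ncard_le_ncard (Set.union_subset (edgeSet_mono hIG) (edgeSet_mono hOG))
    simp only [Nat.card_coe_set_eq]
    omega
  exact ⟨(isTree_iff_connected_and_card.2 ⟨hI, by omega⟩).isAcyclic,
    (isTree_iff_connected_and_card.2 ⟨hO, by omega⟩).isAcyclic⟩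

theorem gdeg_eq_degree [Fintype V] (G : SimpleGraph V) [DecidableRel G.Adj] (v : V) :
    gdeg G v = G.degree v := by
  rw [gdeg, Set.ncard_eq_toFinset_card', ← card_neighborFinset_eq_degree]
  rfl

theorem IsQuartic.ncard_transits [Finite V] {G : SimpleGraph V} (hG : IsQuartic G) :
    {v | IsTransit G v}.ncard = 4 := by
  classical
  have := Fintype.ofFinite V
  have hc := hG.1.card_edgeSet
  have hs := G.sum_degrees_eq_twice_card_edges
  rw [Nat.card_eq_fintype_card, Nat.card_eq_fintype_card, ← edgeFinset_card] at hc
  have hsum : ∑ v, (G.degree v + if gdeg G v = 3 then 1 else 0) = ∑ _v : V, 4 := by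
    refine Finset.sum_congr rfl fun v _ => ?_
    rw [← gdeg_eq_degree]
    rcases hG.2 v with h | h <;> simp [h]
  rw [Finset.sum_add_distrib, Finset.sum_boole] at hsum
  simp only [Finset.sum_const, Finset.card_univ, smul_eq_mul, Nat.cast_id] at hsum
  rw [show {v | IsTransit G v} = ↑(Finset.univ.filter fun v => gdeg G v = 3) by
    ext; simp [IsTransit], Set.ncard_coe_finset]
  omega

theorem gdeg_induce (G : SimpleGraph V) (S : Set V) (v : S) :
    gdeg (G.induce S) v = (G.neighborSet v ∩ S).ncard := by
  rw [gdeg, ← Set.ncard_image_of_injective _ Subtype.val_injective]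
  congr 1
  ext w
  simp [and_comm]

/-- In a graph of maximum degree four, a vertex of an induced quartic which has a neighbor
outside has degree four, is a transit of the quartic, and has only one such neighbor. -/
theorem IsQuartic.of_adj_outside [Finite V] {G : SimpleGraph V} {S : Set V}
    (hH : IsQuartic (G.induce S)) {v w : V} (hv : v ∈ S) (hG : gdeg G v ≤ 4) (hw : w ∉ S)
    (hvw : G.Adj v w) :
    gdeg G v = 4 ∧ IsTransit (G.induce S) ⟨v, hv⟩ ∧ ∀ w', w' ∉ S → G.Adj v w' → w' = w := by
  have h1 := hH.2 ⟨v, hv⟩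
  have h2 := Set.ncard_inter_add_ncard_sdiff_eq_ncard (G.neighborSet v) S
  rw [IsTransit]
  rw [gdeg_induce] at *
  have h3 : 0 < (G.neighborSet v \ S).ncard := (Set.ncard_pos).2 ⟨w, hvw, hw⟩
  simp only [gdeg] at *
  refine ⟨by omega, by omega, fun w' hw' hvw' => ?_⟩
  exact (Set.ncard_le_one (s := G.neighborSet v \ S)).1 (by omega) _ ⟨hvw', hw'⟩ _ ⟨hvw, hw⟩

theorem IsQuartic.induce_isTransit [Finite V] {G : SimpleGraph V} {S : Set V}
    (hH : IsQuartic (G.induce S)) {v : V} (hv : v ∈ S) (hG : IsTransit G v) :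
    IsTransit (G.induce S) ⟨v, hv⟩ := by
  have h1 := hH.2 ⟨v, hv⟩
  have h2 := Set.ncard_inter_add_ncard_sdiff_eq_ncard (G.neighborSet v) S
  rw [IsTransit] at *
  rw [gdeg_induce] at *
  simp only [gdeg] at *
  omega

/-- An `(s,t)`-triple of the graph induced by `S`, with the order given by a rank function and
with the spanning trees replaced by graphs that are merely connected on `S`. -/
def HasTripleOn (G : SimpleGraph V) (S : Set V) (s t : V) : Prop :=
  ∃ (f : V → ℕ) (I O : SimpleGraph V), I ≤ G ∧ O ≤ G ∧ I ⊓ O = ⊥ ∧ Set.InjOn f S ∧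
    (∀ u ∈ S, ∀ v ∈ S, (I.induce S).spanningCoe.Reachable u v) ∧
    (∀ u ∈ S, ∀ v ∈ S, (O.induce S).spanningCoe.Reachable u v) ∧
    (∀ v ∈ S, v ≠ t → ∃ w ∈ S, I.Adj v w ∧ f v < f w) ∧
    (∀ v ∈ S, v ≠ s → ∃ w ∈ S, O.Adj v w ∧ f w < f v)

theorem hasTripleOn_singleton (G : SimpleGraph V) (a : V) : HasTripleOn G {a} a a := by
  refine ⟨fun _ => 0, ⊥, ⊥, bot_le, bot_le, by simp, by simp, ?_, ?_, ?_, ?_⟩ <;>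
    simp +contextual

theorem exists_rank [Finite V] (r : LinearOrder V) :
    ∃ f : V → ℕ, Function.Injective f ∧ ∀ a b, r.lt a b → f a < f b := by
  have hlt : ∀ a b : V, a < b → {x | x < a}.ncard < {x | x < b}.ncard := fun a b hab =>
    Set.ncard_lt_ncard ⟨fun x hx => lt_trans hx hab, fun h => lt_irrefl a (h hab)⟩
  refine ⟨fun a => {x | x < a}.ncard, fun a b hab => ?_, hlt⟩
  rcases lt_trichotomy a b with h | h | h
  · exact absurd hab (hlt _ _ h).ne
  · exact h
  · exact absurd hab (hlt _ _ h).ne'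

theorem HasSTTriple.hasTripleOn [Finite V] {G : SimpleGraph V} {S : Set V} {s t : S}
    (h : HasSTTriple (G.induce S) s t) : HasTripleOn G S s t := by
  classical
  obtain ⟨r, I, O, ⟨hIG, hIc, -⟩, ⟨hOG, hOc, -⟩, hd, hI, hO⟩ := h
  obtain ⟨f, hf, hfr⟩ := exists_rank r
  have hle : ∀ T : SimpleGraph S, T ≤ G.induce S → T.spanningCoe ≤ G := fun T hT a b hab => by
    obtain ⟨a', b', hab', rfl, rfl⟩ := (SimpleGraph.map_adj _ _ _ _).1 hab
    exact hT hab'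
  have hreach : ∀ T : SimpleGraph S, T.Connected → ∀ u ∈ S, ∀ v ∈ S,
      (T.spanningCoe.induce S).spanningCoe.Reachable u v := fun T hT u hu v hv => by
    rw [SimpleGraph.induce_spanningCoe]
    exact (hT.preconnected ⟨u, hu⟩ ⟨v, hv⟩).map (Embedding.spanningCoe T).toHom
  have hadj : ∀ T : SimpleGraph S, ∀ a b, T.Adj a b → T.spanningCoe.Adj a b := fun T a b hab =>
    (SimpleGraph.map_adj _ _ _ _).2 ⟨a, b, hab, rfl, rfl⟩
  refine ⟨fun v => if hv : v ∈ S then f ⟨v, hv⟩ else 0, I.spanningCoe, O.spanningCoe,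
    hle I hIG, hle O hOG, ?_, ?_, hreach I hIc, hreach O hOc, ?_, ?_⟩
  · refine eq_bot_iff.2 fun a b hab => ?_
    obtain ⟨a', b', hab', rfl, rfl⟩ := (SimpleGraph.map_adj _ _ _ _).1 hab.1
    obtain ⟨a'', b'', hab'', ha, hb⟩ := (SimpleGraph.map_adj _ _ _ _).1 hab.2
    obtain rfl := Subtype.ext ha
    obtain rfl := Subtype.ext hb
    have : (I ⊓ O).Adj a'' b'' := ⟨hab', hab''⟩
    rw [hd] at this
    exact this.elim
  · intro a ha b hb hab
    simp only [dif_pos ha, dif_pos hb] at hab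
    exact congrArg Subtype.val (hf hab)
  · intro v hv hvt
    obtain ⟨w, hw, hlt⟩ := hI ⟨v, hv⟩ fun h => hvt (congrArg Subtype.val h)
    refine ⟨w, w.2, hadj _ _ _ hw, ?_⟩
    simpa [hv] using hfr _ _ hlt
  · intro v hv hvt
    obtain ⟨w, hw, hlt⟩ := hO ⟨v, hv⟩ fun h => hvt (congrArg Subtype.val h)
    refine ⟨w, w.2, hadj _ _ _ hw, ?_⟩
    simpa [hv] using hfr _ _ hlt

theorem quotientGraph_adj {G : SimpleGraph V} {P : Setoid V} {x y : Quotient P} :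
    (quotientGraph G P).Adj x y ↔
      x ≠ y ∧ ∃ u v, Quotient.mk P u = x ∧ Quotient.mk P v = y ∧ G.Adj u v := by
  rw [quotientGraph, SimpleGraph.fromRel_adj]
  refine and_congr_right fun _ => ⟨?_, ?_⟩
  · rintro (⟨u, v, rfl, rfl, h⟩ | ⟨u, v, rfl, rfl, h⟩)
    · exact ⟨u, v, rfl, rfl, h⟩
    · exact ⟨v, u, rfl, rfl, h.symm⟩
  · rintro ⟨u, v, rfl, rfl, h⟩
    exact Or.inl ⟨u, v, rfl, rfl, h⟩

/-- The union of the graphs `J q` inside the parts `q` with the edges of `G` lying over `T`. -/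
def glue (G : SimpleGraph V) (P : Setoid V) (J : Quotient P → SimpleGraph V)
    (T : SimpleGraph (Quotient P)) : SimpleGraph V where
  Adj u v := (Quotient.mk P u = Quotient.mk P v ∧ (J (Quotient.mk P u)).Adj u v) ∨
    (G.Adj u v ∧ T.Adj (Quotient.mk P u) (Quotient.mk P v))
  symm := ⟨fun u v h => by
    rcases h with ⟨h, h'⟩ | ⟨h, h'⟩
    · exact Or.inl ⟨h.symm, h ▸ h'.symm⟩
    · exact Or.inr ⟨h.symm, h'.symm⟩⟩
  loopless := ⟨fun u h => by
    rcases h with ⟨_, h⟩ | ⟨h, _⟩ <;> exact h.ne rfl⟩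

theorem glue_le {G : SimpleGraph V} {P : Setoid V} {J : Quotient P → SimpleGraph V}
    (T : SimpleGraph (Quotient P)) (hJ : ∀ q, J q ≤ G) : glue G P J T ≤ G := by
  rintro u v (⟨_, h⟩ | ⟨h, _⟩)
  · exact hJ _ h
  · exact h

theorem glue_inf_glue {G : SimpleGraph V} {P : Setoid V} {J J' : Quotient P → SimpleGraph V}
    {T T' : SimpleGraph (Quotient P)} (hJ : ∀ q, J q ⊓ J' q = ⊥) (hT : T ⊓ T' = ⊥) :
    glue G P J T ⊓ glue G P J' T' = ⊥ := by
  refine eq_bot_iff.2 fun u v h => ?_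
  rcases h with ⟨⟨h1, h2⟩ | ⟨h1, h2⟩, ⟨h3, h4⟩ | ⟨h3, h4⟩⟩
  · have : (J (Quotient.mk P u) ⊓ J' (Quotient.mk P u)).Adj u v := ⟨h2, h4⟩
    rw [hJ] at this
    exact this.elim
  · exact (h4.ne h1).elim
  · exact (h2.ne h3).elim
  · have : (T ⊓ T').Adj (Quotient.mk P u) (Quotient.mk P v) := ⟨h2, h4⟩
    rw [hT] at this
    exact this.elim

theorem glue_connected {G : SimpleGraph V} {P : Setoid V} {J : Quotient P → SimpleGraph V}
    {T : SimpleGraph (Quotient P)} (hTG : T ≤ quotientGraph G P) (hT : T.Connected)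
    (hJ : ∀ q, ∀ u ∈ {v | Quotient.mk P v = q}, ∀ v ∈ {v | Quotient.mk P v = q},
      ((J q).induce {v | Quotient.mk P v = q}).spanningCoe.Reachable u v) :
    (glue G P J T).Connected := by
  have hin : ∀ u v, Quotient.mk P u = Quotient.mk P v → (glue G P J T).Reachable u v := by
    intro u v huv
    refine (hJ (Quotient.mk P v) u huv v rfl).mono fun a b hab => ?_
    obtain ⟨⟨a, ha⟩, ⟨b, hb⟩, hab', rfl, rfl⟩ := (SimpleGraph.map_adj _ _ _ _).1 hab
    exact Or.inl ⟨ha.trans hb.symm, ha.symm ▸ hab'⟩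
  have key : ∀ q q' (_ : T.Walk q q') (u v : V), Quotient.mk P u = q → Quotient.mk P v = q' →
      (glue G P J T).Reachable u v := by
    intro q q' p
    induction p with
    | nil => exact fun u v hu hv => hin u v (hu.trans hv.symm)
    | cons h p ih =>
      intro u v hu hv
      obtain ⟨-, x, y, hx, hy, hxy⟩ := quotientGraph_adj.1 (hTG h)
      have hadj : (glue G P J T).Adj x y := Or.inr ⟨hxy, by rw [hx, hy]; exact h⟩
      exact (hin u x (hu.trans hx.symm)).trans (hadj.reachable.trans (ih y v hy hv))
  obtain ⟨q⟩ := hT.nonempty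
  have : Nonempty V := ⟨q.out⟩
  exact ⟨fun u v => (hT.preconnected (Quotient.mk P u) (Quotient.mk P v)).elim
    fun p => key _ _ p u v rfl rfl⟩

/-- The number of neighbors of a part inducing a quartic, plus the number of transits of `G`
in that part, is at most four. -/
theorem gdeg_quotientGraph_add_ncard_le [Finite V] {G : SimpleGraph V} {P : Setoid V}
    (hG : ∀ v, gdeg G v ≤ 4) {q : Quotient P}
    (hH : IsQuartic (G.induce {v | Quotient.mk P v = q})) :
    gdeg (quotientGraph G P) q + {v | Quotient.mk P v = q ∧ IsTransit G v}.ncard ≤ 4 := by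
  have h : ∀ x : Quotient P, ∃ u, (quotientGraph G P).Adj q x →
      Quotient.mk P u = q ∧ q ≠ x ∧ ∃ w, Quotient.mk P w = x ∧ G.Adj u w := by
    intro x
    by_cases hx : (quotientGraph G P).Adj q x
    · obtain ⟨hne, u, w, hu, hw, huw⟩ := quotientGraph_adj.1 hx
      exact ⟨u, fun _ => ⟨hu, hne, w, hw, huw⟩⟩
    · exact ⟨q.out, fun h => absurd h hx⟩
  choose f hf using h
  have hinj : Set.InjOn f ((quotientGraph G P).neighborSet q) := by
    intro x hx y hy hxy
    obtain ⟨hu, hne, w, rfl, huw⟩ := hf x hx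
    obtain ⟨hu', hne', w', rfl, huw'⟩ := hf y hy
    rw [← hxy] at huw'
    rw [(hH.of_adj_outside hu (hG _) (Ne.symm hne) huw).2.2 w' (Ne.symm hne') huw']
  have hdis : Disjoint (f '' (quotientGraph G P).neighborSet q)
      {v | Quotient.mk P v = q ∧ IsTransit G v} := by
    rw [Set.disjoint_left]
    rintro _ ⟨x, hx, rfl⟩ ⟨-, ht⟩
    obtain ⟨hu, hne, w, rfl, huw⟩ := hf x hx
    have := (hH.of_adj_outside hu (hG _) (Ne.symm hne) huw).1
    rw [IsTransit] at ht
    omega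
  rw [gdeg, ← hinj.ncard_image, ← Set.ncard_union_eq hdis, ← hH.ncard_transits,
    ← Set.ncard_image_of_injective {v | IsTransit (G.induce {v | Quotient.mk P v = q}) v}
      Subtype.val_injective]
  refine Set.ncard_le_ncard ?_
  rintro v (⟨x, hx, rfl⟩ | ⟨hv, ht⟩)
  · obtain ⟨hu, hne, w, rfl, huw⟩ := hf x hx
    exact ⟨⟨f _, hu⟩, (hH.of_adj_outside hu (hG _) (Ne.symm hne) huw).2.1, rfl⟩
  · exact ⟨⟨v, hv⟩, hH.induce_isTransit hv ht, rfl⟩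

theorem gdeg_quotientGraph_le_of_singleton [Finite V] {G : SimpleGraph V} {P : Setoid V} {v : V}
    (hv : {u | Quotient.mk P u = Quotient.mk P v} = {v}) :
    gdeg (quotientGraph G P) (Quotient.mk P v) ≤ gdeg G v := by
  refine le_trans (Set.ncard_le_ncard ?_) (Set.ncard_image_le (f := Quotient.mk P))
  intro x hx
  obtain ⟨-, u, w, hu, rfl, huw⟩ := quotientGraph_adj.1 hx
  obtain rfl : u = v := by
    have : u ∈ {u | Quotient.mk P u = Quotient.mk P v} := hu
    rwa [hv] at this
  exact ⟨w, huw, rfl⟩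

/-- Triples of the quotient graph and of the parts combine to a triple of the 2T-graph `G`. -/
theorem hasSTTriple_of_quotient [Finite V] {G : SimpleGraph V} {P : Setoid V} (hG : IsTwoT G)
    {s t : V} {g : Quotient P → ℕ} (hg : Function.Injective g) {I O : SimpleGraph (Quotient P)}
    (hI : IsSpanningTree (quotientGraph G P) I) (hO : IsSpanningTree (quotientGraph G P) O)
    (hd : I ⊓ O = ⊥) {a b : Quotient P → V}
    (hb : ∀ q, b q = t ∨ ∃ w, G.Adj (b q) w ∧ I.Adj (Quotient.mk P (b q)) (Quotient.mk P w) ∧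
      g (Quotient.mk P (b q)) < g (Quotient.mk P w))
    (ha : ∀ q, a q = s ∨ ∃ w, G.Adj (a q) w ∧ O.Adj (Quotient.mk P (a q)) (Quotient.mk P w) ∧
      g (Quotient.mk P w) < g (Quotient.mk P (a q)))
    (hab : ∀ q, HasTripleOn G {v | Quotient.mk P v = q} (a q) (b q)) :
    HasSTTriple G s t := by
  choose f J K hJG hKG hJK hf hJc hKc hJ hK using hab
  let F : V → ℕ ×ₗ ℕ := fun v => toLex (g (Quotient.mk P v), f (Quotient.mk P v) v)
  have hF : Function.Injective F := by
    intro u v huv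
    have h := Prod.ext_iff.1 (toLex_inj.1 huv)
    have hq : Quotient.mk P u = Quotient.mk P v := hg h.1
    refine hf (Quotient.mk P v) hq rfl ?_
    have h2 : f (Quotient.mk P u) u = f (Quotient.mk P v) v := h.2
    rwa [hq] at h2
  have hIc := glue_connected hI.1 hI.2.1 hJc
  have hOc := glue_connected hO.1 hO.2.1 hKc
  have hle := glue_le I hJG
  have hle' := glue_le O hKG
  have hdis : glue G P J I ⊓ glue G P K O = ⊥ := glue_inf_glue hJK hd
  obtain ⟨hIa, hOa⟩ := hG.isAcyclic_of_connected hle hle' hIc hOc hdis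
  refine ⟨LinearOrder.lift' F hF, glue G P J I, glue G P K O, ⟨hle, hIc, hIa⟩,
    ⟨hle', hOc, hOa⟩, hdis, fun v hv => ?_, fun v hv => ?_⟩
  · by_cases hvb : v = b (Quotient.mk P v)
    · rcases hb (Quotient.mk P v) with h | ⟨w, h1, h2, h3⟩
      · exact absurd (hvb.trans h) hv
      · rw [← hvb] at h1 h2 h3
        exact ⟨w, Or.inr ⟨h1, h2⟩, (Prod.Lex.toLex_lt_toLex.2 (Or.inl h3) : F v < F w)⟩
    · obtain ⟨w, hw, h1, h2⟩ := hJ _ v rfl hvb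
      refine ⟨w, Or.inl ⟨Eq.symm hw, h1⟩,
        (Prod.Lex.toLex_lt_toLex.2 (Or.inr ⟨?_, ?_⟩) : F v < F w)⟩
      · exact congrArg g (Eq.symm hw)
      · have hw' : Quotient.mk P w = Quotient.mk P v := hw
        simpa only [hw'] using h2
  · by_cases hvb : v = a (Quotient.mk P v)
    · rcases ha (Quotient.mk P v) with h | ⟨w, h1, h2, h3⟩
      · exact absurd (hvb.trans h) hv
      · rw [← hvb] at h1 h2 h3
        exact ⟨w, Or.inr ⟨h1, h2⟩, (Prod.Lex.toLex_lt_toLex.2 (Or.inl h3) : F w < F v)⟩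
    · obtain ⟨w, hw, h1, h2⟩ := hK _ v rfl hvb
      refine ⟨w, Or.inl ⟨Eq.symm hw, h1⟩,
        (Prod.Lex.toLex_lt_toLex.2 (Or.inr ⟨?_, ?_⟩) : F w < F v)⟩
      · exact congrArg g hw
      · have hw' : Quotient.mk P w = Quotient.mk P v := hw
        simpa only [hw'] using h2

/-- Let `G` be a quartic and `P` an excellent partition of its vertex set
(every class with more than one vertex induces an excellent quartic).  If the quotient
`G/P` is an excellent quartic (in particular it has no parallel edges, i.e. there is at
most one edge of `G` between any two distinct classes), then `G` is excellent. -/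
theorem stmt6 [Fintype V] (G : SimpleGraph V) (P : Setoid V)
    (hG : IsQuartic G)
    (hexc : ∀ x : V, 1 < ({y : V | P.r x y} : Set V).ncard →
      IsQuartic (G.induce {y : V | P.r x y}) ∧ Excellent (G.induce {y : V | P.r x y}))
    (hsimple : ∀ u v u' v' : V, G.Adj u v → G.Adj u' v' →
      Quotient.mk P u = Quotient.mk P u' → Quotient.mk P v = Quotient.mk P v' →
      Quotient.mk P u ≠ Quotient.mk P v → u = u' ∧ v = v')
    (hQq : IsQuartic (quotientGraph G P))
    (hQe : Excellent (quotientGraph G P)) :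
    Excellent G := by
  intro s t hs ht hst
  have hG4 : ∀ v, gdeg G v ≤ 4 := fun v => by rcases hG.2 v with h | h <;> omega
  have hclass : ∀ x : V, {y : V | P.r x y} = {y | Quotient.mk P y = Quotient.mk P x} := by
    intro x
    ext y
    exact ⟨fun h => (Quotient.sound h).symm, fun h => Quotient.exact (Eq.symm h)⟩
  have hpart : ∀ x : V, {y | Quotient.mk P y = Quotient.mk P x} = {x} ∨
      (IsQuartic (G.induce {y | Quotient.mk P y = Quotient.mk P x}) ∧
        Excellent (G.induce {y | Quotient.mk P y = Quotient.mk P x})) := by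
    intro x
    have h := hexc x
    rw [hclass] at h
    by_cases hx : 1 < {y | Quotient.mk P y = Quotient.mk P x}.ncard
    · exact Or.inr (h hx)
    · refine Or.inl (Set.eq_singleton_iff_unique_mem.2 ⟨rfl, fun y hy => ?_⟩)
      exact (Set.ncard_le_one (Set.toFinite _)).1 (not_lt.1 hx) y hy x rfl
  have htrans : ∀ x, IsTransit G x → IsTransit (quotientGraph G P) (Quotient.mk P x) := by
    intro x hx
    have h34 := hQq.2 (Quotient.mk P x)
    rcases hpart x with h | ⟨h, -⟩
    · have h1 := gdeg_quotientGraph_le_of_singleton (G := G) h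
      rw [IsTransit] at *
      omega
    · have h1 := gdeg_quotientGraph_add_ncard_le hG4 h
      have h2 : 0 < {v | Quotient.mk P v = Quotient.mk P x ∧ IsTransit G v}.ncard :=
        (Set.ncard_pos).2 ⟨x, rfl, hx⟩
      rw [IsTransit]
      omega
  have hne : Quotient.mk P s ≠ Quotient.mk P t := by
    intro heq
    have h34 := hQq.2 (Quotient.mk P t)
    rcases hpart t with h | ⟨h, -⟩
    · have : s ∈ {y | Quotient.mk P y = Quotient.mk P t} := heq
      rw [h] at this
      exact hst this
    · have h1 := gdeg_quotientGraph_add_ncard_le hG4 h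
      have h2 : 1 < {v | Quotient.mk P v = Quotient.mk P t ∧ IsTransit G v}.ncard :=
        (Set.one_lt_ncard).2 ⟨s, ⟨heq, hs⟩, t, ⟨rfl, ht⟩, hst⟩
      omega
  obtain ⟨r, I, O, hI, hO, hd, hIup, hOdown⟩ := hQe _ _ (htrans s hs) (htrans t ht) hne
  obtain ⟨g, hg, hgr⟩ := exists_rank r
  have hb : ∀ q, ∃ b, Quotient.mk P b = q ∧ (b = t ∨ ∃ w, G.Adj b w ∧
      I.Adj (Quotient.mk P b) (Quotient.mk P w) ∧
      g (Quotient.mk P b) < g (Quotient.mk P w)) := by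
    intro q
    by_cases hq : q = Quotient.mk P t
    · exact ⟨t, hq.symm, Or.inl rfl⟩
    · obtain ⟨x, hx, hlt⟩ := hIup q hq
      obtain ⟨-, u, w, rfl, rfl, huw⟩ := quotientGraph_adj.1 (hI.1 hx)
      exact ⟨u, rfl, Or.inr ⟨w, huw, hx, hgr _ _ hlt⟩⟩
  have ha : ∀ q, ∃ a, Quotient.mk P a = q ∧ (a = s ∨ ∃ w, G.Adj a w ∧
      O.Adj (Quotient.mk P a) (Quotient.mk P w) ∧
      g (Quotient.mk P w) < g (Quotient.mk P a)) := by
    intro q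
    by_cases hq : q = Quotient.mk P s
    · exact ⟨s, hq.symm, Or.inl rfl⟩
    · obtain ⟨x, hx, hlt⟩ := hOdown q hq
      obtain ⟨-, u, w, rfl, rfl, huw⟩ := quotientGraph_adj.1 (hO.1 hx)
      exact ⟨u, rfl, Or.inr ⟨w, huw, hx, hgr _ _ hlt⟩⟩
  choose b hbq hb using hb
  choose a haq ha using ha
  refine hasSTTriple_of_quotient hG.1 hg hI hO hd hb ha fun q => ?_
  have hq := hpart q.out
  rw [show Quotient.mk P q.out = q from q.out_eq] at hq
  rcases hq with h | ⟨hH, hHe⟩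
  · have h1 : a q ∈ {y | Quotient.mk P y = q} := haq q
    have h2 : b q ∈ {y | Quotient.mk P y = q} := hbq q
    rw [h] at h1 h2
    rw [h, h1, h2]
    exact hasTripleOn_singleton G _
  have hout : ∀ {v w : V}, Quotient.mk P v = q → G.Adj v w →
      (quotientGraph G P).Adj (Quotient.mk P v) (Quotient.mk P w) →
      gdeg G v = 4 ∧ (∀ hv, IsTransit (G.induce {y | Quotient.mk P y = q}) ⟨v, hv⟩) ∧
        ∀ w', Quotient.mk P w' ≠ q → G.Adj v w' → w' = w := by
    intro v w hv hvw hadj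
    have h := hH.of_adj_outside hv (hG4 v) (fun hw : Quotient.mk P w = q =>
      hadj.ne (hv.trans hw.symm)) hvw
    exact ⟨h.1, fun _ => h.2.1, h.2.2⟩
  have hta : IsTransit (G.induce {y | Quotient.mk P y = q}) ⟨a q, haq q⟩ := by
    rcases ha q with h | ⟨w, h1, h2, -⟩
    · exact hH.induce_isTransit (haq q) (h ▸ hs)
    · exact (hout (haq q) h1 (hO.1 h2)).2.1 _
  have htb : IsTransit (G.induce {y | Quotient.mk P y = q}) ⟨b q, hbq q⟩ := by
    rcases hb q with h | ⟨w, h1, h2, -⟩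
    · exact hH.induce_isTransit (hbq q) (h ▸ ht)
    · exact (hout (hbq q) h1 (hI.1 h2)).2.1 _
  have hab : a q ≠ b q := by
    intro hab
    rcases ha q with h | ⟨w, h1, h2, h3⟩
    · rcases hb q with h' | ⟨w', h1', h2', -⟩
      · exact hst (h.symm.trans (hab.trans h'))
      · have := (hout (hbq q) h1' (hI.1 h2')).1
        rw [← hab, h] at this
        rw [IsTransit] at hs
        omega
    · have hw := hout (haq q) h1 (hO.1 h2)
      rcases hb q with h' | ⟨w', h1', h2', h3'⟩
      · rw [hab, h'] at hw
        rw [IsTransit] at ht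
        omega
      · have hw' : Quotient.mk P w' ≠ q := fun hw' => h2'.ne ((hbq q).trans hw'.symm)
        rw [hw.2.2 w' hw' (hab ▸ h1'), ← hab] at h3'
        omega
  exact (hHe _ _ hta htb fun h => hab (congrArg Subtype.val h)).hasTripleOn
end

section
/- Let L and R be skew subquartics of a normal quartic G, i.e. V(L) ∩ V(R) is a nonempty proper subset of both V(L) and V(R). Then: (a) the subgraph of G induced by V(L) ∪ V(R) is a quartic; (b) G has exactly 2 edges with one endpoint in V(L) ∩ V(R) and the other in V(L) \ V(R), and these have distinct endpoints in V(L) ∩ V(R); similarly G has exactly 2 edges with one endpoint in V(L) ∩ V(R) and the other in V(R) \ V(L), and these have distinct endpoints in V(L) ∩ V(R); (c) G has no edge between V(L) \ V(R) and V(R) \ V(L); (d) the subgraphs of G induced by V(L) \ V(R), by V(R) \ V(L), and by V(L) ∩ V(R) are all 2T-graphs. -/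
open SimpleGraph

universe u

variable {V : Type u}

/-- The set of edges of `G` with one endpoint in `A` and the other in `B`. -/
def edgesBetween (G : SimpleGraph V) (A B : Set V) : Set (Sym2 V) :=
  {e | ∃ u v : V, e = s(u, v) ∧ G.Adj u v ∧ u ∈ A ∧ v ∈ B}

/-- The number of ordered pairs of adjacent vertices with first entry in `A` and second entry
in `B`. -/
noncomputable def dartCount (G : SimpleGraph V) (A B : Set V) : ℕ :=
  {p : V × V | p.1 ∈ A ∧ p.2 ∈ B ∧ G.Adj p.1 p.2}.ncard

theorem dartCount_comm (G : SimpleGraph V) (A B : Set V) :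
    dartCount G A B = dartCount G B A := by
  unfold dartCount
  rw [← Set.ncard_image_of_injective _ Prod.swap_injective]
  congr 1
  ext ⟨x, y⟩
  simp only [Set.image_swap_eq_preimage_swap, Set.mem_preimage, Set.mem_ofPred_eq, Prod.fst_swap,
    Prod.snd_swap, G.adj_comm y x]
  tauto

theorem dartCount_union_left [Finite V] (G : SimpleGraph V) {A A' : Set V} (B : Set V)
    (h : Disjoint A A') :
    dartCount G (A ∪ A') B = dartCount G A B + dartCount G A' B := by
  unfold dartCount
  rw [← Set.ncard_union_eq]
  · congr 1
    ext p
    simp only [Set.mem_union, Set.mem_ofPred_eq]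
    tauto
  · rw [Set.disjoint_left] at h ⊢
    exact fun p hp hp' => h hp.1 hp'.1

theorem dartCount_union_right [Finite V] (G : SimpleGraph V) {A A' : Set V} (B : Set V)
    (h : Disjoint A A') :
    dartCount G B (A ∪ A') = dartCount G B A + dartCount G B A' := by
  simp only [dartCount_comm G B, dartCount_union_left G B h]

theorem dartCount_union_self [Finite V] (G : SimpleGraph V) {A B : Set V} (h : Disjoint A B) :
    dartCount G (A ∪ B) (A ∪ B) =
      dartCount G A A + 2 * dartCount G A B + dartCount G B B := by
  rw [dartCount_union_left G _ h, dartCount_union_right G _ h, dartCount_union_right G _ h,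
    dartCount_comm G B A]
  ring

theorem dartCount_sup [Finite V] (I O : SimpleGraph V) (h : I ⊓ O = ⊥) (A B : Set V) :
    dartCount (I ⊔ O) A B = dartCount I A B + dartCount O A B := by
  unfold dartCount
  rw [← Set.ncard_union_eq]
  · congr 1
    ext p
    simp only [Set.mem_union, Set.mem_ofPred_eq, sup_adj]
    tauto
  · rw [Set.disjoint_left]
    intro p hp hp'
    have : (I ⊓ O).Adj p.1 p.2 := ⟨hp.2.2, hp'.2.2⟩
    rw [h] at this
    exact this

theorem dartCount_induce (G : SimpleGraph V) (S : Set V) :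
    dartCount (G.induce S) Set.univ Set.univ = dartCount G S S := by
  unfold dartCount
  rw [← Set.ncard_image_of_injective _
    (Subtype.val_injective.prodMap Subtype.val_injective : Function.Injective
      (Prod.map (Subtype.val : S → V) (Subtype.val : S → V)))]
  congr 1
  ext ⟨x, y⟩
  simp only [Set.mem_image, Set.mem_ofPred_eq, Prod.exists, Prod.map_apply, Prod.mk.injEq,
    Set.mem_univ, true_and, Subtype.exists, comap_adj, Function.Embedding.subtype_apply]
  constructor
  · rintro ⟨a, ha, b, hb, hab, rfl, rfl⟩
    exact ⟨ha, hb, hab⟩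
  · rintro ⟨hx, hy, h⟩
    exact ⟨x, hx, y, hy, h, rfl, rfl⟩

theorem dartCount_coe_le [Finite V] {G : SimpleGraph V} (H : G.Subgraph) :
    dartCount H.coe Set.univ Set.univ ≤ dartCount G H.verts H.verts := by
  unfold dartCount
  rw [← Set.ncard_image_of_injective _
    (Subtype.val_injective.prodMap Subtype.val_injective : Function.Injective
      (Prod.map (Subtype.val : H.verts → V) (Subtype.val : H.verts → V)))]
  apply Set.ncard_le_ncard _ (Set.toFinite _)
  rintro _ ⟨⟨a, b⟩, h, rfl⟩
  exact ⟨a.2, b.2, H.adj_sub h.2.2⟩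

theorem dartCount_univ [Fintype V] (G : SimpleGraph V) [DecidableRel G.Adj] :
    dartCount G Set.univ Set.univ = 2 * G.edgeFinset.card := by
  classical
  rw [two_mul_card_edgeFinset, dartCount, ← Set.ncard_coe_finset]
  congr 1
  ext p
  simp

theorem dartCount_univ_of_isTree [Finite V] {T : SimpleGraph V} (hT : T.IsTree) :
    dartCount T Set.univ Set.univ + 2 = 2 * Nat.card V := by
  classical
  have := Fintype.ofFinite V
  rw [dartCount_univ, Nat.card_eq_fintype_card, ← hT.card_edgeFinset]
  ring

theorem dartCount_univ_of_isAcyclic [Finite V] [Nonempty V] {T : SimpleGraph V}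
    (hT : T.IsAcyclic) :
    dartCount T Set.univ Set.univ + 2 ≤ 2 * Nat.card V ∧
      (dartCount T Set.univ Set.univ + 2 = 2 * Nat.card V → T.Connected) := by
  classical
  have := Fintype.ofFinite V
  obtain ⟨T', hle, -, hT'⟩ :=
    (connected_top (V := V)).exists_isTree_le_of_le_of_isAcyclic le_top hT
  rw [← dartCount_univ_of_isTree hT', dartCount_univ, dartCount_univ]
  have hsub := edgeFinset_mono hle
  refine ⟨by have := Finset.card_le_card hsub; omega, fun h => ?_⟩
  have := edgeFinset_inj.1 (Finset.eq_of_subset_of_card_le hsub (by omega))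
  exact this ▸ hT'.connected

theorem IsTwoT.dartCount_univ [Finite V] {G : SimpleGraph V} (h : IsTwoT G) :
    dartCount G Set.univ Set.univ + 4 = 4 * Nat.card V := by
  obtain ⟨-, I, O, ⟨-, hI, hI'⟩, ⟨-, hO, hO'⟩, hd, rfl⟩ := h
  have h1 := dartCount_univ_of_isTree ⟨hI, hI'⟩
  have h2 := dartCount_univ_of_isTree ⟨hO, hO'⟩
  rw [dartCount_sup _ _ hd]
  omega

theorem IsTwoT.dartCount_le [Finite V] {G : SimpleGraph V} (h : IsTwoT G) {S : Set V}
    (hS : S.Nonempty) : dartCount G S S + 4 ≤ 4 * S.ncard := by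
  obtain ⟨-, I, O, ⟨-, hI, hI'⟩, ⟨-, hO, hO'⟩, hd, rfl⟩ := h
  have := hS.to_subtype
  have h1 := (dartCount_univ_of_isAcyclic (hI'.induce S)).1
  have h2 := (dartCount_univ_of_isAcyclic (hO'.induce S)).1
  rw [dartCount_induce, Nat.card_coe_set_eq] at h1 h2
  rw [dartCount_sup _ _ hd]
  omega

theorem IsTwoT.induce_of_dartCount [Finite V] {G : SimpleGraph V} (h : IsTwoT G) {S : Set V}
    (hS : 2 ≤ S.ncard) (hSG : dartCount G S S + 4 = 4 * S.ncard) : IsTwoT (G.induce S) := by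
  obtain ⟨-, I, O, ⟨-, hI, hI'⟩, ⟨-, hO, hO'⟩, hd, rfl⟩ := h
  have : Nonempty S := (Set.nonempty_of_ncard_ne_zero (by omega : S.ncard ≠ 0)).to_subtype
  obtain ⟨h1, h1'⟩ := dartCount_univ_of_isAcyclic (hI'.induce S)
  obtain ⟨h2, h2'⟩ := dartCount_univ_of_isAcyclic (hO'.induce S)
  rw [dartCount_induce, Nat.card_coe_set_eq] at h1 h2 h1' h2'
  rw [dartCount_sup _ _ hd] at hSG
  refine ⟨by rwa [Nat.card_coe_set_eq], I.induce S, O.induce S,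
    ⟨fun _ _ h => Or.inl h, h1' (by omega), hI'.induce S⟩,
    ⟨fun _ _ h => Or.inr h, h2' (by omega), hO'.induce S⟩, ?_, ?_⟩
  · ext x y
    simpa using fun hx hy => (hd ▸ (⟨hx, hy⟩ : (I ⊓ O).Adj x y) : (⊥ : SimpleGraph V).Adj x y)
  · ext x y
    simp

theorem gdeg_le_of_injective {W : Type*} [Finite W] {H : SimpleGraph V} {G : SimpleGraph W}
    (f : H →g G) (hf : Function.Injective f) (v : V) : gdeg H v ≤ gdeg G (f v) := by
  unfold gdeg
  rw [← Set.ncard_image_of_injective _ hf]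
  apply Set.ncard_le_ncard _ (Set.toFinite _)
  rintro _ ⟨w, hw, rfl⟩
  exact f.map_adj hw

theorem dartCount_singleton (G : SimpleGraph V) (v : V) :
    dartCount G {v} Set.univ = gdeg G v := by
  unfold dartCount gdeg
  rw [← Set.ncard_image_of_injective (G.neighborSet v) (Prod.mk_right_injective v)]
  congr 1
  ext ⟨x, y⟩
  simp only [Set.mem_singleton_iff, Set.mem_univ, true_and, Set.mem_ofPred_eq, Set.mem_image,
    mem_neighborSet, Prod.mk.injEq]
  constructor
  · rintro ⟨rfl, h⟩
    exact ⟨y, h, rfl, rfl⟩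
  · rintro ⟨_, h, rfl, rfl⟩
    exact ⟨rfl, h⟩

theorem dartCount_le_of_gdeg_le [Finite V] {G : SimpleGraph V} {k : ℕ}
    (h : ∀ v, gdeg G v ≤ k) (S : Set V) : dartCount G S Set.univ ≤ k * S.ncard := by
  induction S, S.toFinite using Set.Finite.induction_on with
  | empty => simp [dartCount]
  | @insert v S hv _ ih =>
    rw [Set.ncard_insert_of_notMem hv, Set.insert_eq,
      dartCount_union_left _ _ (Set.disjoint_singleton_left.2 hv), dartCount_singleton]
    have := h v
    rw [mul_add]
    omega

theorem dartCount_eq_zero_iff [Finite V] {G : SimpleGraph V} {A B : Set V} :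
    dartCount G A B = 0 ↔ ∀ u v : V, u ∈ A → v ∈ B → ¬ G.Adj u v := by
  unfold dartCount
  rw [Set.ncard_eq_zero (Set.toFinite _), Set.eq_empty_iff_forall_notMem]
  simp

theorem ncard_edgesBetween (G : SimpleGraph V) {A B : Set V} (h : Disjoint A B) :
    (edgesBetween G A B).ncard = dartCount G A B := by
  unfold dartCount
  rw [← Set.InjOn.ncard_image (f := fun p : V × V => s(p.1, p.2))]
  · congr 1
    ext e
    simp only [edgesBetween, Set.mem_ofPred_eq, Set.mem_image, Prod.exists]
    constructor
    · rintro ⟨u, v, rfl, huv, hu, hv⟩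
      exact ⟨u, v, ⟨hu, hv, huv⟩, rfl⟩
    · rintro ⟨u, v, ⟨hu, hv, huv⟩, rfl⟩
      exact ⟨u, v, rfl, huv, hu, hv⟩
  · rintro ⟨a, b⟩ ⟨ha, hb, -⟩ ⟨c, d⟩ ⟨hc, hd, -⟩ hpq
    rcases Sym2.eq_iff.1 hpq with ⟨rfl, rfl⟩ | ⟨rfl, rfl⟩
    · rfl
    · exact (Set.disjoint_left.1 h ha hd).elim

/-- Two edges between disjoint sets which form a matching have distinct ends on both sides. -/
theorem exists_of_edgesBetween_matching {G : SimpleGraph V} {A B : Set V}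
    (hM : IsMatchingSet (edgesBetween G A B)) (hc : (edgesBetween G A B).ncard = 2) :
    ∃ a b a' b' : V, a ≠ b ∧ a' ≠ b' ∧ a ∈ A ∧ b ∈ A ∧ a' ∈ B ∧ b' ∈ B ∧
      G.Adj a a' ∧ G.Adj b b' ∧ edgesBetween G A B = {s(a, a'), s(b, b')} := by
  obtain ⟨e, f, hef, heq⟩ := Set.ncard_eq_two.1 hc
  have he : e ∈ edgesBetween G A B := heq ▸ Set.mem_insert _ _
  have hf : f ∈ edgesBetween G A B := heq ▸ Set.mem_insert_of_mem _ rfl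
  have hd := hM e he f hf hef
  obtain ⟨a, a', rfl, haa, ha, ha'⟩ := he
  obtain ⟨b, b', rfl, hbb, hb, hb'⟩ := hf
  refine ⟨a, b, a', b', ?_, ?_, ha, hb, ha', hb', haa, hbb, heq⟩
  · rintro rfl
    exact hd a (Sym2.mem_mk_left _ _) (Sym2.mem_mk_left _ _)
  · rintro rfl
    exact hd a' (Sym2.mem_mk_right _ _) (Sym2.mem_mk_right _ _)

theorem NormalQuartic.isMatchingSet_edgesBetween {G : SimpleGraph V} (hG : NormalQuartic G)
    {H : G.Subgraph} (hH : IsQuartic H.coe) {A B : Set V} (hA : A ⊆ H.verts)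
    (hB : Disjoint B H.verts) (hne : B.Nonempty) : IsMatchingSet (edgesBetween G A B) := by
  have hsub : edgesBetween G A B ⊆ edgeNbhd G H.verts := by
    rintro e ⟨u, v, rfl, huv, hu, hv⟩
    exact ⟨u, v, rfl, huv, hA hu, Set.disjoint_left.1 hB hv⟩
  have hM := (hG H hH (by
    rintro rfl
    obtain ⟨x, hx⟩ := hne
    exact Set.disjoint_left.1 hB hx trivial)).1
  exact fun e he f hf => hM e (hsub he) f (hsub hf)

theorem IsQuartic.coe_dartCount [Finite V] {G : SimpleGraph V} {H : G.Subgraph}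
    (hH : IsQuartic H.coe) : 4 * H.verts.ncard ≤ dartCount G H.verts H.verts + 4 := by
  have h1 := hH.1.dartCount_univ
  rw [Nat.card_coe_set_eq] at h1
  have := dartCount_coe_le H
  omega

theorem IsQuartic.three_le_gdeg_induce [Finite V] {G : SimpleGraph V} {H : G.Subgraph}
    (hH : IsQuartic H.coe) {S : Set V} (hS : H.verts ⊆ S) {v : V} (hv : v ∈ H.verts) :
    3 ≤ gdeg (G.induce S) ⟨v, hS hv⟩ := by
  have h1 := gdeg_le_of_injective
    (⟨Set.inclusion hS, fun h => H.adj_sub h⟩ : H.coe →g G.induce S)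
    (Set.inclusion_injective hS) ⟨v, hv⟩
  have h2 : 3 ≤ gdeg H.coe ⟨v, hv⟩ := by
    rcases hH.2 ⟨v, hv⟩ with h | h <;> omega
  exact h2.trans h1

/-- Properties of two skew subquartics `L`, `R` of a normal quartic `G`. -/
theorem stmt8 [Fintype V] (G : SimpleGraph V)
    (hGq : IsQuartic G) (hGn : NormalQuartic G)
    (L R : G.Subgraph) (hL : IsQuartic L.coe) (hR : IsQuartic R.coe)
    (hne : (L.verts ∩ R.verts).Nonempty)
    (hpL : L.verts ∩ R.verts ⊂ L.verts) (hpR : L.verts ∩ R.verts ⊂ R.verts) :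
    -- (a)
    IsQuartic (G.induce (L.verts ∪ R.verts)) ∧
    -- (b) exactly two edges from `L ∩ R` to `L \ R`, with distinct ends in `L ∩ R`
    ((edgesBetween G (L.verts ∩ R.verts) (L.verts \ R.verts)).ncard = 2 ∧
      (∃ a b a' b' : V, a ≠ b ∧ a ∈ L.verts ∩ R.verts ∧ b ∈ L.verts ∩ R.verts ∧
        a' ∈ L.verts \ R.verts ∧ b' ∈ L.verts \ R.verts ∧ G.Adj a a' ∧ G.Adj b b' ∧
        edgesBetween G (L.verts ∩ R.verts) (L.verts \ R.verts) = {s(a, a'), s(b, b')}) ∧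
      (edgesBetween G (L.verts ∩ R.verts) (R.verts \ L.verts)).ncard = 2 ∧
      (∃ c d c' d' : V, c ≠ d ∧ c ∈ L.verts ∩ R.verts ∧ d ∈ L.verts ∩ R.verts ∧
        c' ∈ R.verts \ L.verts ∧ d' ∈ R.verts \ L.verts ∧ G.Adj c c' ∧ G.Adj d d' ∧
        edgesBetween G (L.verts ∩ R.verts) (R.verts \ L.verts) = {s(c, c'), s(d, d')})) ∧
    -- (c) no edge between `L \ R` and `R \ L`
    (∀ u v : V, u ∈ L.verts \ R.verts → v ∈ R.verts \ L.verts → ¬ G.Adj u v) ∧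
    -- (d)
    (IsTwoT (G.induce (L.verts \ R.verts)) ∧ IsTwoT (G.induce (R.verts \ L.verts)) ∧
      IsTwoT (G.induce (L.verts ∩ R.verts))) := by
  have hdeg : ∀ v, gdeg G v ≤ 4 := fun v => by rcases hGq.2 v with h | h <;> omega
  have hAne : (L.verts \ R.verts).Nonempty :=
    Set.sdiff_nonempty.2 fun h => hpL.2 fun x hx => ⟨hx, h hx⟩
  have hBne : (R.verts \ L.verts).Nonempty :=
    Set.sdiff_nonempty.2 fun h => hpR.2 fun x hx => ⟨h hx, hx⟩
  have hL1 := hL.coe_dartCount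
  have hR1 := hR.coe_dartCount
  have hdegU : ∀ v : ↥(L.verts ∪ R.verts), gdeg (G.induce (L.verts ∪ R.verts)) v = 3 ∨
      gdeg (G.induce (L.verts ∪ R.verts)) v = 4 := by
    rintro ⟨v, hv⟩
    have h1 := (gdeg_le_of_injective (Embedding.induce (G := G) (L.verts ∪ R.verts)).toHom
      Subtype.val_injective ⟨v, hv⟩).trans (hdeg v)
    have h2 : 3 ≤ gdeg (G.induce (L.verts ∪ R.verts)) ⟨v, hv⟩ := by
      rcases hv with h | h
      · exact hL.three_le_gdeg_induce Set.subset_union_left h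
      · exact hR.three_le_gdeg_induce Set.subset_union_right h
    omega
  have hmA : IsMatchingSet (edgesBetween G (L.verts ∩ R.verts) (L.verts \ R.verts)) :=
    hGn.isMatchingSet_edgesBetween hR Set.inter_subset_right Set.disjoint_sdiff_left hAne
  have hmB : IsMatchingSet (edgesBetween G (L.verts ∩ R.verts) (R.verts \ L.verts)) :=
    hGn.isMatchingSet_edgesBetween hL Set.inter_subset_left Set.disjoint_sdiff_left hBne
  have eL : L.verts = (L.verts ∩ R.verts) ∪ (L.verts \ R.verts) :=
    (Set.inter_union_sdiff _ _).symm
  have eR : R.verts = (L.verts ∩ R.verts) ∪ (R.verts \ L.verts) := by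
    rw [Set.inter_comm, Set.inter_union_sdiff]
  have eU : L.verts ∪ R.verts =
      (L.verts ∩ R.verts) ∪ (L.verts \ R.verts) ∪ (R.verts \ L.verts) := by
    rw [Set.inter_union_sdiff, Set.union_sdiff_self]
  have dMA : Disjoint (L.verts ∩ R.verts) (L.verts \ R.verts) :=
    Set.disjoint_left.2 fun _ hx hy => hy.2 hx.2
  have dMB : Disjoint (L.verts ∩ R.verts) (R.verts \ L.verts) :=
    Set.disjoint_left.2 fun _ hx hy => hy.2 hx.1
  have dAB : Disjoint (L.verts \ R.verts) (R.verts \ L.verts) :=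
    Set.disjoint_left.2 fun _ hx hy => hx.2 hy.1
  generalize L.verts ∩ R.verts = M at *
  generalize L.verts \ R.verts = A at *
  generalize R.verts \ L.verts = B at *
  have dMAB : Disjoint (M ∪ A) B := Set.disjoint_union_left.2 ⟨dMB, dAB⟩
  rw [eL, dartCount_union_self _ dMA, Set.ncard_union_eq dMA] at hL1
  rw [eR, dartCount_union_self _ dMB, Set.ncard_union_eq dMB] at hR1
  rw [eU] at hdegU ⊢
  have fM := hGq.1.dartCount_le hne
  have fA := hGq.1.dartCount_le hAne
  have fB := hGq.1.dartCount_le hBne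
  have fU := hGq.1.dartCount_le (S := M ∪ A ∪ B) (hne.mono fun x hx => Or.inl (Or.inl hx))
  rw [dartCount_union_self _ dMAB, dartCount_union_self _ dMA, dartCount_union_left _ _ dMA,
    Set.ncard_union_eq dMAB, Set.ncard_union_eq dMA] at fU
  have hM4 := dartCount_le_of_gdeg_le hdeg M
  rw [← Set.union_compl_self (M ∪ A ∪ B), dartCount_union_right _ _ disjoint_compl_right,
    dartCount_union_right _ _ dMAB, dartCount_union_right _ _ dMA] at hM4
  have cA : dartCount G M A = 2 := by omega
  have cB : dartCount G M B = 2 := by omega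
  have cAB : dartCount G A B = 0 := by omega
  have nA := (ncard_edgesBetween G dMA).trans cA
  have nB := (ncard_edgesBetween G dMB).trans cB
  obtain ⟨a, b, a', b', hab, hab', ha, hb, ha', hb', haa, hbb, heA⟩ :=
    exists_of_edgesBetween_matching hmA nA
  obtain ⟨c, d, c', d', hcd, hcd', hc, hd, hc', hd', hcc, hdd, heB⟩ :=
    exists_of_edgesBetween_matching hmB nB
  have sM : 1 < M.ncard := (Set.one_lt_ncard (Set.toFinite _)).2 ⟨a, ha, b, hb, hab⟩
  have sA : 1 < A.ncard := (Set.one_lt_ncard (Set.toFinite _)).2 ⟨a', ha', b', hb', hab'⟩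
  have sB : 1 < B.ncard := (Set.one_lt_ncard (Set.toFinite _)).2 ⟨c', hc', d', hd', hcd'⟩
  refine ⟨⟨hGq.1.induce_of_dartCount ?_ ?_, hdegU⟩,
    ⟨nA, ⟨a, b, a', b', hab, ha, hb, ha', hb', haa, hbb, heA⟩,
      nB, ⟨c, d, c', d', hcd, hc, hd, hc', hd', hcc, hdd, heB⟩⟩,
    dartCount_eq_zero_iff.1 cAB,
    hGq.1.induce_of_dartCount sA (by omega), hGq.1.induce_of_dartCount sB (by omega),
    hGq.1.induce_of_dartCount sM (by omega)⟩
  · rw [Set.ncard_union_eq dMAB, Set.ncard_union_eq dMA]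
    omega
  · rw [dartCount_union_self _ dMAB, dartCount_union_self _ dMA, dartCount_union_left _ _ dMA,
      Set.ncard_union_eq dMAB, Set.ncard_union_eq dMA]
    omega
end
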